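/- arXiv:1701.03276 — 9 statements merged into one kernel-verified Lean document; each statement's English description precedes it below -/
import Mathlib

section
/- Let u(z,ε) be a function of two complex variables, analytic on a neighborhood of (0,0) in ℂ × ℂ. Assume that z ↦ u(z,0) has a zero of order exactly d at z = 0 (for some integer d ≥ 1) and that ∂u/∂ε(0,0) ≠ 0. Then there exist r, ρ > 0 and an injective analytic map g : B(0,r) → ℂ with g(0) = 0 and g'(0) ≠ 0, such that for all (z,ε) ∈ B(0,r) × B(0,ρ) one has u(z,ε) = 0 if and only if g(z)^d = ε. In other words, after the parameter-independent change of variable z̃ = g(z), the zero set of u_ε is exactly the set of solutions of z̃^d = ε. -/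
open Metric Set Filter Complex

open scoped Topology
open Asymptotics

/-- A product of `z ^ d` with a function continuous and nonzero at `0` is comparable to
`z ^ d`. -/
lemma isTheta_pow_of_eq_pow_mul {f k : ℂ → ℂ} {d : ℕ} (hk : ContinuousAt k 0) (hk0 : k 0 ≠ 0)
    (h : ∀ᶠ z in 𝓝 0, f z = z ^ d * k z) : f =Θ[𝓝 0] fun z => z ^ d := by
  have hk1 : k =Θ[𝓝 0] fun _ => (1 : ℂ) :=
    ((isEquivalent_const_iff_tendsto hk0).mpr hk).isTheta.trans
      (isTheta_const_const hk0 one_ne_zero)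
  have := (isTheta_refl (fun z : ℂ => z ^ d) (𝓝 0)).mul hk1
  simp only [mul_one] at this
  exact (EventuallyEq.isTheta h).trans this

/-- If `f z` is asymptotically comparable to `z ^ d` at `0`, then the analytic function `f` has
a zero of order exactly `d` at `0`. -/
lemma AnalyticAt.exists_eq_pow_mul_of_isTheta {f : ℂ → ℂ} {d : ℕ} (hf : AnalyticAt ℂ f 0)
    (h : f =Θ[𝓝 0] fun z => z ^ d) :
    ∃ k : ℂ → ℂ, AnalyticAt ℂ k 0 ∧ k 0 ≠ 0 ∧ ∀ᶠ z in 𝓝 0, f z = z ^ d * k z := by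
  have hfreq (n : ℕ) : ∃ᶠ z : ℂ in 𝓝 0, z ^ n ≠ 0 := by
    have : ∃ᶠ z : ℂ in 𝓝[≠] 0, z ^ n ≠ 0 :=
      Eventually.frequently <| eventually_mem_nhdsWithin.mono
        fun z (hz : z ∈ ({0}ᶜ : Set ℂ)) => pow_ne_zero n hz
    exact this.filter_mono nhdsWithin_le_nhds
  have hne : ¬ ∀ᶠ z in 𝓝 0, f z = 0 := fun h0 => by
    have hz : ∀ᶠ z : ℂ in 𝓝 0, z ^ d = 0 := by
      filter_upwards [h.symm.isBigO.eq_zero_imp, h0] with z h1 h2 using h1 h2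
    exact hfreq d (hz.mono fun z h1 h2 => h2 h1)
  obtain ⟨n, k, hk, hk0, hfk⟩ := hf.exists_eventuallyEq_pow_smul_nonzero_iff.mpr hne
  simp only [sub_zero, smul_eq_mul] at hfk
  have hdn := (isTheta_pow_of_eq_pow_mul hk.continuousAt hk0 hfk).symm.trans h
  obtain rfl : n = d := by
    rcases lt_trichotomy n d with hlt | heq | hlt
    · exact (isLittleO_irrefl (hfreq n)
        (hdn.trans_isLittleO (isLittleO_pow_pow hlt))).elim
    · exact heq
    · exact (isLittleO_irrefl (hfreq d)
        (hdn.symm.trans_isLittleO (isLittleO_pow_pow hlt))).elim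
  exact ⟨k, hk, hk0, hfk⟩

/-- A function analytic and nonzero at `a` has an analytic `d`-th root near `a`. -/
lemma AnalyticAt.exists_pow_eq {k : ℂ → ℂ} {d : ℕ} (hd : d ≠ 0) {a : ℂ} (hk : AnalyticAt ℂ k a)
    (hka : k a ≠ 0) : ∃ s : ℂ → ℂ, AnalyticAt ℂ s a ∧ ∀ z, s z ^ d = k z := by
  refine ⟨fun z => k a ^ (d⁻¹ : ℂ) * (k z / k a) ^ (d⁻¹ : ℂ), ?_, fun z => ?_⟩
  · refine analyticAt_const.mul (AnalyticAt.cpow (by fun_prop (disch := assumption))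
      analyticAt_const ?_)
    simp [hka]
  · rw [mul_pow, cpow_nat_inv_pow _ hd, cpow_nat_inv_pow _ hd, mul_div_cancel₀ _ hka]

open scoped ContDiff in
/-- The zero set of an analytic `F` with nonzero partial derivative in the second variable is
locally the graph of an analytic function, which is comparable to `z ↦ F (z, 0)`. -/
lemma AnalyticAt.exists_graph {F : ℂ × ℂ → ℂ} (hF : AnalyticAt ℂ F 0) (hF0 : F 0 = 0)
    (hderiv : deriv (fun ε => F (0, ε)) 0 ≠ 0) :
    ∃ φ : ℂ → ℂ, AnalyticAt ℂ φ 0 ∧ φ =Θ[𝓝 0] (fun z => F (z, 0)) ∧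
      ∀ᶠ p in 𝓝 (0 : ℂ × ℂ), F p = 0 ↔ φ p.1 = p.2 := by
  have hstrict : HasStrictFDerivAt F (fderiv ℂ F 0) 0 := hF.hasStrictFDerivAt
  have hpartial : fderiv ℂ F 0 (0, 1) = deriv (fun ε => F (0, ε)) 0 := by
    have h1 : HasDerivAt (fun ε : ℂ => ((0 : ℂ), ε)) (0, 1) 0 :=
      (hasDerivAt_const _ _).prodMk (hasDerivAt_id _)
    exact (hstrict.hasFDerivAt.comp_hasDerivAt (0 : ℂ) h1).deriv.symm
  set c := deriv (fun ε => F (0, ε)) 0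
  have hvert (w : ℂ) : fderiv ℂ F 0 (0, w) = c * w := by
    have : ((0 : ℂ), w) = w • ((0 : ℂ), (1 : ℂ)) := by simp
    rw [this, map_smul, hpartial, smul_eq_mul, mul_comm]
  have hinv : (fderiv ℂ F 0 ∘L .inr ℂ ℂ ℂ).IsInvertible := by
    refine ⟨ContinuousLinearEquiv.unitsEquivAut ℂ (Units.mk0 c hderiv), ?_⟩
    ext
    simp [hpartial]
  have hω : ContDiffAt ℂ ω F 0 := hF.contDiffAt
  have hω0 : (ω : WithTop ℕ∞) ≠ 0 := by simp
  set φ := hω.implicitFunction hω0 hinv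
  have hφan : AnalyticAt ℂ φ 0 := (hω.contDiffAt_implicitFunction hω0 hinv).analyticAt
  have hφ0 : φ 0 = 0 := hω.implicitFunction_apply_self hω0 hinv
  have hroot : ∀ᶠ z in 𝓝 0, F (z, φ z) = F 0 := hω.eventually_apply_implicitFunction hω0 hinv
  refine ⟨φ, hφan, ?_, ?_⟩
  · have htend : Tendsto (fun z => ((z, (0 : ℂ)), (z, φ z))) (𝓝 0)
        (𝓝 ((0 : ℂ × ℂ), (0 : ℂ × ℂ))) := by
      have : ContinuousAt (fun z => ((z, (0 : ℂ)), (z, φ z))) 0 := by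
        have := hφan.continuousAt
        fun_prop
      simpa only [ContinuousAt, hφ0, Prod.mk_zero_zero] using this
    have hlit := hstrict.isLittleO.comp_tendsto htend
    have hnorm : (fun z => (z, (0 : ℂ)) - (z, φ z)) =O[𝓝 0] φ :=
      IsBigO.of_bound 1 (.of_forall fun z => by simp)
    have hcφ : φ =Θ[𝓝 0] fun z => -(c * φ z) := by
      refine IsTheta.symm ?_
      simpa [← neg_mul] using (isTheta_const_mul_left (f := φ) (neg_ne_zero.mpr hderiv)).mpr
        (isTheta_refl φ (𝓝 0))
    have hequiv : IsEquivalent (𝓝 0) (fun z => F (z, 0)) fun z => -(c * φ z) := by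
      refine ((hlit.trans_isBigO hnorm).trans_isBigO hcφ.isBigO).congr' ?_ .rfl
      filter_upwards [hroot] with z hz
      simp [hz, hF0, hvert, -map_sub]
    exact hcφ.trans hequiv.isTheta.symm
  · simpa [hF0] using hω.eventually_apply_eq_iff_implicitFunction hω0 hinv

/-- If `u(z, ε)` is analytic on a neighborhood `U` of `(0,0)` in `ℂ × ℂ`,
`z ↦ u(z,0)` has a zero of exact order `d ≥ 1` at `0`, and `∂u/∂ε(0,0) ≠ 0`, then there are
radii `r, ρ > 0` and an injective analytic change of variable `g` on `B(0,r)` with `g 0 = 0`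
and `g' 0 ≠ 0` such that, on `B(0,r) × B(0,ρ)`, `u(z,ε) = 0 ↔ g(z)^d = ε`. -/
theorem statement0 (d : ℕ) (hd : 1 ≤ d) (u : ℂ → ℂ → ℂ)
    (U : Set (ℂ × ℂ)) (hUopen : IsOpen U) (hU0 : ((0 : ℂ), (0 : ℂ)) ∈ U)
    (hu : AnalyticOnNhd ℂ (fun p : ℂ × ℂ => u p.1 p.2) U)
    (hord : ∃ w : ℂ → ℂ, AnalyticAt ℂ w 0 ∧ w 0 ≠ 0 ∧
      ∀ᶠ z in nhds (0 : ℂ), u z 0 = z ^ d * w z)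
    (hgen : deriv (fun ε => u 0 ε) 0 ≠ 0) :
    ∃ (r ρ : ℝ) (g : ℂ → ℂ), 0 < r ∧ 0 < ρ ∧
      ball (0 : ℂ) r ×ˢ ball (0 : ℂ) ρ ⊆ U ∧
      AnalyticOnNhd ℂ g (ball 0 r) ∧ Set.InjOn g (ball 0 r) ∧
      g 0 = 0 ∧ deriv g 0 ≠ 0 ∧
      ∀ z ∈ ball (0 : ℂ) r, ∀ ε ∈ ball (0 : ℂ) ρ, (u z ε = 0 ↔ g z ^ d = ε) := by
  set F : ℂ × ℂ → ℂ := fun p => u p.1 p.2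
  obtain ⟨w, hw, hw0, huw⟩ := hord
  have hd0 : d ≠ 0 := by omega
  have hF0 : F 0 = 0 := by
    have := huw.self_of_nhds
    rwa [zero_pow hd0, zero_mul] at this
  obtain ⟨φ, hφ, hφθ, hgraph⟩ := (hu 0 hU0).exists_graph hF0 hgen
  have hθ : φ =Θ[𝓝 0] fun z => z ^ d :=
    hφθ.trans (isTheta_pow_of_eq_pow_mul hw.continuousAt hw0 huw)
  obtain ⟨k, hk, hk0, hφk⟩ := hφ.exists_eq_pow_mul_of_isTheta hθ
  obtain ⟨s, hs, hsk⟩ := hk.exists_pow_eq hd0 hk0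
  have hs0 : s 0 ≠ 0 := fun h => hk0 (by rw [← hsk, h, zero_pow hd0])
  set g : ℂ → ℂ := fun z => z * s z with hg
  have hgan : AnalyticAt ℂ g 0 := analyticAt_id.mul hs
  have hg' : deriv g 0 = s 0 := by
    have := ((hasDerivAt_id (0 : ℂ)).mul hs.differentiableAt.hasDerivAt).deriv
    rwa [id, one_mul, zero_mul, add_zero] at this
  have hg'0 : deriv g 0 ≠ 0 := hg' ▸ hs0
  have hinj := hgan.hasStrictDerivAt.eventually_left_inverse hg'0
  have hnear : ∀ᶠ p in 𝓝 (0 : ℂ × ℂ), p ∈ U ∧ (F p = 0 ↔ φ p.1 = p.2) :=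
    (hUopen.eventually_mem hU0).and hgraph
  obtain ⟨ρ, hρ, hρball⟩ := Metric.eventually_nhds_iff_ball.mp hnear
  obtain ⟨r, hr, hrball⟩ := Metric.eventually_nhds_iff_ball.mp
    ((hgan.eventually_analyticAt.and hinj).and hφk)
  have hsub : ∀ z ∈ ball (0 : ℂ) (min r ρ), ∀ ε ∈ ball (0 : ℂ) ρ,
      (z, ε) ∈ ball (0 : ℂ × ℂ) ρ := fun z hz ε hε => by
    rw [← Prod.mk_zero_zero, ← ball_prod_same]
    exact ⟨ball_subset_ball (min_le_right _ _) hz, hε⟩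
  have hmem : ∀ z ∈ ball (0 : ℂ) (min r ρ), z ∈ ball (0 : ℂ) r :=
    fun z hz => ball_subset_ball (min_le_left _ _) hz
  refine ⟨min r ρ, ρ, g, lt_min hr hρ, hρ, ?_, ?_, ?_, by simp [hg], hg'0, ?_⟩
  · rintro ⟨z, ε⟩ ⟨hz, hε⟩
    exact (hρball _ (hsub z hz ε hε)).1
  · exact fun z hz => (hrball z (hmem z hz)).1.1
  · intro x hx y hy hxy
    rw [← (hrball x (hmem x hx)).1.2, ← (hrball y (hmem y hy)).1.2, hxy]
  · intro z hz ε hε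
    rw [show g z ^ d = φ z by rw [(hrball z (hmem z hz)).2, hg, mul_pow, hsk]]
    exact (hρball _ (hsub z hz ε hε)).2
end

section
/- Let k ≥ 1 and let ω be a generic family unfolding a parabolic singular point of codimension k. Then there exist r, ρ > 0, an injective analytic map g : B(0,r) → ℂ with g(0) = 0 and g'(0) ≠ 0, and an analytic function v on a neighborhood of (0,0) in ℂ × ℂ with v(0,0) ≠ 0, such that g'(z)·ω(z,ε) = (g(z)^{k+1} − ε)·v(g(z), ε) for all (z,ε) ∈ B(0,r) × B(0,ρ). (That is, the parameter-independent change of variable z̃ = g(z) transforms the family of vector fields ż = ω(z,ε) into the factored form dz̃/dt = (z̃^{k+1} − ε)·v(z̃,ε).) -/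
open Metric Set Filter Complex

section Division

variable {𝕜 E F : Type*} [NontriviallyNormedField 𝕜] [NormedAddCommGroup E] [NormedSpace 𝕜 E]
  [NormedAddCommGroup F] [NormedSpace 𝕜 F]

/-- The formal quotient by a linear functional `ℓ` of the difference between a power series and
its composition with a linear map `π` satisfying `x - π x = ℓ x • e`. -/
noncomputable def FormalMultilinearSeries.divLinear (p : FormalMultilinearSeries 𝕜 E F)
    (π : E →L[𝕜] E) (e : E) : FormalMultilinearSeries 𝕜 E F := fun n =>
  ∑ i : Fin (n + 1), ((p (n + 1)).curryMid i e).compContinuousLinearMap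
    fun j => if i.succAbove j < i then ContinuousLinearMap.id 𝕜 E else π

theorem FormalMultilinearSeries.smul_divLinear (p : FormalMultilinearSeries 𝕜 E F)
    {π : E →L[𝕜] E} {e : E} {ℓ : E →L[𝕜] 𝕜} (hπ : ∀ x, x - π x = ℓ x • e) (n : ℕ) (x : E) :
    ℓ x • p.divLinear π e n (fun _ => x) =
      p (n + 1) (fun _ => x) - p (n + 1) (fun _ => π x) := by
  let T : ℕ → F := fun i => p (n + 1) fun j => if (j : ℕ) < i then x else π x
  have hT (i : Fin (n + 1)) :
      ℓ x • ((p (n + 1)).curryMid i e).compContinuousLinearMap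
        (fun j => if i.succAbove j < i then ContinuousLinearMap.id 𝕜 E else π) (fun _ => x) =
      T (i + 1) - T i := by
    set m : Fin n → E := fun j => if i.succAbove j < i then x else π x with hm
    have h1 : T (i + 1) = (p (n + 1)).curryMid i x m := by
      simp only [T, ContinuousMultilinearMap.curryMid_apply]
      congr 1
      ext j
      refine Fin.succAboveCases i ?_ (fun j => ?_) j
      · simp
      · have := Fin.succAbove_ne i j
        simp only [Fin.insertNth_apply_succAbove, hm]
        congr 1
        grind
    have h0 : T i = (p (n + 1)).curryMid i (π x) m := by
      simp only [T, ContinuousMultilinearMap.curryMid_apply]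
      congr 1
      ext j
      refine Fin.succAboveCases i ?_ (fun j => ?_) j
      · simp
      · simp only [Fin.insertNth_apply_succAbove, hm]
        rfl
    rw [h1, h0, ← _root_.sub_apply, ← map_sub, hπ, map_smul,
      _root_.smul_apply,
      ContinuousMultilinearMap.compContinuousLinearMap_apply]
    congr 2
    ext j
    simp only [hm]
    split_ifs <;> rfl
  rw [divLinear, _root_.sum_apply, Finset.smul_sum, Finset.sum_congr rfl
    fun i _ => hT i, Fin.sum_univ_eq_sum_range (fun i => T (i + 1) - T i), Finset.sum_range_sub]
  simp [T, Nat.le_of_lt_succ, Fin.is_le]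

theorem FormalMultilinearSeries.norm_divLinear_le (p : FormalMultilinearSeries 𝕜 E F)
    (π : E →L[𝕜] E) (e : E) (n : ℕ) :
    ‖p.divLinear π e n‖ ≤ (n + 1) * (‖p (n + 1)‖ * ‖e‖ * (1 + ‖π‖) ^ n) := by
  refine (norm_sum_le_of_le _ (fun i _ => ?_)).trans_eq
    (b := ∑ _i : Fin (n + 1), ‖p (n + 1)‖ * ‖e‖ * (1 + ‖π‖) ^ n) (by simp)
  refine (ContinuousMultilinearMap.norm_compContinuousLinearMap_le _ _).trans ?_
  gcongr
  · refine (ContinuousLinearMap.le_opNorm _ _).trans_eq ?_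
    rw [ContinuousMultilinearMap.norm_curryMid]
  · refine (Finset.prod_le_prod (g := fun _ => 1 + ‖π‖) (fun _ _ => norm_nonneg _) fun j _ => ?_).trans_eq (by simp)
    split_ifs
    · exact ContinuousLinearMap.norm_id_le.trans (by simp)
    · simp

theorem FormalMultilinearSeries.radius_divLinear_pos {p : FormalMultilinearSeries 𝕜 E F}
    (hp : 0 < p.radius) (π : E →L[𝕜] E) (e : E) : 0 < (p.divLinear π e).radius := by
  obtain ⟨C, a, hC, ha, hpa⟩ := p.le_mul_pow_of_radius_pos hp
  let r : NNReal := ⟨(2 * a * (1 + ‖π‖))⁻¹, by positivity⟩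
  have hr : 0 < r := by
    rw [← NNReal.coe_pos]
    change 0 < (2 * a * (1 + ‖π‖))⁻¹
    positivity
  refine lt_of_lt_of_le (ENNReal.coe_pos.2 hr)
    ((p.divLinear π e).le_radius_of_bound (C * a * ‖e‖) fun n => ?_)
  have hn : ((n : ℝ) + 1) ≤ 2 ^ n := by exact_mod_cast Nat.lt_two_pow_self (n := n)
  calc ‖p.divLinear π e n‖ * (r : ℝ) ^ n
      ≤ 2 ^ n * (C * a ^ (n + 1) * ‖e‖ * (1 + ‖π‖) ^ n) * ((2 * a * (1 + ‖π‖))⁻¹) ^ n := by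
        refine mul_le_mul_of_nonneg_right ((p.norm_divLinear_le π e n).trans ?_) (by positivity)
        gcongr
        exact hpa _
    _ = C * a * ‖e‖ := by
        have : 1 + ‖π‖ ≠ 0 := by positivity
        rw [inv_pow, mul_pow, mul_pow]
        field_simp
        ring

/-- Let `π` be the linear map `x ↦ x - ℓ x • e`. If `f` is analytic at `0` and `f ∘ π` vanishes
near `0`, then `f` is the product of `ℓ` and a function analytic at `0`. -/
theorem AnalyticAt.exists_eq_smul_of_eventually_eq_zero [CompleteSpace F] {f : E → F}
    (hf : AnalyticAt 𝕜 f 0) {π : E →L[𝕜] E} {e : E} {ℓ : E →L[𝕜] 𝕜}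
    (hπ : ∀ x, x - π x = ℓ x • e) (h0 : ∀ᶠ x in nhds (0 : E), f (π x) = 0) :
    ∃ h : E → F, AnalyticAt 𝕜 h 0 ∧ ∀ᶠ x in nhds (0 : E), f x = ℓ x • h x := by
  obtain ⟨p, hp⟩ := hf
  have hrad : 0 < p.radius := by
    obtain ⟨r, hr⟩ := hp
    exact hr.r_pos.trans_le hr.r_le
  have hq := (p.divLinear π e).hasFPowerSeriesOnBall
    (FormalMultilinearSeries.radius_divLinear_pos hrad π e)
  refine ⟨_, hq.analyticAt, ?_⟩
  have hπ0 : Tendsto π (nhds 0) (nhds 0) := by simpa using π.continuous.tendsto 0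
  have hp' := hp.eventually_hasSum
  filter_upwards [hp', hπ0.eventually hp', h0, hq.hasFPowerSeriesAt.eventually_hasSum]
    with x h1 h2 h3 h4
  simp only [zero_add] at h1 h2 h4
  have h5 := h1.sub h2
  rw [← hasSum_nat_add_iff' 1] at h5
  have h6 := h4.const_smul (ℓ x)
  simp only [FormalMultilinearSeries.smul_divLinear p hπ] at h6
  have h7 := h5.unique h6
  rw [← h7, h3]
  simp [Subsingleton.elim (fun _ : Fin 0 => x) (fun _ => π x)]

end Division

theorem AnalyticAt.exists_pow_eventuallyEq {W : ℂ → ℂ} {a : ℂ} (hW : AnalyticAt ℂ W a)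
    (ha : W a ≠ 0) {n : ℕ} (hn : n ≠ 0) :
    ∃ φ : ℂ → ℂ, AnalyticAt ℂ φ a ∧ φ a ≠ 0 ∧ ∀ z, φ z ^ n = W z := by
  refine ⟨fun z => W a ^ (n⁻¹ : ℂ) * (W z / W a) ^ (n⁻¹ : ℂ), ?_, ?_, fun z => ?_⟩
  · refine analyticAt_const.mul ((hW.div analyticAt_const ha).cpow analyticAt_const ?_)
    simp [ha]
  · simp [ha]
  · rw [mul_pow, cpow_nat_inv_pow _ hn, cpow_nat_inv_pow _ hn, mul_div_cancel₀ _ ha]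

/-- Weierstrass preparation in degree one: a function of two variables with a simple zero in the
second variable is a unit times the equation of a graph. -/
theorem AnalyticAt.exists_eq_graph_sub_mul {f : ℂ × ℂ → ℂ} (hf : AnalyticAt ℂ f 0)
    (h0 : f 0 = 0) (hd : deriv (fun ε => f (0, ε)) 0 ≠ 0) :
    ∃ (s : ℂ → ℂ) (h : ℂ × ℂ → ℂ), AnalyticAt ℂ s 0 ∧ s 0 = 0 ∧ AnalyticAt ℂ h 0 ∧ h 0 ≠ 0 ∧
      ∀ᶠ p in nhds (0 : ℂ × ℂ), f p = (s p.1 - p.2) * h p := by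
  have hc : ContDiffAt ℂ (⊤ : WithTop ℕ∞) f 0 := hf.contDiffAt
  have hinv : (fderiv ℂ f 0 ∘L .inr ℂ ℂ ℂ).IsInvertible := by
    refine ⟨ContinuousLinearEquiv.unitsEquivAut ℂ (Units.mk0 _ hd), ?_⟩
    have h1 : HasDerivAt (fun ε => f (0, ε)) (fderiv ℂ f 0 (0, 1)) 0 :=
      HasFDerivAt.comp_hasDerivAt (l := f) (f := fun ε : ℂ => ((0 : ℂ), ε)) (0 : ℂ)
        hf.differentiableAt.hasFDerivAt ((hasDerivAt_const _ _).prodMk (hasDerivAt_id _))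
    ext
    simp [h1.deriv]
  obtain ⟨s, hs, hs0, hsf⟩ : ∃ s : ℂ → ℂ, AnalyticAt ℂ s 0 ∧ s 0 = 0 ∧
      ∀ᶠ z in nhds (0 : ℂ), f (z, s z) = 0 :=
    ⟨hc.implicitFunction (by simp) hinv,
      (ContDiffAt.analyticAt (hc.contDiffAt_implicitFunction (by simp) hinv)),
      hc.implicitFunction_apply_self (by simp) hinv,
      by simpa [h0] using hc.eventually_apply_implicitFunction (by simp) hinv⟩
  have hs1 : AnalyticAt ℂ (fun p : ℂ × ℂ => s p.1) 0 :=
    AnalyticAt.fun_comp (f := Prod.fst) hs analyticAt_fst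
  have hg : AnalyticAt ℂ (fun p : ℂ × ℂ => f (p.1, s p.1 + p.2)) 0 := by
    refine AnalyticAt.fun_comp (g := f) ?_ (analyticAt_fst.prod (hs1.add analyticAt_snd))
    simpa [hs0, Prod.mk_zero_zero] using hf
  have hfst : Tendsto Prod.fst (nhds (0 : ℂ × ℂ)) (nhds 0) := continuous_fst.tendsto _
  obtain ⟨H, hH, hHf⟩ := hg.exists_eq_smul_of_eventually_eq_zero
    (π := (ContinuousLinearMap.fst ℂ ℂ ℂ).prod 0) (e := (0, 1))
    (ℓ := ContinuousLinearMap.snd ℂ ℂ ℂ) (fun x => by ext <;> simp)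
    (by simpa using hfst.eventually hsf)
  have hA : AnalyticAt ℂ (fun p : ℂ × ℂ => (p.1, p.2 - s p.1)) 0 :=
    analyticAt_fst.prod (analyticAt_snd.sub hs1)
  have hA0 : Tendsto (fun p : ℂ × ℂ => (p.1, p.2 - s p.1)) (nhds 0) (nhds 0) := by
    simpa [hs0, Prod.mk_zero_zero] using hA.continuousAt.tendsto
  have hmain : ∀ᶠ p in nhds (0 : ℂ × ℂ), f p = (s p.1 - p.2) * -H (p.1, p.2 - s p.1) := by
    filter_upwards [hA0.eventually hHf] with p hp
    simp only [add_sub_cancel, ContinuousLinearMap.coe_snd', smul_eq_mul] at hp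
    rw [hp]
    ring
  refine ⟨s, fun p => -H (p.1, p.2 - s p.1), hs, hs0, ?_, fun hH0 => hd ?_, hmain⟩
  · refine (AnalyticAt.fun_comp (g := H) ?_ hA).neg
    simpa [hs0, Prod.mk_zero_zero] using hH
  · have hi : Tendsto (fun ε : ℂ => ((0 : ℂ), ε)) (nhds 0) (nhds 0) :=
      (Continuous.prodMk_right (0 : ℂ)).tendsto 0
    have heq : (fun ε => f (0, ε)) =ᶠ[nhds 0] fun ε => ε * H (0, ε) := by
      filter_upwards [hi.eventually hmain] with ε hε
      rw [hε]
      simp [hs0]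
    have hHd : DifferentiableAt ℂ (fun ε : ℂ => H (0, ε)) 0 :=
      (AnalyticAt.fun_comp (g := H) (f := fun ε : ℂ => ((0 : ℂ), ε)) hH
        (analyticAt_const.prod analyticAt_id)).differentiableAt
    have hH0' : H (0, 0) = 0 := by simpa [hs0] using hH0
    rw [heq.deriv_eq, ((hasDerivAt_id' (0 : ℂ)).fun_mul hHd.hasDerivAt).deriv]
    simp [hH0']

/-- A generic family `ω(z,ε)` unfolding a parabolic point of codimension `k`
can be brought, by a parameter-independent injective analytic change of variable `g`,
to the factored form `(g(z)^{k+1} − ε)·v(g(z),ε)` with `v` analytic near `(0,0)`, `v(0,0) ≠ 0`. -/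
theorem statement1 (k : ℕ) (hk : 1 ≤ k) (ω : ℂ → ℂ → ℂ)
    (U : Set (ℂ × ℂ)) (hUopen : IsOpen U) (hU0 : ((0 : ℂ), (0 : ℂ)) ∈ U)
    (hω : AnalyticOnNhd ℂ (fun p : ℂ × ℂ => ω p.1 p.2) U)
    (hord : ∃ w : ℂ → ℂ, AnalyticAt ℂ w 0 ∧ w 0 ≠ 0 ∧
      ∀ᶠ z in nhds (0 : ℂ), ω z 0 = z ^ (k + 1) * w z)
    (hgen : deriv (fun ε => ω 0 ε) 0 ≠ 0) :
    ∃ (r ρ : ℝ) (g : ℂ → ℂ) (v : ℂ → ℂ → ℂ), 0 < r ∧ 0 < ρ ∧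
      ball (0 : ℂ) r ×ˢ ball (0 : ℂ) ρ ⊆ U ∧
      AnalyticOnNhd ℂ g (ball 0 r) ∧ Set.InjOn g (ball 0 r) ∧
      g 0 = 0 ∧ deriv g 0 ≠ 0 ∧
      AnalyticAt ℂ (fun p : ℂ × ℂ => v p.1 p.2) (0, 0) ∧ v 0 0 ≠ 0 ∧
      ∀ z ∈ ball (0 : ℂ) r, ∀ ε ∈ ball (0 : ℂ) ρ,
        deriv g z * ω z ε = (g z ^ (k + 1) - ε) * v (g z) ε := by
  obtain ⟨w, hw, hw0, hωw⟩ := hord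
  have hf : AnalyticAt ℂ (fun p : ℂ × ℂ => ω p.1 p.2) 0 := hω _ hU0
  have hf0 : ω 0 0 = 0 := by simpa using hωw.self_of_nhds
  obtain ⟨s, h, hs, hs0, hh, hh0, hfac⟩ := hf.exists_eq_graph_sub_mul hf0 hgen
  have hi : Tendsto (fun z : ℂ => (z, (0 : ℂ))) (nhds 0) (nhds 0) :=
    (Continuous.prodMk_left (0 : ℂ)).tendsto 0
  have hh1 : AnalyticAt ℂ (fun z : ℂ => h (z, 0)) 0 :=
    AnalyticAt.fun_comp (g := h) (f := fun z : ℂ => (z, (0 : ℂ))) hh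
      (analyticAt_id.prod analyticAt_const)
  obtain ⟨φ, hφ, hφ0, hφW⟩ := (hw.div hh1 hh0).exists_pow_eventuallyEq
    (div_ne_zero hw0 hh0) k.succ_ne_zero
  set g : ℂ → ℂ := fun z => z * φ z with hg_def
  have hg : AnalyticAt ℂ g 0 := analyticAt_id.mul hφ
  have hg0 : g 0 = 0 := by simp [hg_def]
  have hg' : deriv g 0 ≠ 0 := by
    have := ((hasDerivAt_id' (0 : ℂ)).fun_mul hφ.differentiableAt.hasDerivAt).deriv
    have h2 : deriv g 0 = φ 0 := by simpa using this
    rwa [h2]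
  have hgs : ∀ᶠ z in nhds (0 : ℂ), g z ^ (k + 1) = s z := by
    filter_upwards [hωw, hi.eventually hfac, hh1.continuousAt.eventually_ne hh0] with z h1 h2 h3
    have h4 : z ^ (k + 1) * w z = s z * h (z, 0) := by
      rw [← h1, h2, sub_zero]
    rw [hg_def, mul_pow, hφW, Pi.div_apply, ← mul_div_assoc, h4, mul_div_cancel_right₀ _ h3]
  obtain ⟨G, hG, hGg⟩ : ∃ G : ℂ → ℂ, AnalyticAt ℂ G 0 ∧ ∀ᶠ z in nhds (0 : ℂ), G (g z) = z :=
    ⟨_, by simpa only [hg0] using hg.analyticAt_localInverse hg',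
      hg.hasStrictDerivAt.eventually_left_inverse hg'⟩
  have hG0 : G 0 = 0 := by simpa [hg0] using hGg.self_of_nhds
  have hG1 : AnalyticAt ℂ (fun p : ℂ × ℂ => G p.1) (0, 0) :=
    AnalyticAt.fun_comp (f := Prod.fst) hG analyticAt_fst
  have hfst : Tendsto Prod.fst (nhds (0 : ℂ × ℂ)) (nhds 0) := continuous_fst.tendsto _
  obtain ⟨r, hr, hball⟩ := Metric.eventually_nhds_iff_ball.1
    ((hUopen.eventually_mem hU0 : ∀ᶠ p in nhds (0 : ℂ × ℂ), p ∈ U).and <| hfac.and <|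
      hfst.eventually <| hg.eventually_analyticAt.and <| hgs.and hGg)
  have hprod : ball (0 : ℂ) r ×ˢ ball (0 : ℂ) r = ball (0 : ℂ × ℂ) r := ball_prod_same _ _ _
  have hball1 (z : ℂ) (hz : z ∈ ball (0 : ℂ) r) := (hball (z, 0) (hprod ▸ ⟨hz, by simpa⟩)).2.2
  refine ⟨r, r, g, fun y ε => deriv g (G y) * h (G y, ε), hr, hr,
    fun p hp => (hball p (hprod ▸ hp)).1, fun z hz => (hball1 z hz).1, fun z hz z' hz' hzz' => ?_,
    hg0, hg', ?_, ?_, fun z hz ε hε => ?_⟩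
  · exact (hball1 z hz).2.2.symm.trans ((congrArg G hzz').trans (hball1 z' hz').2.2)
  · refine (AnalyticAt.fun_comp (g := deriv g) ?_ hG1).mul
      (AnalyticAt.fun_comp (g := h) ?_ (hG1.prod analyticAt_snd))
    · simpa [hG0] using hg.deriv
    · simpa [hG0, Prod.mk_zero_zero] using hh
  · simpa [hG0, Prod.mk_zero_zero] using And.intro hg' hh0
  · obtain ⟨-, h2, -, h4, h5⟩ := hball (z, ε) (hprod ▸ ⟨hz, hε⟩)
    simp only at h2 h4 h5 ⊢
    rw [h2, h4, h5]
    ring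
end

section
/- Let k ≥ 1 and let ω be a generic family unfolding a parabolic singular point of codimension k. Suppose g and ḡ are two injective analytic maps defined on disks around 0 with g(0) = ḡ(0) = 0 and g'(0), ḡ'(0) ≠ 0, and suppose there are analytic functions v and v̄ near (0,0) with v(0,0) ≠ 0 and v̄(0,0) ≠ 0 such that, for all (z,ε) in a neighborhood of (0,0): g'(z)·ω(z,ε) = (g(z)^{k+1} − ε)·v(g(z),ε) and ḡ'(z)·ω(z,ε) = (ḡ(z)^{k+1} − ε)·v̄(ḡ(z),ε). Then there exists ζ ∈ ℂ with ζ^{k+1} = 1 such that ḡ(z) = ζ·g(z) for all z in a neighborhood of 0. In particular, the change of coordinate bringing ω to factored form is completely determined by its derivative at 0, which can take exactly k+1 values. -/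
open Metric Set Filter Complex

/-- Two functions analytic at a point whose `n`-th powers agree near that point differ by an
`n`-th root of unity. -/
theorem AnalyticAt.exists_rootOfUnity_of_pow_eventuallyEq {f h : ℂ → ℂ} {x : ℂ} {n : ℕ}
    (hn : 0 < n) (hf : AnalyticAt ℂ f x) (hh : AnalyticAt ℂ h x)
    (hpow : ∀ᶠ z in nhds x, h z ^ n = f z ^ n) :
    ∃ ζ : ℂ, ζ ^ n = 1 ∧ ∀ᶠ z in nhds x, h z = ζ * f z := by
  by_contra! hcon
  have hne : ∀ ζ ∈ Polynomial.nthRootsFinset n (1 : ℂ),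
      ∀ᶠ z in nhdsWithin x {x}ᶜ, h z - ζ * f z ≠ 0 := by
    intro ζ hζ
    have hζ1 := (Polynomial.mem_nthRootsFinset hn 1).1 hζ
    refine ((hh.sub (analyticAt_const.mul hf)).eventually_eq_zero_or_eventually_ne_zero).resolve_left
      fun hzero => hcon ζ hζ1 ?_
    filter_upwards [hzero] with z hz
    exact not_not.2 (sub_eq_zero.1 hz)
  obtain ⟨z, hz, hzpow⟩ :=
    (((eventually_all_finset _).2 hne).and (hpow.filter_mono nhdsWithin_le_nhds)).exists
  by_cases hfz : f z = 0
  · have hhz : h z = 0 := by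
      rw [hfz, zero_pow hn.ne'] at hzpow
      exact eq_zero_of_pow_eq_zero hzpow
    exact hz 1 ((Polynomial.mem_nthRootsFinset hn 1).2 (one_pow n)) (by simp [hfz, hhz])
  · refine hz (h z / f z) ((Polynomial.mem_nthRootsFinset hn 1).2 ?_) ?_
    · rw [div_pow, hzpow, div_self (pow_ne_zero n hfz)]
    · rw [div_mul_cancel₀ _ hfz, sub_self]

/-- Two parameter-independent changes of variable `g`, `ḡ` bringing a generic
family `ω` of codimension `k` to the factored form `(z̃^{k+1} − ε)·v(z̃,ε)` differ by
multiplication by a `(k+1)`-st root of unity: `ḡ = ζ·g` near `0` for some `ζ^{k+1} = 1`. -/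
theorem statement2 (k : ℕ) (hk : 1 ≤ k) (ω : ℂ → ℂ → ℂ)
    (hω : AnalyticAt ℂ (fun p : ℂ × ℂ => ω p.1 p.2) (0, 0))
    (hord : ∃ w : ℂ → ℂ, AnalyticAt ℂ w 0 ∧ w 0 ≠ 0 ∧
      ∀ᶠ z in nhds (0 : ℂ), ω z 0 = z ^ (k + 1) * w z)
    (hgen : deriv (fun ε => ω 0 ε) 0 ≠ 0)
    (g gbar : ℂ → ℂ) (v vbar : ℂ → ℂ → ℂ) (r rbar : ℝ)
    (hr : 0 < r) (hg : AnalyticOnNhd ℂ g (ball 0 r)) (hginj : Set.InjOn g (ball 0 r))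
    (hg0 : g 0 = 0) (hg' : deriv g 0 ≠ 0)
    (hrbar : 0 < rbar) (hgbar : AnalyticOnNhd ℂ gbar (ball 0 rbar))
    (hgbarinj : Set.InjOn gbar (ball 0 rbar))
    (hgbar0 : gbar 0 = 0) (hgbar' : deriv gbar 0 ≠ 0)
    (hv : AnalyticAt ℂ (fun p : ℂ × ℂ => v p.1 p.2) (0, 0)) (hv0 : v 0 0 ≠ 0)
    (hvbar : AnalyticAt ℂ (fun p : ℂ × ℂ => vbar p.1 p.2) (0, 0)) (hvbar0 : vbar 0 0 ≠ 0)
    (heq : ∀ᶠ p : ℂ × ℂ in nhds (0, 0),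
      deriv g p.1 * ω p.1 p.2 = (g p.1 ^ (k + 1) - p.2) * v (g p.1) p.2)
    (heqbar : ∀ᶠ p : ℂ × ℂ in nhds (0, 0),
      deriv gbar p.1 * ω p.1 p.2 = (gbar p.1 ^ (k + 1) - p.2) * vbar (gbar p.1) p.2) :
    ∃ ζ : ℂ, ζ ^ (k + 1) = 1 ∧ ∀ᶠ z in nhds (0 : ℂ), gbar z = ζ * g z := by
  have hga : AnalyticAt ℂ g 0 := hg 0 (mem_ball_self hr)
  have hgba : AnalyticAt ℂ gbar 0 := hgbar 0 (mem_ball_self hrbar)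
  refine hga.exists_rootOfUnity_of_pow_eventuallyEq k.succ_pos hgba ?_
  have hε : Tendsto (fun z => g z ^ (k + 1)) (nhds 0) (nhds 0) := by
    simpa [hg0] using hga.continuousAt.tendsto.pow (k + 1)
  have hcurve : Tendsto (fun z => (z, g z ^ (k + 1))) (nhds 0) (nhds ((0 : ℂ), (0 : ℂ))) :=
    tendsto_id.prodMk_nhds hε
  have hcurvebar : Tendsto (fun z => (gbar z, g z ^ (k + 1))) (nhds 0)
      (nhds ((0 : ℂ), (0 : ℂ))) :=
    Tendsto.prodMk_nhds (by simpa [hgbar0] using hgba.continuousAt.tendsto) hε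
  have hvne := hcurvebar.eventually (hvbar.continuousAt.eventually_ne hvbar0)
  filter_upwards [hcurve.eventually heq, hcurve.eventually heqbar, hvne,
    hga.deriv.continuousAt.eventually_ne hg'] with z h₁ h₂ h₃ h₄
  have hωz : ω z (g z ^ (k + 1)) = 0 := by simpa [h₄] using h₁
  rw [hωz, mul_zero] at h₂
  exact sub_eq_zero.1 ((mul_eq_zero.1 h₂.symm).resolve_right h₃)
end

section
/- Let k ≥ 0 and let λ and λ̃ be analytic functions on an open disk D = B(0,R) ⊂ ℂ. Suppose that for every δ ∈ D there exists ζ ∈ ℂ with ζ^{k+1} = 1 (depending on δ) such that λ̃(δ) = λ(ζ·δ). Then there exists a single ζ ∈ ℂ with ζ^{k+1} = 1 such that λ̃(δ) = λ(ζ·δ) for all δ ∈ D. -/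
open Metric Set Filter Complex

/-- If `λ, λ̃` are analytic on the disk `B(0,R)` and for every `δ` there is
a `(k+1)`-st root of unity `ζ` (depending on `δ`) with `λ̃(δ) = λ(ζ·δ)`, then a single such
`ζ` works for all `δ` in the disk. -/
theorem statement5 (k : ℕ) (R : ℝ) (hR : 0 < R) (lam tlam : ℂ → ℂ)
    (hlam : AnalyticOnNhd ℂ lam (ball 0 R))
    (htlam : AnalyticOnNhd ℂ tlam (ball 0 R))
    (h : ∀ δ ∈ ball (0 : ℂ) R, ∃ ζ : ℂ, ζ ^ (k + 1) = 1 ∧ tlam δ = lam (ζ * δ)) :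
    ∃ ζ : ℂ, ζ ^ (k + 1) = 1 ∧ ∀ δ ∈ ball (0 : ℂ) R, tlam δ = lam (ζ * δ) := by
  have hmem : ∀ ζ : ℂ, ζ ^ (k + 1) = 1 → MapsTo (ζ * ·) (ball (0 : ℂ) R) (ball 0 R) := by
    intro ζ hζ z hz
    simpa [Complex.norm_eq_one_of_pow_eq_one hζ k.succ_ne_zero] using hz
  have hrot : ∀ ζ : ℂ, ζ ^ (k + 1) = 1 →
      AnalyticOnNhd ℂ (fun z => lam (ζ * z)) (ball 0 R) := fun ζ hζ =>
    hlam.comp (analyticOnNhd_const.mul analyticOnNhd_id) (hmem ζ hζ)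
  by_contra! hne
  have hev : ∀ ζ ∈ Polynomial.nthRootsFinset (k + 1) (1 : ℂ),
      ∀ᶠ z in nhdsWithin (0 : ℂ) {0}ᶜ, tlam z ≠ lam (ζ * z) := by
    intro ζ hζ
    have hζ' : ζ ^ (k + 1) = 1 := (Polynomial.mem_nthRootsFinset k.succ_pos 1).1 hζ
    obtain ⟨δ, hδ, hδne⟩ := hne ζ hζ'
    by_contra hfreq
    exact hδne (htlam.eqOn_of_preconnected_of_frequently_eq (hrot ζ hζ')
      (convex_ball 0 R).isPreconnected (mem_ball_self hR) hfreq hδ)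
  have hball : ∀ᶠ z in nhdsWithin (0 : ℂ) {0}ᶜ, z ∈ ball (0 : ℂ) R :=
    mem_nhdsWithin_of_mem_nhds (ball_mem_nhds 0 hR)
  obtain ⟨z, hz, hzR⟩ := (((eventually_all_finset _).2 hev).and hball).exists
  obtain ⟨ζ, hζ, hzζ⟩ := h z hzR
  exact hz ζ ((Polynomial.mem_nthRootsFinset k.succ_pos 1).2 hζ) hzζ
end

section
/- Let k ≥ 1 and let ω(z,ε) = (z^{k+1} − ε)·v(z,ε) and ω̃(z,ε) = (z^{k+1} − ε)·ṽ(z,ε) be two factored families of codimension k, with natural eigenvalue functions λ and λ̃ respectively. Suppose there exists ζ ∈ ℂ with ζ^{k+1} = 1 such that λ(δ) = λ̃(ζ·δ) for all δ in a neighborhood of 0. Then there exists a parameter-preserving conjugacy from ω to ω̃: i.e., there exist r, ρ > 0 and an analytic map ψ : B(0,r) × B(0,ρ) → ℂ with ψ(0,0) = 0 such that z ↦ ψ(z,ε) is injective for each ε ∈ B(0,ρ), and ∂ψ/∂z(z,ε)·ω(z,ε) = ω̃(ψ(z,ε), ε) for all (z,ε) ∈ B(0,r) × B(0,ρ). Moreover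 ψ can be chosen so that ψ(0,ε) = 0 for all ε ∈ B(0,ρ). -/
open Metric Set Filter Complex

/-- The average of an analytic function over the segment `[a, a + b]` depends analytically on
`(a, b)`, near a degenerate segment. -/
theorem AnalyticAt.integral_segment {E F : Type*} [NormedAddCommGroup E] [NormedSpace ℂ E]
    [NormedAddCommGroup F] [NormedSpace ℂ F] [CompleteSpace F] {f : E → F} {x : E}
    (hf : AnalyticAt ℂ f x) :
    AnalyticAt ℂ (fun q : E × E => ∫ s in (0 : ℝ)..1, f (q.1 + (s : ℂ) • q.2)) (x, 0) := by
  obtain ⟨p, r, hp⟩ := hf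
  let L : ℝ → E × E →L[ℂ] E := fun s =>
    ContinuousLinearMap.fst ℂ E E + (s : ℂ) • ContinuousLinearMap.snd ℂ E E
  have hLc : Continuous L := by fun_prop
  have hL : ∀ s ∈ uIoc (0 : ℝ) 1, ‖L s‖ ≤ 2 := by
    intro s hs
    rw [uIoc_of_le zero_le_one] at hs
    refine (norm_add_le _ _).trans ?_
    have h1 := ContinuousLinearMap.norm_fst_le ℂ E E
    have h2 := ContinuousLinearMap.norm_snd_le ℂ E E
    have h3 : ‖(s : ℂ)‖ ≤ 1 := by
      rw [Complex.norm_real, Real.norm_of_nonneg hs.1.le]; exact hs.2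
    have h4 := mul_le_mul h3 h2 (norm_nonneg _) zero_le_one
    rw [norm_smul]
    linarith
  let c : ∀ n : ℕ, ℝ → ContinuousMultilinearMap ℂ (fun _ : Fin n => E × E) F := fun n s =>
    (p n).compContinuousLinearMap fun _ => L s
  have hcc : ∀ n, Continuous (c n) := fun n =>
    (ContinuousMultilinearMap.compContinuousLinearMapLRight
      (E := fun _ : Fin n => E × E) (p n)).cont.comp (continuous_pi fun _ => hLc)
  have hcn : ∀ n, ∀ s ∈ uIoc (0 : ℝ) 1, ‖c n s‖ ≤ ‖p n‖ * 2 ^ n := by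
    intro n s hs
    refine ((p n).norm_compContinuousLinearMap_le _).trans ?_
    gcongr
    simpa using pow_le_pow_left₀ (norm_nonneg _) (hL s hs) n
  let q : FormalMultilinearSeries ℂ (E × E) F := fun n => ∫ s in (0 : ℝ)..1, c n s
  obtain ⟨r', hr'0, hr'⟩ := ENNReal.lt_iff_exists_nnreal_btwn.1 hp.r_pos
  have hr'0' : 0 < r' := by exact_mod_cast hr'0
  have hr'p : (r' : ENNReal) < p.radius := hr'.trans_le hp.r_le
  have hbase : HasFPowerSeriesOnBall
      (fun q : E × E => ∫ s in (0 : ℝ)..1, f (q.1 + (s : ℂ) • q.2)) q (x, 0)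
      ((r' / 2 : NNReal) : ENNReal) := by
    refine ⟨?_, by simpa using hr'0'.ne', ?_⟩
    · obtain ⟨C, -, hC⟩ := p.norm_mul_pow_le_of_lt_radius hr'p
      refine q.le_radius_of_bound C fun n => le_trans ?_ (hC n)
      have : ‖q n‖ ≤ ‖p n‖ * 2 ^ n := by
        simpa using intervalIntegral.norm_integral_le_of_norm_le_const (hcn n)
      calc ‖q n‖ * ((r' / 2 : NNReal) : ℝ) ^ n
          ≤ ‖p n‖ * 2 ^ n * ((r' / 2 : NNReal) : ℝ) ^ n := by gcongr
        _ = ‖p n‖ * (r' : ℝ) ^ n := by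
          rw [mul_assoc, ← mul_pow]; congr 2; push_cast; ring
    · intro y hy
      have hy2 : ‖y‖ < r' / 2 := by
        rw [Metric.eball_coe, mem_ball_zero_iff] at hy
        exact_mod_cast hy
      have hq : ∀ n, (q n fun _ => y) = ∫ s in (0 : ℝ)..1, (p n) fun _ => L s y := by
        intro n
        have := ((ContinuousMultilinearMap.apply ℂ (fun _ : Fin n => E × E) F
          (fun _ => y)).intervalIntegral_comp_comm
            ((hcc n).intervalIntegrable (μ := MeasureTheory.volume) 0 1))
        exact this.symm
      have hLy : ∀ s ∈ uIoc (0 : ℝ) 1, ‖L s y‖ ≤ 2 * ‖y‖ := fun s hs =>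
        (L s).le_of_opNorm_le (hL s hs) y
      simp only [hq]
      refine intervalIntegral.hasSum_integral_of_dominated_convergence
        (fun n _ => ‖p n‖ * (r' : ℝ) ^ n) (fun n => ?_) (fun n => ?_) ?_ ?_ ?_
      · have : Continuous fun s => (p n) fun _ : Fin n => L s y :=
          (p n).cont.comp (continuous_pi fun _ => hLc.clm_apply continuous_const)
        exact this.aestronglyMeasurable
      · refine Eventually.of_forall fun s hs => ((p n).le_opNorm _).trans ?_
        gcongr
        simpa using pow_le_pow_left₀ (norm_nonneg _) ((hLy s hs).trans (by linarith)) n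
      · exact Eventually.of_forall fun _ _ => p.summable_norm_mul_pow hr'p
      · exact intervalIntegrable_const
      · refine Eventually.of_forall fun s hs => ?_
        have hmem : L s y ∈ Metric.eball (0 : E) r := by
          refine Metric.eball_subset_eball hr'.le ?_
          rw [Metric.eball_coe, mem_ball_zero_iff]
          exact (hLy s hs).trans_lt (by linarith)
        have := hp.hasSum hmem
        have he : x + L s y = ((x, 0) + y : E × E).1 + (s : ℂ) • ((x, 0) + y : E × E).2 := by
          simp [L, add_assoc]
        rwa [he] at this
  exact hbase.analyticAt

/-- Hadamard's lemma for analytic functions. -/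
theorem AnalyticAt.exists_sub_eq_apply {E F : Type*} [NormedAddCommGroup E] [NormedSpace ℂ E]
    [NormedAddCommGroup F] [NormedSpace ℂ F] [CompleteSpace F] {f : E → F} {x : E}
    (hf : AnalyticAt ℂ f x) :
    ∃ G : E × E → E →L[ℂ] F, AnalyticAt ℂ G (x, 0) ∧
      ∀ᶠ q in nhds ((x, 0) : E × E), f (q.1 + q.2) - f q.1 = G q q.2 := by
  refine ⟨_, hf.fderiv.integral_segment, ?_⟩
  obtain ⟨r, hr, hfr⟩ := hf.exists_ball_analyticOnNhd
  have hcont : Tendsto (fun q : E × E => (q.1, q.1 + q.2)) (nhds (x, 0)) (nhds (x, x)) := by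
    have : Continuous fun q : E × E => (q.1, q.1 + q.2) := by fun_prop
    simpa using this.tendsto (x, 0)
  filter_upwards [hcont (prod_mem_nhds (ball_mem_nhds x hr) (ball_mem_nhds x hr))]
    with q hq
  have hseg : ∀ s ∈ uIcc (0 : ℝ) 1, q.1 + (s : ℂ) • q.2 ∈ ball x r := by
    intro s hs
    rw [uIcc_of_le zero_le_one] at hs
    have h := (convex_ball x r).add_smul_sub_mem hq.1 hq.2 hs
    simpa [Complex.coe_smul] using h
  have hderiv : ∀ s ∈ uIcc (0 : ℝ) 1, HasDerivAt (fun s : ℝ => f (q.1 + (s : ℂ) • q.2))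
      (fderiv ℂ f (q.1 + (s : ℂ) • q.2) q.2) s := by
    intro s hs
    have h1 : HasDerivAt (fun t : ℝ => q.1 + (t : ℂ) • q.2) q.2 s := by
      simpa using ((hasDerivAt_id s).ofReal_comp.smul_const q.2).const_add q.1
    exact ((hfr _ (hseg s hs)).differentiableAt.hasFDerivAt.restrictScalars ℝ).comp_hasDerivAt s h1
  have hcf : ContinuousOn (fun s : ℝ => fderiv ℂ f (q.1 + (s : ℂ) • q.2)) (uIcc 0 1) := by
    intro s hs
    have h2 : Continuous fun s : ℝ => q.1 + (s : ℂ) • q.2 := by fun_prop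
    exact ((hfr _ (hseg s hs)).fderiv.continuousAt.comp_of_eq h2.continuousAt rfl
      ).continuousWithinAt
  have hint := hcf.intervalIntegrable (μ := MeasureTheory.volume)
  have hcf' : ContinuousOn (fun s : ℝ => fderiv ℂ f (q.1 + (s : ℂ) • q.2) q.2) (uIcc 0 1) :=
    hcf.clm_apply continuousOn_const
  have h := intervalIntegral.integral_eq_sub_of_hasDerivAt hderiv hcf'.intervalIntegrable
  rw [ContinuousLinearMap.intervalIntegral_apply hint, h]
  simp

/-- Analytic primitives with respect to the first variable, vanishing on `z = 0`. -/
theorem AnalyticAt.exists_primitive_fst {E : Type*} [NormedAddCommGroup E] [NormedSpace ℂ E]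
    {g : ℂ × E → ℂ} (hg : AnalyticAt ℂ g 0) :
    ∃ G : ℂ × E → ℂ, AnalyticAt ℂ G 0 ∧ (∀ y, G (0, y) = 0) ∧
      ∀ᶠ q in nhds (0 : ℂ × E), HasDerivAt (fun z => G (z, q.2)) (g q) q.1 := by
  let a : ℂ × E → (ℂ × E) × (ℂ × E) := fun q => ((0, q.2), (q.1, 0))
  have ha : AnalyticAt ℂ a 0 :=
    (analyticAt_const.prod analyticAt_snd).prod (analyticAt_fst.prod analyticAt_const)
  refine ⟨fun q => q.1 * ∫ s in (0 : ℝ)..1, g ((a q).1 + (s : ℂ) • (a q).2),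
    analyticAt_fst.mul (hg.integral_segment.comp_of_eq ha rfl), by simp, ?_⟩
  obtain ⟨r, hr, hgr⟩ := hg.exists_ball_analyticOnNhd
  filter_upwards [ball_mem_nhds (0 : ℂ × E) hr] with q hq
  have hq' : ‖q.1‖ < r ∧ ‖q.2‖ < r := by
    simpa [Prod.norm_def] using hq
  have hmem : ∀ w ∈ ball (0 : ℂ) r, (w, q.2) ∈ ball (0 : ℂ × E) r := by
    intro w hw
    simpa [Prod.norm_def, hq'.2] using hw
  have hd : DifferentiableOn ℂ (fun w => g (w, q.2)) (ball 0 r) := by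
    intro w hw
    exact ((hgr _ (hmem w hw)).comp_of_eq (analyticAt_id.prod analyticAt_const) rfl
      ).differentiableAt.differentiableWithinAt
  obtain ⟨P, hP⟩ := hd.isExactOn_ball
  have hq1 : q.1 ∈ ball (0 : ℂ) r := by simpa using hq'.1
  refine ((hP q.1 hq1).sub_const (P 0)).congr_of_eventuallyEq ?_
  filter_upwards [isOpen_ball.mem_nhds hq1] with w hw
  have hsw : ∀ s ∈ uIcc (0 : ℝ) 1, (s : ℂ) * w ∈ ball (0 : ℂ) r := by
    intro s hs
    rw [uIcc_of_le zero_le_one] at hs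
    have := (convex_ball (0 : ℂ) r).smul_mem_of_zero_mem (mem_ball_self hr) hw hs
    simpa using this
  have hderiv : ∀ s ∈ uIcc (0 : ℝ) 1, HasDerivAt (fun s : ℝ => P ((s : ℂ) * w))
      (g ((s : ℂ) * w, q.2) * w) s := by
    intro s hs
    have h1 : HasDerivAt (fun t : ℂ => t * w) w (s : ℂ) := by
      simpa using (hasDerivAt_id (s : ℂ)).mul_const w
    exact ((hP _ (hsw s hs)).comp (s : ℂ) h1).comp_ofReal
  have hcont : ContinuousOn (fun s : ℝ => g ((s : ℂ) * w, q.2) * w) (uIcc 0 1) := by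
    refine ContinuousOn.mul (hd.continuousOn.comp (f := fun s : ℝ => (s : ℂ) * w) ?_ hsw)
      continuousOn_const
    fun_prop
  have h := intervalIntegral.integral_eq_sub_of_hasDerivAt hderiv hcont.intervalIntegrable
  rw [intervalIntegral.integral_mul_const] at h
  simp only [a, Prod.smul_mk, Prod.mk_add_mk, smul_zero, add_zero, zero_add, smul_eq_mul]
  rw [mul_comm, h]
  simp

/-- An analytic function vanishing on the curve `ε = z ^ n` is divisible by `z ^ n - ε`. -/
theorem AnalyticAt.exists_eq_pow_sub_mul {g : ℂ × ℂ → ℂ} (hg : AnalyticAt ℂ g 0) {n : ℕ}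
    (hn : n ≠ 0) (h0 : ∀ᶠ z in nhds (0 : ℂ), g (z, z ^ n) = 0) :
    ∃ h : ℂ × ℂ → ℂ, AnalyticAt ℂ h 0 ∧
      ∀ᶠ q in nhds (0 : ℂ × ℂ), g q = (q.1 ^ n - q.2) * h q := by
  obtain ⟨G, hG, hGg⟩ := hg.exists_sub_eq_apply
  let a : ℂ × ℂ → (ℂ × ℂ) × (ℂ × ℂ) := fun q => ((q.1, q.1 ^ n), (0, q.2 - q.1 ^ n))
  have ha : AnalyticAt ℂ a 0 :=
    (analyticAt_fst.prod (analyticAt_fst.pow n)).prod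
      (analyticAt_const.prod (analyticAt_snd.sub (analyticAt_fst.pow n)))
  have ha0 : a 0 = (0, 0) := by simp [a, hn]
  refine ⟨fun q => -(G (a q) (0, 1)),
    (((ContinuousLinearMap.apply ℂ ℂ ((0, 1) : ℂ × ℂ)).analyticAt _).comp
      (hG.comp_of_eq ha ha0)).neg, ?_⟩
  have hGa := (ha0 ▸ ha.continuousAt.tendsto).eventually hGg
  have h0' := (continuous_fst.tendsto' (0 : ℂ × ℂ) (0 : ℂ) rfl).eventually h0
  filter_upwards [hGa, h0'] with q hq hq0
  have e : (a q).2 = (q.2 - q.1 ^ n) • ((0, 1) : ℂ × ℂ) := by simp [a]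
  rw [e, map_smul, ← e] at hq
  simp only [a, Prod.mk_add_mk, add_zero, add_sub_cancel, hq0, sub_zero, smul_eq_mul] at hq
  rw [hq]
  simp only [a]
  ring

/-- Moving along the vector field `f(·, ε)` for the complex time `H(z, ε)`: the new position is
`z + f(z, ε) * U(z, ε)`, and its derivative with respect to `z` is the one predicted by the
time form `dz / f`. -/
theorem AnalyticAt.exists_displacement {f H : ℂ × ℂ → ℂ} (hf : AnalyticAt ℂ f 0) (hf0 : f 0 = 0)
    (hH : AnalyticAt ℂ H 0) (hH0 : H 0 = 0) :
    ∃ U : ℂ × ℂ → ℂ, AnalyticAt ℂ U 0 ∧ U 0 = 0 ∧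
      (∀ᶠ ε in nhds (0 : ℂ), H (0, ε) = 0 → U (0, ε) = 0) ∧
      ∀ᶠ q in nhds (0 : ℂ × ℂ), f q ≠ 0 → ∀ h, HasDerivAt (fun z => H (z, q.2)) h q.1 →
        HasDerivAt (fun z => z + f (z, q.2) * U (z, q.2))
          (f (q.1 + f q * U q, q.2) * (1 / f q + h)) q.1 := by
  obtain ⟨G, hG, hGf⟩ := hf.exists_sub_eq_apply
  -- `f (z + f (z, ε) * w, ε) = f (z, ε) * P (w, (z, ε))` with `P` analytic, `P 0 = 1`
  let a : ℂ × (ℂ × ℂ) → (ℂ × ℂ) × (ℂ × ℂ) := fun y => (y.2, (f y.2 * y.1, 0))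
  have hf2 : AnalyticAt ℂ (fun y : ℂ × (ℂ × ℂ) => f y.2) 0 :=
    hf.comp_of_eq analyticAt_snd rfl
  have ha : AnalyticAt ℂ a 0 :=
    analyticAt_snd.prod ((hf2.mul analyticAt_fst).prod analyticAt_const)
  have ha0 : a 0 = (0, 0) := by simp [a]
  let P : ℂ × (ℂ × ℂ) → ℂ := fun y => 1 + y.1 * G (a y) (1, 0)
  have hP : AnalyticAt ℂ P 0 :=
    analyticAt_const.add (analyticAt_fst.mul
      (((ContinuousLinearMap.apply ℂ ℂ ((1, 0) : ℂ × ℂ)).analyticAt _).comp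
        (hG.comp_of_eq ha ha0)))
  have hP0 : P 0 = 1 := by simp [P]
  have hfP : ∀ᶠ y in nhds (0 : ℂ × (ℂ × ℂ)),
      f (y.2.1 + f y.2 * y.1, y.2.2) = f y.2 * P y := by
    filter_upwards [(ha0 ▸ ha.continuousAt.tendsto).eventually hGf] with y hy
    have e : (a y).2 = (f y.2 * y.1) • ((1, 0) : ℂ × ℂ) := by simp [a]
    have e2 : (a y).1 + (a y).2 = (y.2.1 + f y.2 * y.1, y.2.2) := by
      ext <;> simp [a]
    rw [e2, e, map_smul, sub_eq_iff_eq_add] at hy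
    rw [hy]
    simp only [P, a, smul_eq_mul]
    ring
  have hPne : ∀ᶠ y in nhds (0 : ℂ × (ℂ × ℂ)), P y ≠ 0 :=
    hP.continuousAt.eventually_ne (by simp [hP0])
  obtain ⟨T, hT, hT0, hTP⟩ := (hP.inv (by simp [hP0])).exists_primitive_fst
  -- solve `T (U x, x) = H x`
  let Q : (ℂ × ℂ) × ℂ → ℂ := fun y => T (y.2, y.1) - H y.1
  have hQ : AnalyticAt ℂ Q 0 :=
    (hT.comp_of_eq (analyticAt_snd.prod analyticAt_fst) rfl).sub
      (hH.comp_of_eq analyticAt_fst rfl)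
  have hQ0 : Q 0 = 0 := by
    have := hT0 (0 : ℂ × ℂ)
    simp [Q, hH0, this]
  have hQd : (fderiv ℂ Q 0 ∘L .inr ℂ (ℂ × ℂ) ℂ) = ContinuousLinearMap.id ℂ ℂ := by
    ext
    have h1 : HasDerivAt (fun w : ℂ => Q ((0 : ℂ × ℂ), w)) 1 0 := by
      have := hTP.self_of_nhds
      have h2 : HasDerivAt (fun w : ℂ => T (w, (0 : ℂ × ℂ))) 1 0 := by
        simpa [hP0] using this
      exact h2.sub_const (H 0)
    have h3 : HasDerivAt (fun w : ℂ => ((0 : ℂ × ℂ), w)) (0, 1) 0 :=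
      (hasDerivAt_const _ _).prodMk (hasDerivAt_id _)
    have h4 := (hQ.differentiableAt.hasFDerivAt).comp_hasDerivAt (0 : ℂ) h3
    simpa using h4.unique h1
  have hinv : (fderiv ℂ Q 0 ∘L .inr ℂ (ℂ × ℂ) ℂ).IsInvertible := by
    rw [hQd]
    exact ⟨ContinuousLinearEquiv.refl ℂ ℂ, rfl⟩
  have hQc : ContDiffAt ℂ ⊤ Q 0 := hQ.contDiffAt
  let U : ℂ × ℂ → ℂ := hQc.implicitFunction (by simp) hinv
  have hUan : AnalyticAt ℂ U 0 :=
    (hQc.contDiffAt_implicitFunction (by simp) hinv).analyticAt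
  have hU0 : U 0 = 0 := hQc.implicitFunction_apply_self (by simp) hinv
  have hUeq : ∀ᶠ x in nhds (0 : ℂ × ℂ), T (U x, x) = H x := by
    filter_upwards [hQc.eventually_apply_implicitFunction (by simp) hinv] with x hx
    rw [hQ0] at hx
    exact sub_eq_zero.1 hx
  refine ⟨U, hUan, hU0, ?_, ?_⟩
  · have hiff := hQc.eventually_apply_eq_iff_implicitFunction (by simp) hinv
    have ht : Tendsto (fun ε : ℂ => (((0, ε), 0) : (ℂ × ℂ) × ℂ)) (nhds 0) (nhds 0) :=
      Continuous.tendsto' (by fun_prop) _ _ rfl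
    filter_upwards [ht.eventually hiff] with ε hε hHε
    refine hε.1 ?_
    rw [hQ0]
    simp [Q, hT0, hHε]
  have hfan : ∀ᶠ y in nhds (0 : ℂ × (ℂ × ℂ)), AnalyticAt ℂ f (y.2.1 + f y.2 * y.1, y.2.2) := by
    have hc : ContinuousAt (fun y : ℂ × (ℂ × ℂ) => (y.2.1 + f y.2 * y.1, y.2.2)) 0 := by
      have := hf2.continuousAt
      fun_prop
    have ht : Tendsto (fun y : ℂ × (ℂ × ℂ) => (y.2.1 + f y.2 * y.1, y.2.2)) (nhds 0) (nhds 0) := by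
      refine hc.tendsto.trans (le_of_eq ?_)
      simp [hf0]
    exact ht.eventually hf.eventually_analyticAt
  obtain ⟨r, hr, hball⟩ := Metric.eventually_nhds_iff_ball.1
    (hfP.and (hPne.and (hTP.and hfan)))
  have hball' : ∀ (w : ℂ) (x : ℂ × ℂ), ‖w‖ < r → ‖x‖ < r → (w, x) ∈ ball (0 : ℂ × (ℂ × ℂ)) r := by
    intro w x hw hx
    rw [mem_ball_zero_iff, Prod.norm_def]
    exact max_lt hw hx
  have hUsmall : ∀ᶠ x in nhds (0 : ℂ × ℂ), ‖U x‖ < r / 2 := by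
    have := hUan.continuousAt.norm
    refine this.eventually_lt_const ?_
    simpa [hU0] using hr
  have hxsmall : ∀ᶠ x in nhds (0 : ℂ × ℂ), ‖x‖ < r := by
    filter_upwards [ball_mem_nhds (0 : ℂ × ℂ) hr] with x hx using mem_ball_zero_iff.1 hx
  filter_upwards [(hUsmall.and (hxsmall.and hUeq)).eventually_nhds, hUan.eventually_analyticAt]
    with q hq hUq hfq h hh
  obtain ⟨hq1, hq2, -⟩ := hq.self_of_nhds
  have hfq_an : AnalyticAt ℂ f q := by
    simpa using (hball _ (hball' 0 q (by simpa using hr) hq2)).2.2.2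
  have hfz : ContinuousAt (fun z => f (z, q.2)) q.1 :=
    hfq_an.continuousAt.comp_of_eq (f := fun z : ℂ => (z, q.2)) (by fun_prop) rfl
  set D := ball q.1 (‖f q‖ * r) with hD
  have hDr : 0 < ‖f q‖ * r := mul_pos (norm_pos_iff.2 hfq) hr
  have hDf : ∀ z ∈ D, f (z, q.2) ≠ 0 ∧ AnalyticAt ℂ f (z, q.2) := by
    intro z hz
    have hw : ‖(z - q.1) / f q‖ < r := by
      rw [norm_div, div_lt_iff₀' (norm_pos_iff.2 hfq)]
      simpa [hD, dist_eq_norm] using hz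
    obtain ⟨h1, h2, -, h4⟩ := hball _ (hball' _ q hw hq2)
    have e : q.1 + f q * ((z - q.1) / f q) = z := by field_simp; ring
    simp only [e] at h1 h4
    exact ⟨by rw [h1]; exact mul_ne_zero hfq h2, h4⟩
  have hDd : DifferentiableOn ℂ (fun z => (f (z, q.2))⁻¹) D := by
    intro z hz
    have : AnalyticAt ℂ (fun z => f (z, q.2)) z :=
      (hDf z hz).2.comp_of_eq (analyticAt_id.prod analyticAt_const) rfl
    exact (this.inv (hDf z hz).1).differentiableAt.differentiableWithinAt
  obtain ⟨R, hR⟩ := hDd.isExactOn_ball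
  have hev : ∀ᶠ z in nhds q.1, R (z + f (z, q.2) * U (z, q.2)) - R z = H (z, q.2) := by
    have htend : Tendsto (fun z : ℂ => (z, q.2)) (nhds q.1) (nhds q) :=
      Continuous.tendsto' (by fun_prop) _ _ rfl
    have hclose : ∀ᶠ z in nhds q.1, ‖z - q.1‖ + ‖f (z, q.2)‖ * (r / 2) < ‖f q‖ * r := by
      have hc : ContinuousAt (fun z => ‖z - q.1‖ + ‖f (z, q.2)‖ * (r / 2)) q.1 := by fun_prop
      refine hc.eventually_lt_const ?_
      simp only [sub_self, norm_zero, zero_add, Prod.mk.eta]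
      nlinarith
    filter_upwards [htend.eventually hq, hclose, hfz.eventually_ne hfq] with z hz hzc hzf
    obtain ⟨hz1, hz2, hz3⟩ := hz
    have hmem : ∀ w ∈ ball (0 : ℂ) (r / 2), z + f (z, q.2) * w ∈ D := by
      intro w hw
      rw [mem_ball_zero_iff] at hw
      rw [hD, mem_ball, dist_eq_norm]
      refine lt_of_le_of_lt ?_ hzc
      calc ‖z + f (z, q.2) * w - q.1‖ = ‖(z - q.1) + f (z, q.2) * w‖ := by ring_nf
        _ ≤ ‖z - q.1‖ + ‖f (z, q.2)‖ * ‖w‖ := (norm_add_le _ _).trans_eq (by rw [norm_mul])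
        _ ≤ _ := by gcongr
    have h1 : ∀ w ∈ ball (0 : ℂ) (r / 2),
        HasDerivAt (fun w => R (z + f (z, q.2) * w)) (P (w, (z, q.2)))⁻¹ w := by
      intro w hw
      have hl : HasDerivAt (fun w => z + f (z, q.2) * w) (f (z, q.2)) w := by
        simpa using ((hasDerivAt_id w).const_mul (f (z, q.2))).const_add z
      have hw' : ‖w‖ < r := by rw [mem_ball_zero_iff] at hw; linarith
      obtain ⟨h1, h2, -, -⟩ := hball _ (hball' w (z, q.2) hw' hz2)
      refine ((hR _ (hmem w hw)).comp w hl).congr_deriv ?_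
      simp only at h1
      beta_reduce
      rw [h1]
      field_simp
    have h2 : ∀ w ∈ ball (0 : ℂ) (r / 2),
        HasDerivAt (fun w => T (w, (z, q.2))) (P (w, (z, q.2)))⁻¹ w := by
      intro w hw
      have hw' : ‖w‖ < r := by rw [mem_ball_zero_iff] at hw; linarith
      exact (hball _ (hball' w (z, q.2) hw' hz2)).2.2.1
    have h3 : EqOn (fun w => R (z + f (z, q.2) * w) - R z) (fun w => T (w, (z, q.2)))
        (ball 0 (r / 2)) := by
      refine isOpen_ball.eqOn_of_deriv_eq (convex_ball _ _).isPreconnected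
        (fun w hw => ((h1 w hw).sub_const _).differentiableAt.differentiableWithinAt)
        (fun w hw => (h2 w hw).differentiableAt.differentiableWithinAt)
        (fun w hw => by rw [((h1 w hw).sub_const _).deriv, (h2 w hw).deriv])
        (mem_ball_self (by positivity)) ?_
      simp [hT0]
    rw [← hz3]
    exact h3 (by simpa using hz1)
  have hψd : DifferentiableAt ℂ (fun z => z + f (z, q.2) * U (z, q.2)) q.1 := by
    have hpair : AnalyticAt ℂ (fun z : ℂ => (z, q.2)) q.1 := analyticAt_id.prod analyticAt_const
    exact (analyticAt_id.add ((hfq_an.comp_of_eq hpair rfl).mul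
      (hUq.comp_of_eq hpair rfl))).differentiableAt
  have hψD : q.1 + f q * U q ∈ D := by
    rw [hD, mem_ball, dist_eq_norm, add_sub_cancel_left, norm_mul]
    have := norm_pos_iff.2 hfq
    gcongr
    linarith
  have hRψ := ((hR _ hψD).comp q.1 (h := fun z => z + f (z, q.2) * U (z, q.2)) hψd.hasDerivAt).sub
    (hR q.1 (mem_ball_self hDr))
  have huniq := (hRψ.congr_of_eventuallyEq (hev.mono fun z hz => hz.symm)).unique hh
  refine hψd.hasDerivAt.congr_deriv ?_
  have hne := (hDf _ hψD).1
  simp only [Prod.mk.eta] at huniq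
  rw [← huniq]
  field_simp
  ring

/-- An analytic function with nonzero partial derivative in the first variable is locally
injective in that variable. -/
theorem AnalyticAt.exists_ball_injective_fst {ψ : ℂ × ℂ → ℂ} {x : ℂ × ℂ} (hψ : AnalyticAt ℂ ψ x)
    {d : ℂ} (hd : d ≠ 0) (h : HasDerivAt (fun z => ψ (z, x.2)) d x.1) :
    ∃ r > 0, ∀ p ∈ ball x r, ∀ q ∈ ball x r, p.2 = q.2 → ψ p = ψ q → p = q := by
  have hs := hψ.hasStrictFDerivAt
  have hd1 : fderiv ℂ ψ x (1, 0) = d := by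
    have h3 : HasDerivAt (fun z : ℂ => (z, x.2)) (1, 0) x.1 :=
      (hasDerivAt_id _).prodMk (hasDerivAt_const _ _)
    exact (hs.hasFDerivAt.comp_hasDerivAt x.1 h3).unique h
  have hb := hs.isLittleO.def (half_pos (norm_pos_iff.2 hd))
  obtain ⟨r, hr, hball⟩ := Metric.eventually_nhds_iff_ball.1 hb
  refine ⟨r, hr, fun p hp q hq h2 hpq => ?_⟩
  have hpq' : (p, q) ∈ ball (x, x) r := by
    rw [← ball_prod_same]
    exact ⟨hp, hq⟩
  have key := hball _ hpq'
  have e : p - q = (p.1 - q.1) • ((1, 0) : ℂ × ℂ) := by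
    ext <;> simp [h2]
  simp only at key
  rw [hpq, sub_self, zero_sub, norm_neg, e, map_smul, hd1, norm_smul, norm_smul] at key
  have h1 : ‖((1, 0) : ℂ × ℂ)‖ = 1 := by simp [Prod.norm_def]
  rw [h1] at key
  have h4 : ‖p.1 - q.1‖ ≤ 0 := by
    have := norm_pos_iff.2 hd
    have h5 := norm_nonneg (p.1 - q.1)
    nlinarith
  exact Prod.ext (sub_eq_zero.1 (norm_le_zero_iff.1 h4)) h2

/-- Two families `(z ^ n - ε) * V` and `(z ^ n - ε) * W` whose unit factors agree on the curve
`ε = z ^ n` are conjugate by an analytic change of variable tangent to the identity at `0`. -/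
theorem exists_conjugacy_of_eq_on_curve {n : ℕ} (hn : n ≠ 0) {V W : ℂ × ℂ → ℂ}
    (hV : AnalyticAt ℂ V 0) (hV0 : V 0 ≠ 0) (hW : AnalyticAt ℂ W 0) (hW0 : W 0 ≠ 0)
    (hVW : ∀ᶠ z in nhds (0 : ℂ), V (z, z ^ n) = W (z, z ^ n)) :
    ∃ ψ : ℂ × ℂ → ℂ, AnalyticAt ℂ ψ 0 ∧ (∀ᶠ ε in nhds (0 : ℂ), ψ (0, ε) = 0) ∧
      HasDerivAt (fun z => ψ (z, 0)) 1 0 ∧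
      ∀ᶠ q in nhds (0 : ℂ × ℂ), deriv (fun z => ψ (z, q.2)) q.1 * ((q.1 ^ n - q.2) * V q)
        = (ψ q ^ n - q.2) * W (ψ q, q.2) := by
  obtain ⟨h, hh, hdiv⟩ := ((hV.inv hV0).sub (hW.inv hW0)).exists_eq_pow_sub_mul hn
    (by filter_upwards [hVW] with z hz; simp [hz])
  obtain ⟨H, hH, hH0, hHd⟩ := hh.exists_primitive_fst
  let f : ℂ × ℂ → ℂ := fun q => (q.1 ^ n - q.2) * W q
  have hf : AnalyticAt ℂ f 0 := ((analyticAt_fst.pow n).sub analyticAt_snd).mul hW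
  have hf0 : f 0 = 0 := by simp [f, hn]
  obtain ⟨U, hU, hU0, hUε, hUd⟩ := hf.exists_displacement hf0 hH (hH0 0)
  refine ⟨fun q => q.1 + f q * U q, analyticAt_fst.add (hf.mul hU), ?_, ?_, ?_⟩
  · filter_upwards [hUε] with ε hε
    simp [hε (hH0 ε)]
  · have hpair : AnalyticAt ℂ (fun z : ℂ => (z, (0 : ℂ))) 0 := analyticAt_id.prod analyticAt_const
    have h1 := (hf.comp_of_eq hpair rfl).differentiableAt.hasDerivAt
    have h2 := (hU.comp_of_eq hpair rfl).differentiableAt.hasDerivAt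
    refine ((hasDerivAt_id (0 : ℂ)).add (h1.mul h2)).congr_deriv ?_
    simp [← Prod.zero_eq_mk, hf0, hU0]
  · filter_upwards [hUd, hHd, hdiv, hV.continuousAt.eventually_ne hV0,
      hW.continuousAt.eventually_ne hW0] with q hq hHq hdq hVq hWq
    by_cases hz : q.1 ^ n - q.2 = 0
    · have : f q = 0 := by simp [f, hz]
      simp [this, hz]
    · have hfq : f q ≠ 0 := mul_ne_zero hz hWq
      rw [(hq hfq _ hHq).deriv]
      have e : (1 / f q + h q) * ((q.1 ^ n - q.2) * V q) = 1 := by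
        simp only [Pi.sub_apply, Pi.inv_apply] at hdq
        calc (1 / f q + h q) * ((q.1 ^ n - q.2) * V q)
            = (q.1 ^ n - q.2) * V q / f q + (q.1 ^ n - q.2) * h q * V q := by ring
          _ = 1 := by
            rw [← hdq]
            simp only [f]
            field_simp
            ring
      rw [mul_assoc, e, mul_one]

/-- If two factored families `(z^{k+1}−ε)·v(z,ε)` and `(z^{k+1}−ε)·ṽ(z,ε)`
of codimension `k` have eigenvalue functions related by `λ(δ) = λ̃(ζ·δ)` for some
`(k+1)`-st root of unity `ζ`, then there is a parameter-preserving analytic conjugacy `ψ`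
from the first family to the second, which moreover fixes `0` for every `ε`. -/
theorem statement6 (k : ℕ) (hk : 1 ≤ k) (v tv : ℂ → ℂ → ℂ)
    (hv : AnalyticAt ℂ (fun p : ℂ × ℂ => v p.1 p.2) (0, 0)) (hv0 : v 0 0 ≠ 0)
    (htv : AnalyticAt ℂ (fun p : ℂ × ℂ => tv p.1 p.2) (0, 0)) (htv0 : tv 0 0 ≠ 0)
    (ζ : ℂ) (hζ : ζ ^ (k + 1) = 1)
    (hEig : ∀ᶠ δ in nhds (0 : ℂ),
      ((k : ℂ) + 1) * δ ^ k * v δ (δ ^ (k + 1))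
        = ((k : ℂ) + 1) * (ζ * δ) ^ k * tv (ζ * δ) ((ζ * δ) ^ (k + 1))) :
    ∃ (r ρ : ℝ) (ψ : ℂ → ℂ → ℂ), 0 < r ∧ 0 < ρ ∧
      AnalyticOnNhd ℂ (fun p : ℂ × ℂ => ψ p.1 p.2) (ball 0 r ×ˢ ball 0 ρ) ∧
      ψ 0 0 = 0 ∧
      (∀ ε ∈ ball (0 : ℂ) ρ, ψ 0 ε = 0) ∧
      (∀ ε ∈ ball (0 : ℂ) ρ, Set.InjOn (fun z => ψ z ε) (ball 0 r)) ∧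
      ∀ z ∈ ball (0 : ℂ) r, ∀ ε ∈ ball (0 : ℂ) ρ,
        deriv (fun z => ψ z ε) z * ((z ^ (k + 1) - ε) * v z ε)
          = (ψ z ε ^ (k + 1) - ε) * tv (ψ z ε) ε := by
  have hζ0 : ζ ≠ 0 := by
    rintro rfl
    simp at hζ
  let V : ℂ × ℂ → ℂ := fun p => v p.1 p.2
  let W : ℂ × ℂ → ℂ := fun p => ζ ^ k * tv (ζ * p.1) p.2
  have hW : AnalyticAt ℂ W 0 :=
    analyticAt_const.mul (htv.comp_of_eq
      ((analyticAt_const.mul analyticAt_fst).prod analyticAt_snd) (by simp))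
  have hcurve : AnalyticAt ℂ (fun z : ℂ => (z, z ^ (k + 1))) 0 :=
    analyticAt_id.prod (analyticAt_id.pow (k + 1))
  have hVW : ∀ᶠ z in nhds (0 : ℂ), V (z, z ^ (k + 1)) = W (z, z ^ (k + 1)) := by
    refine ((hv.comp_of_eq hcurve (by simp)).frequently_eq_iff_eventually_eq
      (hW.comp_of_eq hcurve (by simp))).1 (Eventually.frequently ?_)
    filter_upwards [hEig.filter_mono nhdsWithin_le_nhds, self_mem_nhdsWithin] with z hz hz0
    have hk1 : (k : ℂ) + 1 ≠ 0 := Nat.cast_add_one_ne_zero k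
    have hc : ((k : ℂ) + 1) * z ^ k ≠ 0 := mul_ne_zero hk1 (pow_ne_zero _ hz0)
    refine mul_left_cancel₀ hc (hz.trans ?_)
    rw [mul_pow ζ z (k + 1), hζ, one_mul, mul_pow]
    simp only [W, Function.comp]
    ring
  obtain ⟨φ, hφ, hφ0, hφd, hφc⟩ := exists_conjugacy_of_eq_on_curve (Nat.add_one_ne_zero k) hv
    hv0 hW (by simp [W, hζ0, htv0]) hVW
  obtain ⟨r₁, hr₁, hinj⟩ := hφ.exists_ball_injective_fst one_ne_zero hφd
  obtain ⟨r₂, hr₂, hr₂'⟩ := Metric.eventually_nhds_iff_ball.1 (hφc.and hφ.eventually_analyticAt)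
  obtain ⟨r₃, hr₃, hr₃'⟩ := Metric.eventually_nhds_iff_ball.1 hφ0
  obtain ⟨r, hr, hrm⟩ : ∃ r > 0, r ≤ min r₁ (min r₂ r₃) := ⟨_, by positivity, le_rfl⟩
  simp only [le_min_iff] at hrm
  obtain ⟨h1, h2, h3⟩ := hrm
  have hmem : ∀ {R : ℝ} {z ε : ℂ}, r ≤ R → z ∈ ball (0 : ℂ) r → ε ∈ ball (0 : ℂ) r →
      (z, ε) ∈ ball (0 : ℂ × ℂ) R := by
    intro R z ε hR hz hε
    refine ball_subset_ball hR ?_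
    rw [mem_ball_zero_iff, Prod.norm_def]
    exact max_lt (mem_ball_zero_iff.1 hz) (mem_ball_zero_iff.1 hε)
  have hz0 : ∀ ε ∈ ball (0 : ℂ) r, ζ * φ (0, ε) = 0 := by
    intro ε hε
    rw [hr₃' ε (ball_subset_ball h3 hε), mul_zero]
  refine ⟨r, r, fun z ε => ζ * φ (z, ε), hr, hr, ?_, hz0 0 (mem_ball_self hr), hz0, ?_, ?_⟩
  · rintro ⟨z, ε⟩ ⟨hz, hε⟩
    exact analyticAt_const.mul (hr₂' _ (hmem h2 hz hε)).2
  · intro ε hε z hz w hw hzw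
    have := hinj _ (hmem h1 hz hε) _ (hmem h1 hw hε) rfl (mul_left_cancel₀ hζ0 hzw)
    exact congrArg Prod.fst this
  · intro z hz ε hε
    have key := (hr₂' _ (hmem h2 hz hε)).1
    rw [deriv_const_mul_field, mul_pow, hζ, one_mul, mul_assoc]
    simp only [W] at key
    rw [key]
    linear_combination (φ (z, ε) ^ (k + 1) - ε) * tv (ζ * φ (z, ε)) ε * hζ
end

section
/- Let k ≥ 1 and let ω(z,ε) = (z^{k+1} − ε)·v(z,ε) and ω̃(z,ε) = (z^{k+1} − ε)·ṽ(z,ε) be two factored families of codimension k, with natural eigenvalue functions λ and λ̃ respectively. Then the following are equivalent: (i) there exists a parameter-preserving conjugacy from ω to ω̃ (an analytic map ψ : B(0,r) × B(0,ρ) → ℂ for some r,ρ > 0 with ψ(0,0) = 0, z ↦ ψ(z,ε) injective for each ε, and ∂ψ/∂z(z,ε)·ω(z,ε) = ω̃(ψ(z,ε), ε) on B(0,r) × B(0,ρ)); (ii) there exists ζ ∈ ℂ with ζ^{k+1} = 1 such that λ̃(δ) = λ(ζ·δ) for all δ in a neighborhood of 0. -/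
open Metric Set Filter Complex
open scoped Topology Interval ContDiff

/-- The average of an analytic function along the segment from `(x, 0)` to `(x, s)` is analytic
in `(x, s)`. -/
theorem AnalyticAt.integral_segment_s7 {E : Type*} [NormedAddCommGroup E] [NormedSpace ℂ E]
    {F : E × ℂ → ℂ} {x₀ : E} (hF : AnalyticAt ℂ F (x₀, 0)) :
    AnalyticAt ℂ (fun p : E × ℂ => ∫ t in (0 : ℝ)..1, F (p.1, t * p.2)) (x₀, 0) := by
  obtain ⟨p, R, hp⟩ := hF
  let L : ℝ → (E × ℂ →L[ℂ] E × ℂ) := fun t =>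
    (ContinuousLinearMap.fst ℂ E ℂ).prod ((t : ℂ) • ContinuousLinearMap.snd ℂ E ℂ)
  have hL1 : ∀ t ∈ Icc (0 : ℝ) 1, ∀ y, ‖L t y‖ ≤ ‖y‖ := by
    intro t ht y
    have : ‖(t : ℂ) * y.2‖ ≤ ‖y.2‖ := by
      rw [norm_mul, norm_real, Real.norm_of_nonneg ht.1]
      exact mul_le_of_le_one_left (norm_nonneg _) ht.2
    simp only [L, Prod.norm_def]
    exact max_le_max le_rfl this
  have hLn : ∀ t ∈ Icc (0 : ℝ) 1, ‖L t‖ ≤ 1 := fun t ht =>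
    ContinuousLinearMap.opNorm_le_bound _ zero_le_one fun y => by simpa using hL1 t ht y
  have hLc : Continuous L := by
    have h : L = fun t : ℝ =>
        (ContinuousLinearMap.inl ℂ E ℂ) ∘L (ContinuousLinearMap.fst ℂ E ℂ) +
          (t : ℂ) • ((ContinuousLinearMap.inr ℂ E ℂ) ∘L (ContinuousLinearMap.snd ℂ E ℂ)) := by
      ext t x <;> simp [L]
    rw [h]
    fun_prop
  let c : ∀ n : ℕ, ℝ → ContinuousMultilinearMap ℂ (fun _ : Fin n => E × ℂ) ℂ := fun n t =>
    (p n).compContinuousLinearMap fun _ => L t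
  have hc : ∀ n, Continuous (c n) := fun n =>
    ((p n).compContinuousLinearMapLRight (E := fun _ : Fin n => E × ℂ)).cont.comp
      (continuous_pi fun _ => hLc)
  have hcn : ∀ n, ∀ t ∈ Icc (0 : ℝ) 1, ‖c n t‖ ≤ ‖p n‖ := by
    intro n t ht
    refine (ContinuousMultilinearMap.norm_compContinuousLinearMap_le _ _).trans ?_
    refine mul_le_of_le_one_right (norm_nonneg _) ?_
    exact Finset.prod_le_one (fun _ _ => norm_nonneg _) fun _ _ => hLn t ht
  let q : FormalMultilinearSeries ℂ (E × ℂ) ℂ := fun n => ∫ t in (0 : ℝ)..1, c n t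
  have hIcc : ∀ t ∈ Ι (0 : ℝ) 1, t ∈ Icc (0 : ℝ) 1 := fun t ht => by
    rw [uIoc_of_le zero_le_one] at ht; exact Ioc_subset_Icc_self ht
  have hq : ∀ n, ‖q n‖ ≤ ‖p n‖ := fun n => by
    simpa using intervalIntegral.norm_integral_le_of_norm_le_const (a := (0 : ℝ)) (b := 1)
      (f := c n) fun t ht => hcn n t (hIcc t ht)
  refine ⟨q, R, ?_, hp.r_pos, ?_⟩
  · refine hp.r_le.trans (ENNReal.le_of_forall_nnreal_lt fun r hr => ?_)
    obtain ⟨C, -, hC⟩ := p.norm_mul_pow_le_of_lt_radius hr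
    exact q.le_radius_of_bound C fun n =>
      (mul_le_mul_of_nonneg_right (hq n) (by positivity)).trans (hC n)
  · intro y hy
    have happ : ∀ n, q n (fun _ => y) = ∫ t in (0 : ℝ)..1, c n t (fun _ => y) := fun n =>
      ((ContinuousMultilinearMap.apply ℂ (fun _ : Fin n => E × ℂ) ℂ
        (fun _ => y)).intervalIntegral_comp_comm ((hc n).intervalIntegrable 0 1)).symm
    simp only [happ]
    have hyr : (‖y‖₊ : ENNReal) < p.radius :=
      lt_of_lt_of_le (by simpa [enorm_eq_nnnorm] using hy) hp.r_le
    refine intervalIntegral.hasSum_integral_of_dominated_convergence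
      (fun n _ => ‖p n‖ * (‖y‖₊ : ℝ) ^ n) ?_ ?_ ?_ ?_ ?_
    · exact fun n => ((ContinuousMultilinearMap.apply ℂ (fun _ : Fin n => E × ℂ) ℂ
        (fun _ => y)).continuous.comp (hc n)).aestronglyMeasurable
    · refine fun n => .of_forall fun t ht => ?_
      refine ((c n t).le_opNorm _).trans ?_
      simp only [Finset.prod_const, Finset.card_univ, Fintype.card_fin, coe_nnnorm]
      gcongr
      exact hcn n t (hIcc t ht)
    · exact .of_forall fun t _ => p.summable_norm_mul_pow hyr
    · exact intervalIntegrable_const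
    · refine .of_forall fun t ht => ?_
      have hmem : L t y ∈ Metric.eball (0 : E × ℂ) R := by
        simp only [Metric.mem_eball, edist_zero_right] at hy
        rw [Metric.mem_eball, edist_zero_right]
        refine lt_of_le_of_lt ?_ hy
        exact enorm_le_iff_norm_le.2 (hL1 t (hIcc t ht) y)
      have := hp.hasSum hmem
      simpa [L, c, mul_add] using this

theorem mul_integral_segment_eq_sub {f T : ℂ → ℂ} {c : ℂ} {r : ℝ}
    (hf : ContinuousOn f (ball c r)) (hT : ∀ u ∈ ball c r, HasDerivAt T (f u) u) {a b : ℂ}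
    (ha : a ∈ ball c r) (hab : a + b ∈ ball c r) :
    b * ∫ t in (0 : ℝ)..1, f (a + t * b) = T (a + b) - T a := by
  have hmem : ∀ t ∈ Icc (0 : ℝ) 1, a + (t : ℂ) * b ∈ ball c r := fun t ht => by
    have := (convex_ball c r).add_smul_mem ha hab ht
    simpa [real_smul] using this
  have hd : ∀ t ∈ uIcc (0 : ℝ) 1,
      HasDerivAt (fun t : ℝ => T (a + t * b)) (b * f (a + t * b)) t := by
    intro t ht
    rw [uIcc_of_le zero_le_one] at ht
    have h1 : HasDerivAt (fun t : ℝ => a + (t : ℂ) * b) b t := by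
      simpa using ((hasDerivAt_id t).ofReal_comp.mul_const b).const_add a
    exact ((hT _ (hmem t ht)).comp t h1).congr_deriv (mul_comm _ _)
  have hc : ContinuousOn (fun t : ℝ => b * f (a + t * b)) (uIcc (0 : ℝ) 1) := by
    rw [uIcc_of_le zero_le_one]
    exact continuousOn_const.mul (hf.comp (by fun_prop) hmem)
  have := intervalIntegral.integral_eq_sub_of_hasDerivAt hd hc.intervalIntegrable
  simpa using this

theorem AnalyticAt.exists_hasDerivAt_mul_segment {E : Type*} [NormedAddCommGroup E]
    [NormedSpace ℂ E] {F : E × ℂ → ℂ} {x₀ : E} (hF : AnalyticAt ℂ F (x₀, 0)) :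
    ∀ᶠ p in 𝓝 (x₀, (0 : ℂ)),
      HasDerivAt (fun s => s * ∫ t in (0 : ℝ)..1, F (p.1, t * s)) (F p) p.2 := by
  obtain ⟨r, hr, h⟩ := Metric.eventually_nhds_iff_ball.1 hF.eventually_analyticAt
  filter_upwards [ball_mem_nhds _ hr] with p hp
  rw [← ball_prod_same] at h hp
  have hd : DifferentiableOn ℂ (fun s => F (p.1, s)) (ball 0 r) := fun s hs =>
    ((h (p.1, s) ⟨hp.1, hs⟩).differentiableAt.comp s
      (by fun_prop : DifferentiableAt ℂ (fun s : ℂ => (p.1, s)) s)).differentiableWithinAt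
  obtain ⟨T, hT⟩ := hd.isExactOn_ball
  refine ((hT p.2 hp.2).sub_const (T 0)).congr_of_eventuallyEq ?_
  filter_upwards [isOpen_ball.mem_nhds hp.2] with s hs
  simpa using mul_integral_segment_eq_sub hd.continuousOn hT (mem_ball_self hr)
    (by simpa using hs : (0 : ℂ) + s ∈ ball 0 r)

/-- An analytic function vanishing on `s = 0` is analytically divisible by `s`. -/
theorem AnalyticAt.exists_eq_snd_mul {E : Type*} [NormedAddCommGroup E]
    [NormedSpace ℂ E] {f : E × ℂ → ℂ} {x₀ : E} (hf : AnalyticAt ℂ f (x₀, 0))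
    (h0 : ∀ᶠ x in 𝓝 x₀, f (x, 0) = 0) :
    ∃ g : E × ℂ → ℂ, AnalyticAt ℂ g (x₀, 0) ∧ ∀ᶠ p in 𝓝 (x₀, (0 : ℂ)), f p = p.2 * g p := by
  have hD : AnalyticAt ℂ (fun p => fderiv ℂ f p (0, 1)) (x₀, 0) :=
    ((ContinuousLinearMap.apply ℂ ℂ ((0, 1) : E × ℂ)).analyticAt _).comp hf.fderiv
  refine ⟨_, hD.integral_segment_s7, ?_⟩
  obtain ⟨r, hr, h⟩ := Metric.eventually_nhds_iff_ball.1
    (hf.eventually_analyticAt.and hD.eventually_analyticAt)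
  have h0' : ∀ᶠ p in 𝓝 (x₀, (0 : ℂ)), f (p.1, 0) = 0 :=
    (continuous_fst.tendsto (x₀, (0 : ℂ))).eventually h0
  filter_upwards [ball_mem_nhds _ hr, h0'] with p hp hp0
  rw [← ball_prod_same] at h hp
  have hd : ∀ s ∈ ball (0 : ℂ) r,
      HasDerivAt (fun s => f (p.1, s)) (fderiv ℂ f (p.1, s) (0, 1)) s := fun s hs =>
    (h (p.1, s) ⟨hp.1, hs⟩).1.differentiableAt.hasFDerivAt.comp_hasDerivAt s
      ((hasDerivAt_const s p.1).prodMk (hasDerivAt_id s))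
  have hc : ContinuousOn (fun s => fderiv ℂ f (p.1, s) (0, 1)) (ball 0 r) := fun s hs =>
    ((h (p.1, s) ⟨hp.1, hs⟩).2.continuousAt.comp
      (by fun_prop : ContinuousAt (fun s : ℂ => (p.1, s)) s)).continuousWithinAt
  have := mul_integral_segment_eq_sub hc hd (mem_ball_self hr)
    (by simpa using hp.2 : (0 : ℂ) + p.2 ∈ ball 0 r)
  simpa [hp0] using this.symm

/-- An analytic function vanishing on the curve `ε = z ^ n` is analytically divisible by
`z ^ n - ε`. -/
theorem AnalyticAt.exists_eq_pow_sub_mul_s7 {D : ℂ × ℂ → ℂ} {n : ℕ} (hn : n ≠ 0)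
    (hD : AnalyticAt ℂ D (0, 0)) (h0 : ∀ᶠ δ in 𝓝 (0 : ℂ), D (δ, δ ^ n) = 0) :
    ∃ g : ℂ × ℂ → ℂ, AnalyticAt ℂ g (0, 0) ∧
      ∀ᶠ p in 𝓝 ((0 : ℂ), (0 : ℂ)), D p = (p.1 ^ n - p.2) * g p := by
  let σ : ℂ × ℂ → ℂ × ℂ := fun p => (p.1, p.1 ^ n - p.2)
  have hσ : ∀ p, AnalyticAt ℂ σ p := fun p =>
    analyticAt_fst.prod ((analyticAt_fst.pow n).sub analyticAt_snd)
  have hσ0 : σ (0, 0) = (0, 0) := by simp [σ, hn]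
  have hσσ : ∀ p, σ (σ p) = p := fun p => by simp [σ]
  obtain ⟨g, hg, hfg⟩ := AnalyticAt.exists_eq_snd_mul (f := D ∘ σ) (x₀ := 0)
    (AnalyticAt.comp (hσ0.symm ▸ hD) (hσ _)) (by simpa [σ] using h0)
  refine ⟨g ∘ σ, AnalyticAt.comp (hσ0.symm ▸ hg) (hσ _), ?_⟩
  have ht : Tendsto σ (𝓝 (0, 0)) (𝓝 (0, 0)) := by
    simpa only [hσ0] using (hσ (0, 0)).continuousAt.tendsto
  filter_upwards [ht.eventually hfg] with p hp
  simpa only [Function.comp, hσσ] using hp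

theorem AnalyticAt.exists_primitive_fst_s7 {h : ℂ × ℂ → ℂ} (hh : AnalyticAt ℂ h (0, 0)) :
    ∃ H : ℂ × ℂ → ℂ, AnalyticAt ℂ H (0, 0) ∧ H (0, 0) = 0 ∧
      ∀ᶠ p in 𝓝 ((0 : ℂ), (0 : ℂ)), HasDerivAt (fun z => H (z, p.2)) (h p) p.1 := by
  have hs : ∀ p : ℂ × ℂ, AnalyticAt ℂ Prod.swap p := fun p => analyticAt_snd.prod analyticAt_fst
  have hh' : AnalyticAt ℂ (h ∘ Prod.swap) (0, 0) := AnalyticAt.comp (g := h) hh (hs _)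
  refine ⟨fun p => p.1 * ∫ t in (0 : ℝ)..1, h (t * p.1, p.2),
    analyticAt_fst.mul (AnalyticAt.comp (f := Prod.swap)
      (g := fun p : ℂ × ℂ => ∫ t in (0 : ℝ)..1, h (t * p.2, p.1)) (x := ((0 : ℂ), (0 : ℂ)))
      hh'.integral_segment_s7 (hs (0, 0))), by simp, ?_⟩
  exact (continuous_swap.tendsto ((0 : ℂ), (0 : ℂ))).eventually hh'.exists_hasDerivAt_mul_segment

/-- Solving `∫ s in 0..w, F (x, s) = H x` for `w` analytically in `x`. -/
theorem AnalyticAt.exists_solution_mul_segment {E : Type*} [NormedAddCommGroup E]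
    [NormedSpace ℂ E] [CompleteSpace E] {F : E × ℂ → ℂ} {H : E → ℂ} {x₀ : E}
    (hF : AnalyticAt ℂ F (x₀, 0)) (hF0 : F (x₀, 0) ≠ 0) (hH : AnalyticAt ℂ H x₀)
    (hH0 : H x₀ = 0) :
    ∃ w : E → ℂ, AnalyticAt ℂ w x₀ ∧ w x₀ = 0 ∧
      ∀ᶠ x in 𝓝 x₀, w x * ∫ t in (0 : ℝ)..1, F (x, t * w x) = H x := by
  let Φ : E × ℂ → ℂ := fun p => p.2 * (∫ t in (0 : ℝ)..1, F (p.1, t * p.2)) - H p.1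
  have hΦ : AnalyticAt ℂ Φ (x₀, 0) :=
    (analyticAt_snd.mul hF.integral_segment_s7).sub (AnalyticAt.comp hH analyticAt_fst)
  have hd : fderiv ℂ Φ (x₀, 0) (0, 1) = F (x₀, 0) := by
    have h1 : HasDerivAt (fun s => Φ (x₀, s)) (fderiv ℂ Φ (x₀, 0) (0, 1)) 0 :=
      hΦ.differentiableAt.hasFDerivAt.comp_hasDerivAt (0 : ℂ)
        ((hasDerivAt_const (0 : ℂ) x₀).prodMk (hasDerivAt_id (0 : ℂ)))
    exact h1.unique (hF.exists_hasDerivAt_mul_segment.self_of_nhds.sub_const (H x₀))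
  have hinv : (fderiv ℂ Φ (x₀, (0 : ℂ)) ∘L .inr ℂ E ℂ).IsInvertible :=
    ⟨ContinuousLinearEquiv.unitsEquivAut ℂ (Units.mk0 _ hF0), by ext; simp [hd]⟩
  have hcd : ContDiffAt ℂ ω Φ (x₀, 0) := hΦ.contDiffAt
  have hω : (ω : WithTop ℕ∞) ≠ 0 := by simp
  refine ⟨hcd.implicitFunction hω hinv, ?_, hcd.implicitFunction_apply_self hω hinv, ?_⟩
  · exact (hcd.contDiffAt_implicitFunction hω hinv).analyticAt
  · filter_upwards [hcd.eventually_apply_implicitFunction hω hinv] with x hx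
    simpa [Φ, hH0, sub_eq_zero] using hx

/-- Two families whose unit factors agree on the singular points are conjugate. The conjugacy is
`ψ = z + (z ^ n - ε) w`, where `w` is chosen so that the time form of the second family,
integrated from `z` to `ψ`, is a primitive of the difference of the two time forms. -/
theorem exists_conjugacy_of_eq_on_zeros {n : ℕ} (hn0 : n ≠ 0) {v tv : ℂ × ℂ → ℂ}
    (hv : AnalyticAt ℂ v (0, 0)) (hv0 : v (0, 0) ≠ 0)
    (htv : AnalyticAt ℂ tv (0, 0)) (htv0 : tv (0, 0) ≠ 0)
    (heq : ∀ᶠ δ in 𝓝 (0 : ℂ), tv (δ, δ ^ n) = v (δ, δ ^ n)) :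
    ∃ ψ : ℂ × ℂ → ℂ, AnalyticAt ℂ ψ (0, 0) ∧ ψ (0, 0) = 0 ∧ fderiv ℂ ψ (0, 0) (1, 0) ≠ 0 ∧
      ∀ᶠ p in 𝓝 ((0 : ℂ), (0 : ℂ)), deriv (fun z => ψ (z, p.2)) p.1 * ((p.1 ^ n - p.2) * v p)
        = (ψ p ^ n - p.2) * tv (ψ p, p.2) := by
  obtain ⟨g, hg, hgD⟩ := AnalyticAt.exists_eq_pow_sub_mul_s7 hn0 (htv.sub hv)
    (heq.mono fun δ h => by simpa [sub_eq_zero] using h)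
  have hh : AnalyticAt ℂ (fun p => g p / (v p * tv p)) (0, 0) :=
    hg.div (hv.mul htv) (mul_ne_zero hv0 htv0)
  obtain ⟨H, hH, hH0, hHd⟩ := hh.exists_primitive_fst_s7
  let P : ℂ × ℂ → ℂ := fun p => p.1 ^ n - p.2
  have hP : ∀ p, AnalyticAt ℂ P p := fun p => (analyticAt_fst.pow n).sub analyticAt_snd
  have hP0 : P (0, 0) = 0 := by simp [P, hn0]
  let m : (ℂ × ℂ) × ℂ → ℂ := fun q => q.1.1 + P q.1 * q.2
  have hfst : ∀ q : (ℂ × ℂ) × ℂ, AnalyticAt ℂ (fun q : (ℂ × ℂ) × ℂ => q.1) q :=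
    fun q => analyticAt_fst
  have hm : ∀ q, AnalyticAt ℂ m q := fun q =>
    (AnalyticAt.comp analyticAt_fst (hfst q)).add
      ((AnalyticAt.comp (hP _) (hfst q)).mul analyticAt_snd)
  let R : (ℂ × ℂ) × ℂ → ℂ := fun q =>
    1 + q.2 * ∑ i ∈ Finset.range n, m q ^ i * q.1.1 ^ (n - 1 - i)
  have hR : ∀ q, AnalyticAt ℂ R q := fun q => by
    refine analyticAt_const.add (analyticAt_snd.mul ?_)
    exact Finset.analyticAt_fun_sum _ fun i _ =>
      ((hm q).pow i).mul ((AnalyticAt.comp analyticAt_fst (hfst q)).pow _)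
  have hPR : ∀ q, m q ^ n - q.1.2 = P q.1 * R q := fun q => by
    have := (Commute.all (m q) q.1.1).mul_geom_sum₂ n
    have h2 : m q - q.1.1 = P q.1 * q.2 := by simp [m]
    rw [h2] at this
    simp only [R, mul_add, ← mul_assoc, this]
    simp [P]
  let M : (ℂ × ℂ) × ℂ → ℂ × ℂ := fun q => (m q, q.1.2)
  have hM : ∀ q, AnalyticAt ℂ M q := fun q => (hm q).prod (AnalyticAt.comp analyticAt_snd (hfst q))
  have hM0 : M ((0, 0), 0) = (0, 0) := by simp [M, m]
  have htM : AnalyticAt ℂ (fun q => tv (M q)) ((0, 0), 0) :=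
    AnalyticAt.comp (hM0.symm ▸ htv) (hM _)
  have hK : AnalyticAt ℂ (fun q => (R q * tv (M q))⁻¹) ((0, 0), 0) :=
    ((hR _).mul htM).inv (by simp [hM0, R, htv0])
  obtain ⟨w, hw, hw0, hwe⟩ := hK.exists_solution_mul_segment (by simp [hM0, R, htv0]) hH hH0
  let ψ : ℂ × ℂ → ℂ := fun p => p.1 + P p * w p
  have hψ : AnalyticAt ℂ ψ (0, 0) := analyticAt_fst.add ((hP _).mul hw)
  refine ⟨ψ, hψ, by simp [ψ, hP0], ?_, ?_⟩
  · have h1 : HasFDerivAt ψ _ ((0 : ℂ), (0 : ℂ)) :=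
      hasFDerivAt_fst.add ((hP (0, 0)).differentiableAt.hasFDerivAt.mul
        hw.differentiableAt.hasFDerivAt)
    rw [h1.fderiv]
    simp [hP0, hw0]
  obtain ⟨η, hη, hball⟩ := Metric.eventually_nhds_iff_ball.1
    (((hR ((0, 0), 0)).continuousAt.eventually_ne (by simp [R] : R ((0, 0), 0) ≠ 0)).and
      ((htM.continuousAt.eventually_ne (by simpa [hM0] using htv0)).and
        ((hM ((0, 0), 0)).continuousAt.tendsto.eventually
          (hM0.symm ▸ htv.eventually_analyticAt))))
  rw [← ball_prod_same] at hball
  filter_upwards [hgD, hHd, hwe.eventually_nhds, ball_mem_nhds _ hη,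
    hw.continuousAt.eventually_mem (isOpen_ball.mem_nhds (by rw [hw0]; exact mem_ball_self hη)),
    hψ.eventually_analyticAt, hv.continuousAt.eventually_ne hv0,
    htv.continuousAt.eventually_ne htv0] with p hgp hHp hwp hpη hwη hψp hvp htvp
  by_cases hPp : P p = 0
  · have h1 : ψ p = p.1 := by simp [ψ, hPp]
    have h2 : p.1 ^ n - p.2 = 0 := hPp
    simp [h1, h2]
  let f : ℂ → ℂ := fun u => ((u ^ n - p.2) * tv (u, p.2))⁻¹
  have hmem : ∀ u ∈ ball p.1 (‖P p‖ * η),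
      u ^ n - p.2 ≠ 0 ∧ tv (u, p.2) ≠ 0 ∧ AnalyticAt ℂ tv (u, p.2) := by
    intro u hu
    have hτ : (u - p.1) / P p ∈ ball (0 : ℂ) η := by
      rw [mem_ball_zero_iff, norm_div, div_lt_iff₀' (norm_pos_iff.2 hPp)]
      simpa [dist_eq_norm] using hu
    have hmu : m (p, (u - p.1) / P p) = u := by
      simp only [m]; field_simp; ring
    obtain ⟨h1, h2, h3⟩ := hball (p, (u - p.1) / P p) ⟨hpη, hτ⟩
    have hMu : M (p, (u - p.1) / P p) = (u, p.2) := by simp only [M, hmu]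
    have := hPR (p, (u - p.1) / P p)
    rw [hmu] at this
    rw [hMu] at h2 h3
    exact ⟨by rw [this]; exact mul_ne_zero hPp h1, h2, h3⟩
  have hfd : DifferentiableOn ℂ f (ball p.1 (‖P p‖ * η)) := fun u hu => by
    obtain ⟨h1, h2, h3⟩ := hmem u hu
    have h4 : DifferentiableAt ℂ (fun u => tv (u, p.2)) u :=
      h3.differentiableAt.comp u (by fun_prop : DifferentiableAt ℂ (fun u : ℂ => (u, p.2)) u)
    have h5 : DifferentiableAt ℂ (fun u : ℂ => u ^ n - p.2) u := by fun_prop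
    exact ((h5.mul h4).inv (mul_ne_zero h1 h2)).differentiableWithinAt
  obtain ⟨T, hT⟩ := hfd.isExactOn_ball
  have hρ : 0 < ‖P p‖ * η := mul_pos (norm_pos_iff.2 hPp) hη
  have hψmem : ψ p ∈ ball p.1 (‖P p‖ * η) := by
    have := mul_lt_mul_of_pos_left (mem_ball_zero_iff.1 hwη) (norm_pos_iff.2 hPp)
    simpa [ψ, dist_eq_norm] using this
  have hι : Continuous fun z : ℂ => (z, p.2) := by fun_prop
  have hιp : Tendsto (fun z : ℂ => (z, p.2)) (𝓝 p.1) (𝓝 p) := hι.tendsto p.1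
  have hψι : DifferentiableAt ℂ (fun z => ψ (z, p.2)) p.1 :=
    DifferentiableAt.comp (g := ψ) p.1 hψp.differentiableAt
      (by fun_prop : DifferentiableAt ℂ (fun u : ℂ => (u, p.2)) p.1)
  have hkey : ∀ᶠ z in 𝓝 p.1, T (ψ (z, p.2)) - T z = H (z, p.2) := by
    filter_upwards [hιp.eventually hwp, ball_mem_nhds p.1 hρ,
      hψι.continuousAt.eventually_mem (isOpen_ball.mem_nhds hψmem),
      ((hP p).continuousAt.tendsto.comp hιp).eventually_ne hPp] with z hz hzb hψb hPz
    have h1 := mul_integral_segment_eq_sub (b := P (z, p.2) * w (z, p.2)) hfd.continuousOn hT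
      hzb hψb
    have h2 : ∀ t : ℝ, (R ((z, p.2), t * w (z, p.2)) * tv (M ((z, p.2), t * w (z, p.2))))⁻¹
        = P (z, p.2) * f (z + t * (P (z, p.2) * w (z, p.2))) := fun t => by
      have h3 : m ((z, p.2), t * w (z, p.2)) = z + t * (P (z, p.2) * w (z, p.2)) := by
        simp only [m]; ring
      have h4 := hPR ((z, p.2), t * w (z, p.2))
      have hPz' : P (z, p.2) ≠ 0 := hPz
      simp only [h3] at h4
      simp only [M, h3, f, h4, mul_inv, mul_assoc, mul_inv_cancel_left₀ hPz']
    simp only [h2, intervalIntegral.integral_const_mul] at hz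
    rw [← hz, ← h1]
    ring
  have hd := ((hT _ hψmem).comp p.1 hψι.hasDerivAt).sub (hT _ (mem_ball_self hρ))
  have hd' := hHp.unique (hd.congr_of_eventuallyEq (hkey.mono fun z hz => hz.symm))
  obtain ⟨h1, h2, -⟩ := hmem _ hψmem
  have hgp' : tv p - v p = P p * g p := hgp
  have hf1 : f p.1 = (P p * tv p)⁻¹ := rfl
  have hf2 : f (ψ p) = ((ψ p ^ n - p.2) * tv (ψ p, p.2))⁻¹ := rfl
  change _ * (P p * v p) = _
  rw [hf1, hf2] at hd'
  field_simp at hd'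
  refine mul_left_cancel₀ htvp ?_
  linear_combination -hd' - (ψ p ^ n - p.2) * tv (ψ p, p.2) * hgp'

theorem hasDerivAt_comp_prodMk_left {ψ : ℂ × ℂ → ℂ} {p : ℂ × ℂ} (hψ : DifferentiableAt ℂ ψ p) :
    HasDerivAt (fun z => ψ (z, p.2)) (fderiv ℂ ψ p (1, 0)) p.1 :=
  HasFDerivAt.comp_hasDerivAt (l := ψ) p.1 hψ.hasFDerivAt
    ((hasDerivAt_id p.1).prodMk (hasDerivAt_const p.1 p.2))

theorem deriv_ne_zero_of_conjugacy {k : ℕ} (hk : 1 ≤ k) {f a c : ℂ → ℂ}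
    (hf : AnalyticAt ℂ f 0) (hf0 : f 0 = 0) (hne : ¬ ∀ᶠ z in 𝓝 0, f z = 0)
    (ha : ContinuousAt a 0) (ha0 : a 0 ≠ 0) (hc : ContinuousAt c 0)
    (h : ∀ᶠ z in 𝓝 0, deriv f z * (z ^ (k + 1) * a z) = f z ^ (k + 1) * c z) :
    deriv f 0 ≠ 0 := by
  obtain ⟨m, u, hu, hu0, hfu⟩ := hf.exists_eventuallyEq_pow_smul_nonzero_iff.2 hne
  simp only [sub_zero, smul_eq_mul] at hfu
  have hd : ∀ᶠ z in 𝓝 (0 : ℂ), deriv f z = m * z ^ (m - 1) * u z + z ^ m * deriv u z := by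
    filter_upwards [hfu.eventually_nhds, hu.eventually_analyticAt] with z hz huz
    have := ((hasDerivAt_pow m z).mul huz.differentiableAt.hasDerivAt).congr_of_eventuallyEq hz
    exact this.deriv
  rcases m with _ | _ | m
  · exact absurd (hfu.self_of_nhds.symm.trans hf0) (by simpa using hu0)
  · rw [hd.self_of_nhds]
    simpa using hu0
  · exfalso
    obtain ⟨l, rfl⟩ := Nat.exists_eq_add_of_le hk
    let A : ℂ → ℂ := fun z => ((m + 2 : ℂ) * u z + z * deriv u z) * a z
    let B : ℂ → ℂ := fun z => z * (z ^ (m * (l + 1) + l) * u z ^ (l + 2) * c z)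
    have hAB : ∀ᶠ z in 𝓝[≠] (0 : ℂ), A z = B z := by
      filter_upwards [eventually_nhdsWithin_of_eventually_nhds hfu,
        eventually_nhdsWithin_of_eventually_nhds hd,
        eventually_nhdsWithin_of_eventually_nhds h, self_mem_nhdsWithin] with z h1 h2 h3 hz
      rw [h1, h2] at h3
      refine mul_left_cancel₀ (pow_ne_zero (m + l + 3) hz) ?_
      simp only [A, B]
      push_cast at h3
      linear_combination h3
    have hA : ContinuousAt A 0 := ((continuousAt_const.mul hu.continuousAt).add
      (continuousAt_id.mul hu.deriv.continuousAt)).mul ha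
    have hB : ContinuousAt B 0 := continuousAt_id.mul
      (((continuousAt_id.pow _).mul (hu.continuousAt.pow _)).mul hc)
    have hAB0 : A 0 = B 0 :=
      tendsto_nhds_unique (hA.tendsto.mono_left nhdsWithin_le_nhds)
        ((hB.tendsto.mono_left nhdsWithin_le_nhds).congr' (hAB.mono fun z hz => hz.symm))
    have hm : (m + 2 : ℂ) ≠ 0 := by exact_mod_cast (by omega : m + 2 ≠ 0)
    simp [A, B, ha0, hu0, hm] at hAB0

/-- An analytic `n`-th root of `δ ^ n` is `ζ * δ` with `ζ ^ n = 1`. -/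
theorem AnalyticAt.eventually_eq_mul_of_pow_eq {g : ℂ → ℂ} {n : ℕ} (hn : n ≠ 0)
    (hg : AnalyticAt ℂ g 0) (hgn : ∀ᶠ δ in 𝓝 (0 : ℂ), g δ ^ n = δ ^ n) :
    ∃ ζ : ℂ, ζ ^ n = 1 ∧ ∀ᶠ δ in 𝓝 (0 : ℂ), g δ = ζ * δ := by
  have hg0 : g 0 = 0 := by
    have := hgn.self_of_nhds
    rw [zero_pow hn] at this
    exact pow_eq_zero_iff hn |>.1 this
  let q : ℂ → ℂ := dslope g 0
  have hq : ContinuousAt q 0 := continuousAt_dslope_same.2 hg.differentiableAt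
  have hgq : ∀ δ, g δ = q δ * δ := fun δ => by
    have := sub_smul_dslope g 0 δ
    simp only [sub_zero, hg0, smul_eq_mul] at this
    rw [← this, mul_comm]
  have hq1 : ∀ᶠ δ in 𝓝[≠] (0 : ℂ), q δ ^ n = 1 := by
    filter_upwards [eventually_nhdsWithin_of_eventually_nhds hgn, self_mem_nhdsWithin]
      with δ h1 hδ
    rw [hgq, mul_pow] at h1
    exact mul_right_cancel₀ (pow_ne_zero n hδ) (h1.trans (one_mul _).symm)
  have hq0 : q 0 ^ n = 1 :=
    tendsto_nhds_unique ((hq.pow n).tendsto.mono_left nhdsWithin_le_nhds)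
      (tendsto_const_nhds.congr' (hq1.mono fun z hz => hz.symm))
  have hfin : ({x : ℂ | x ^ n = 1} \ {q 0}).Finite := by
    refine Set.Finite.subset (Polynomial.nthRoots n (1 : ℂ)).toFinset.finite_toSet ?_
    intro x hx
    simpa [Polynomial.mem_nthRoots (Nat.pos_of_ne_zero hn)] using hx.1
  refine ⟨q 0, hq0, ?_⟩
  have hev := hq.eventually_mem (hfin.isClosed.isOpen_compl.mem_nhds (by simp))
  filter_upwards [hev, eventually_nhdsWithin_iff.1 hq1] with δ h1 h2
  rcases eq_or_ne δ 0 with rfl | hδ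
  · simp [hg0]
  · have : q δ = q 0 := by
      by_contra hne
      exact h1 ⟨h2 hδ, hne⟩
    rw [hgq, this]

/-- A conjugacy maps singular points to singular points and preserves eigenvalues there. -/
theorem exists_eigenvalue_eq_of_conjugacy {k : ℕ} {v tv ψ : ℂ × ℂ → ℂ}
    (hv : AnalyticAt ℂ v (0, 0)) (htv : AnalyticAt ℂ tv (0, 0)) (htv0 : tv (0, 0) ≠ 0)
    (hψ : AnalyticAt ℂ ψ (0, 0)) (hψ0 : ψ (0, 0) = 0) (hψ1 : fderiv ℂ ψ (0, 0) (1, 0) ≠ 0)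
    (h : ∀ᶠ p in 𝓝 ((0 : ℂ), (0 : ℂ)),
      deriv (fun z => ψ (z, p.2)) p.1 * ((p.1 ^ (k + 1) - p.2) * v p)
        = (ψ p ^ (k + 1) - p.2) * tv (ψ p, p.2)) :
    ∃ ζ : ℂ, ζ ^ (k + 1) = 1 ∧ ∀ᶠ δ in 𝓝 (0 : ℂ),
      ((k : ℂ) + 1) * δ ^ k * tv (δ, δ ^ (k + 1))
        = ((k : ℂ) + 1) * (ζ * δ) ^ k * v (ζ * δ, (ζ * δ) ^ (k + 1)) := by
  let c : ℂ → ℂ × ℂ := fun δ => (δ, δ ^ (k + 1))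
  have hc : AnalyticAt ℂ c 0 := analyticAt_id.prod (analyticAt_id.pow _)
  have hc0 : c 0 = (0, 0) := by simp [c]
  have hct : Tendsto c (𝓝 0) (𝓝 (0, 0)) := hc0 ▸ hc.continuousAt.tendsto
  let N : ℂ × ℂ → ℂ × ℂ := fun p => (ψ p, p.2)
  have hNt : Tendsto N (𝓝 (0, 0)) (𝓝 (0, 0)) := by
    have : ContinuousAt N (0, 0) := hψ.continuousAt.prodMk continuousAt_snd
    simpa [ContinuousAt, N, hψ0] using this
  have hfd : ContinuousAt (fun p => fderiv ℂ ψ p (1, 0)) (0, 0) :=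
    hψ.fderiv.continuousAt.clm_apply continuousAt_const
  have hgood : ∀ᶠ p in 𝓝 ((0 : ℂ), (0 : ℂ)), p.1 ^ (k + 1) = p.2 → ψ p ^ (k + 1) = p.2 ∧
      ((k : ℂ) + 1) * p.1 ^ k * v p = ((k : ℂ) + 1) * ψ p ^ k * tv (ψ p, p.2) := by
    filter_upwards [h.eventually_nhds, hv.eventually_analyticAt,
      hNt.eventually htv.eventually_analyticAt, hNt.eventually (htv.continuousAt.eventually_ne htv0),
      hψ.eventually_analyticAt, hfd.eventually_ne hψ1] with p hp hvp htvp htvp0 hψp hψp1 hpz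
    have h0 : ψ p ^ (k + 1) - p.2 = 0 := by
      have := hp.self_of_nhds
      rw [hpz, sub_self, zero_mul, mul_zero] at this
      exact (mul_eq_zero.1 this.symm).resolve_right htvp0
    refine ⟨sub_eq_zero.1 h0, ?_⟩
    have hι : AnalyticAt ℂ (fun z : ℂ => (z, p.2)) p.1 := analyticAt_id.prod analyticAt_const
    have hψι := hasDerivAt_comp_prodMk_left hψp.differentiableAt
    have hψa : AnalyticAt ℂ (fun z => ψ (z, p.2)) p.1 := AnalyticAt.comp (g := ψ) hψp hι
    have hV := hasDerivAt_comp_prodMk_left hvp.differentiableAt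
    have hTV : DifferentiableAt ℂ (fun z => tv (ψ (z, p.2), p.2)) p.1 :=
      DifferentiableAt.comp (g := tv) p.1 htvp.differentiableAt
        (hψι.differentiableAt.prodMk (differentiableAt_const _))
    have hL := hψa.deriv.differentiableAt.hasDerivAt.mul
      (((hasDerivAt_pow (k + 1) p.1).sub_const p.2).mul hV)
    have hRd := ((hψι.pow (k + 1)).sub_const p.2).mul hTV.hasDerivAt
    have heq := hL.unique (hRd.congr_of_eventuallyEq ((hι.continuousAt.tendsto).eventually hp))
    have hpz' : p.1 ^ (k + 1) - p.2 = 0 := sub_eq_zero.2 hpz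
    have hDp : deriv (fun z => ψ (z, p.2)) p.1 = fderiv ℂ ψ p (1, 0) := hψι.deriv
    simp [hpz', h0, hDp] at heq
    refine mul_left_cancel₀ hψp1 ?_
    linear_combination heq
  have hg : AnalyticAt ℂ (ψ ∘ c) 0 := AnalyticAt.comp (hc0.symm ▸ hψ) hc
  have hgc := hct.eventually hgood
  obtain ⟨ζ, hζ, hζg⟩ := hg.eventually_eq_mul_of_pow_eq k.succ_ne_zero
    (hgc.mono fun δ hδ => (hδ rfl).1)
  have hζ0 : ζ ≠ 0 := by rintro rfl; simp at hζ
  refine ⟨ζ⁻¹, by simp [inv_pow, hζ], ?_⟩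
  have hmul : Tendsto (fun δ : ℂ => ζ⁻¹ * δ) (𝓝 0) (𝓝 0) := by
    simpa using (continuous_const_mul ζ⁻¹).tendsto (0 : ℂ)
  filter_upwards [hmul.eventually hgc, hmul.eventually hζg] with δ h1 h2
  have h3 := (h1 rfl).2
  have h4 : ψ (c (ζ⁻¹ * δ)) = δ := by
    rw [show ψ (c (ζ⁻¹ * δ)) = ζ * (ζ⁻¹ * δ) from h2, mul_inv_cancel_left₀ hζ0]
  have h5 : (ζ⁻¹ * δ) ^ (k + 1) = δ ^ (k + 1) := by simp [mul_pow, hζ]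
  rw [h4] at h3
  simp only [c] at h3
  rw [h3, h5]

/-- If `∂ψ/∂z ≠ 0` at the origin, then `ψ` is injective in `z` near the origin, uniformly in the
parameter. -/
theorem AnalyticAt.exists_injOn_slices {ψ : ℂ × ℂ → ℂ} (hψ : AnalyticAt ℂ ψ (0, 0))
    (hψ1 : fderiv ℂ ψ (0, 0) (1, 0) ≠ 0) :
    ∃ s ∈ 𝓝 ((0 : ℂ), (0 : ℂ)), ∀ p ∈ s, ∀ q ∈ s, p.2 = q.2 → ψ p = ψ q → p = q := by
  obtain ⟨s, hs, hsL⟩ := hψ.hasStrictFDerivAt.approximates_deriv_on_nhds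
    (c := ‖fderiv ℂ ψ (0, 0) (1, 0)‖₊ / 2) (Or.inr (half_pos (nnnorm_pos.2 hψ1)))
  refine ⟨s, hs, fun p hp q hq h2 hpq => ?_⟩
  have h := hsL p hp q hq
  have hd : p - q = (p.1 - q.1) • ((1 : ℂ), (0 : ℂ)) := by
    ext <;> simp [h2]
  have hn : ‖p - q‖ = ‖p.1 - q.1‖ := by rw [hd, norm_smul]; simp [Prod.norm_def]
  rw [hn, hd, hpq, sub_self, zero_sub, norm_neg, map_smul, norm_smul] at h
  have hpos : 0 < ‖fderiv ℂ ψ (0, 0) (1, 0)‖ := norm_pos_iff.2 hψ1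
  push_cast at h
  have h0 : ‖p.1 - q.1‖ = 0 := by nlinarith [norm_nonneg (p.1 - q.1)]
  exact Prod.ext (sub_eq_zero.1 (norm_eq_zero.1 h0)) h2

/-- Two factored families `(z^{k+1}−ε)·v(z,ε)` and `(z^{k+1}−ε)·ṽ(z,ε)` of
codimension `k` are conjugate by a parameter-preserving analytic conjugacy if and only if
their natural eigenvalue functions satisfy `λ̃(δ) = λ(ζ·δ)` near `0` for some `(k+1)`-st
root of unity `ζ`. -/
theorem statement7 (k : ℕ) (hk : 1 ≤ k) (v tv : ℂ → ℂ → ℂ)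
    (hv : AnalyticAt ℂ (fun p : ℂ × ℂ => v p.1 p.2) (0, 0)) (hv0 : v 0 0 ≠ 0)
    (htv : AnalyticAt ℂ (fun p : ℂ × ℂ => tv p.1 p.2) (0, 0)) (htv0 : tv 0 0 ≠ 0) :
    (∃ (r ρ : ℝ) (ψ : ℂ → ℂ → ℂ), 0 < r ∧ 0 < ρ ∧
      AnalyticOnNhd ℂ (fun p : ℂ × ℂ => ψ p.1 p.2) (ball 0 r ×ˢ ball 0 ρ) ∧
      ψ 0 0 = 0 ∧
      (∀ ε ∈ ball (0 : ℂ) ρ, Set.InjOn (fun z => ψ z ε) (ball 0 r)) ∧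
      ∀ z ∈ ball (0 : ℂ) r, ∀ ε ∈ ball (0 : ℂ) ρ,
        deriv (fun z => ψ z ε) z * ((z ^ (k + 1) - ε) * v z ε)
          = (ψ z ε ^ (k + 1) - ε) * tv (ψ z ε) ε) ↔
    (∃ ζ : ℂ, ζ ^ (k + 1) = 1 ∧ ∀ᶠ δ in nhds (0 : ℂ),
      ((k : ℂ) + 1) * δ ^ k * tv δ (δ ^ (k + 1))
        = ((k : ℂ) + 1) * (ζ * δ) ^ k * v (ζ * δ) ((ζ * δ) ^ (k + 1))) := by
  constructor
  · rintro ⟨r, ρ, ψ, hr, hρ, hψ, hψ0, hinj, heq⟩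
    have hψa := hψ (0, 0) ⟨mem_ball_self hr, mem_ball_self hρ⟩
    have hslice := hasDerivAt_comp_prodMk_left hψa.differentiableAt
    have hι : AnalyticAt ℂ (fun z : ℂ => (z, (0 : ℂ))) 0 := analyticAt_id.prod analyticAt_const
    have hψι : AnalyticAt ℂ (fun z => ψ z 0) 0 :=
      AnalyticAt.comp_of_eq (g := fun p : ℂ × ℂ => ψ p.1 p.2) hψa hι rfl
    refine exists_eigenvalue_eq_of_conjugacy (ψ := fun p => ψ p.1 p.2) hv htv htv0 hψa hψ0 ?_ ?_
    · rw [← hslice.deriv]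
      refine deriv_ne_zero_of_conjugacy (a := fun z => v z 0) (c := fun z => tv (ψ z 0) 0)
        hk hψι hψ0 (fun hz => ?_)
        (ContinuousAt.comp_of_eq (g := fun p : ℂ × ℂ => v p.1 p.2) hv.continuousAt
          hι.continuousAt rfl) hv0
        (ContinuousAt.comp_of_eq (g := fun p : ℂ × ℂ => tv p.1 p.2) htv.continuousAt
          (hψι.continuousAt.prodMk continuousAt_const) (by simp [hψ0])) ?_
      · have hev : ∀ᶠ z in 𝓝[≠] (0 : ℂ), False := by
          filter_upwards [eventually_nhdsWithin_of_eventually_nhds hz,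
            eventually_nhdsWithin_of_eventually_nhds (ball_mem_nhds (0 : ℂ) hr),
            self_mem_nhdsWithin] with z h1 h2 h3
          exact h3 (hinj 0 (mem_ball_self hρ) h2 (mem_ball_self hr) (h1.trans hψ0.symm))
        exact hev.exists.elim fun _ h => h
      · filter_upwards [ball_mem_nhds (0 : ℂ) hr] with z hz
        simpa using heq z hz 0 (mem_ball_self hρ)
    · filter_upwards [prod_mem_nhds (ball_mem_nhds (0 : ℂ) hr) (ball_mem_nhds (0 : ℂ) hρ)] with p hp
      exact heq p.1 hp.1 p.2 hp.2
  · rintro ⟨ζ, hζ, hev⟩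
    have hζ0 : ζ ≠ 0 := by rintro rfl; simp at hζ
    have hζζ : ζ * ζ ^ k = 1 := by rw [← pow_succ', hζ]
    have hscale : ∀ c : ℂ, ∀ p, AnalyticAt ℂ (fun p : ℂ × ℂ => (c * p.1, p.2)) p := fun c p =>
      (analyticAt_const.mul analyticAt_fst).prod analyticAt_snd
    let v' : ℂ × ℂ → ℂ := fun p => ζ ^ k * v (ζ * p.1) p.2
    have hv' : AnalyticAt ℂ v' (0, 0) := analyticAt_const.mul
      (AnalyticAt.comp_of_eq (g := fun p : ℂ × ℂ => v p.1 p.2) hv (hscale ζ (0, 0)) (by simp))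
    have hv'0 : v' (0, 0) ≠ 0 := by simp [v', hζ0, hv0]
    have hc : AnalyticAt ℂ (fun δ : ℂ => (δ, δ ^ (k + 1))) 0 :=
      analyticAt_id.prod (analyticAt_id.pow _)
    have hag : ∀ᶠ δ in 𝓝 (0 : ℂ), tv δ (δ ^ (k + 1)) = v' (δ, δ ^ (k + 1)) := by
      have h1 : AnalyticAt ℂ (fun δ => tv δ (δ ^ (k + 1))) 0 :=
        AnalyticAt.comp_of_eq (g := fun p : ℂ × ℂ => tv p.1 p.2) htv hc (by simp)
      have h2 : AnalyticAt ℂ (fun δ => v' (δ, δ ^ (k + 1))) 0 :=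
        AnalyticAt.comp_of_eq (g := v') hv' hc (by simp)
      refine (h1.frequently_eq_iff_eventually_eq h2).1 (Eventually.frequently ?_)
      filter_upwards [eventually_nhdsWithin_of_eventually_nhds hev, self_mem_nhdsWithin]
        with δ hδ hδ0
      have hk0 : (k : ℂ) + 1 ≠ 0 := by exact_mod_cast k.succ_ne_zero
      have h3 : (ζ * δ) ^ (k + 1) = δ ^ (k + 1) := by rw [mul_pow, hζ, one_mul]
      refine mul_left_cancel₀ (mul_ne_zero hk0 (pow_ne_zero k hδ0)) ?_
      rw [h3, mul_pow] at hδ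
      simp only [v']
      linear_combination hδ
    obtain ⟨φ, hφ, hφ0, hφ1, hφe⟩ := exists_conjugacy_of_eq_on_zeros (n := k + 1) k.succ_ne_zero hv' hv'0
      htv htv0 hag
    let S : ℂ × ℂ → ℂ × ℂ := fun p => (ζ ^ k * p.1, p.2)
    have hS0 : S (0, 0) = (0, 0) := by simp [S]
    have hSt : Tendsto S (𝓝 (0, 0)) (𝓝 (0, 0)) := by
      have h : ContinuousAt S (0, 0) := (hscale (ζ ^ k) (0, 0)).continuousAt
      rwa [ContinuousAt, hS0] at h
    let ψ : ℂ × ℂ → ℂ := φ ∘ S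
    have hψ : AnalyticAt ℂ ψ (0, 0) := AnalyticAt.comp (hS0.symm ▸ hφ) (hscale _ _)
    have hψ1 : fderiv ℂ ψ (0, 0) (1, 0) ≠ 0 := by
      rw [← (hasDerivAt_comp_prodMk_left hψ.differentiableAt).deriv]
      have hφd := hasDerivAt_comp_prodMk_left hφ.differentiableAt
      change deriv (fun z => φ (ζ ^ k * z, 0)) 0 ≠ 0
      rw [deriv_comp_mul_left (ζ ^ k) (fun z => φ (z, 0)), mul_zero]
      rw [show deriv (fun z => φ (z, 0)) 0 = _ from hφd.deriv]
      exact smul_ne_zero (pow_ne_zero k hζ0) hφ1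
    obtain ⟨s, hs, hsi⟩ := hψ.exists_injOn_slices hψ1
    obtain ⟨r, hr, hball⟩ := Metric.eventually_nhds_iff_ball.1
      (hψ.eventually_analyticAt.and ((hSt.eventually hφe).and hs))
    rw [← ball_prod_same] at hball
    refine ⟨r, r, fun z ε => ψ (z, ε), hr, hr, fun p hp => (hball p hp).1,
      by simp [ψ, hS0, hφ0], fun ε hε z hz z' hz' h => ?_, fun z hz ε hε => ?_⟩
    · exact congrArg Prod.fst
        (hsi _ (hball (z, ε) ⟨hz, hε⟩).2.2 _ (hball (z', ε) ⟨hz', hε⟩).2.2 rfl h)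
    · have h1 := (hball (z, ε) ⟨hz, hε⟩).2.1
      have h2 : deriv (fun z => ψ (z, ε)) z
          = ζ ^ k * deriv (fun z => φ (z, ε)) (ζ ^ k * z) :=
        deriv_comp_mul_left (ζ ^ k) (fun z => φ (z, ε)) z
      have h3 : (ζ ^ k * z) ^ (k + 1) = z ^ (k + 1) := by
        rw [mul_pow, pow_right_comm, hζ, one_pow, one_mul]
      simp only [S, v', h3, ← mul_assoc, hζζ, one_mul] at h1
      rw [h2]
      simp only [ψ, S, Function.comp]
      linear_combination h1
end

section
/- Let k ≥ 1 and let ω(z,ε) = (z^{k+1} − ε)·v(z,ε) be a factored family of codimension k, and set σ(δ) := v(δ, δ^{k+1}), so that the natural eigenvalue function of ω is λ(δ) = (k+1)·δ^k·σ(δ). Then there exists a parameter-preserving conjugacy from ω to the family Ω(z,ε) := (z^{k+1} − ε)·σ(z): i.e., there exist r, ρ > 0 and an analytic map ψ : B(0,r) × B(0,ρ) → ℂ with ψ(0,0) = 0, z ↦ ψ(z,ε) injective for each ε, and ∂ψ/∂z(z,ε)·ω(z,ε) = Ω(ψ(z,ε), ε) on B(0,r) × B(0,ρ). In particular every factored family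 is conjugate, preserving the parameter, to a family of the form (z^{k+1} − ε)·σ(z) with σ independent of ε. -/
open Metric Set Filter Complex

open scoped Topology

attribute [local fun_prop] analyticAt_fst analyticAt_snd

section

open scoped unitInterval ContDiff

namespace ContinuousMultilinearMap

variable {𝕜 α ι E F : Type*} [NontriviallyNormedField 𝕜] [TopologicalSpace α] [CompactSpace α]
  [Fintype ι] [NormedAddCommGroup E] [NormedSpace 𝕜 E] [NormedAddCommGroup F] [NormedSpace 𝕜 F]

variable (α) in
/-- Pointwise application of a continuous multilinear map to continuous functions on a compact
space. -/
noncomputable def compLeftContinuousMap (p : ContinuousMultilinearMap 𝕜 (fun _ : ι => E) F) :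
    ContinuousMultilinearMap 𝕜 (fun _ : ι => C(α, E)) C(α, F) :=
  MultilinearMap.mkContinuous
    { toFun := fun m => ⟨fun s => p fun i => m i s, by fun_prop⟩
      map_update_add' := fun m i x y => by
        ext s
        have h (z : C(α, E)) : (fun j => Function.update m i z j s)
            = Function.update (fun j => m j s) i (z s) := by
          ext j
          rcases eq_or_ne j i with rfl | hj <;> simp [*]
        simp only [ContinuousMap.coe_mk, ContinuousMap.add_apply, h, p.map_update_add]
      map_update_smul' := fun m i c x => by
        ext s
        have h (z : C(α, E)) : (fun j => Function.update m i z j s)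
            = Function.update (fun j => m j s) i (z s) := by
          ext j
          rcases eq_or_ne j i with rfl | hj <;> simp [*]
        simp only [ContinuousMap.coe_mk, ContinuousMap.smul_apply, h, p.map_update_smul] }
    ‖p‖ fun m => by
      refine (ContinuousMap.norm_le _ (by positivity)).2 fun s => (p.le_opNorm _).trans ?_
      gcongr with i
      exact (m i).norm_coe_le_norm s

@[simp]
theorem compLeftContinuousMap_apply (p : ContinuousMultilinearMap 𝕜 (fun _ : ι => E) F)
    (m : ι → C(α, E)) (s : α) : p.compLeftContinuousMap α m s = p fun i => m i s :=
  rfl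

theorem norm_compLeftContinuousMap_le (p : ContinuousMultilinearMap 𝕜 (fun _ : ι => E) F) :
    ‖p.compLeftContinuousMap α‖ ≤ ‖p‖ :=
  MultilinearMap.mkContinuous_norm_le _ (norm_nonneg _) _

end ContinuousMultilinearMap

/-- The superposition operator `Y ↦ H ∘ Y` on continuous functions with values near `0` is
analytic when `H` is. -/
theorem AnalyticAt.exists_superposition {𝕜 E F : Type*} (α : Type*) [NontriviallyNormedField 𝕜]
    [TopologicalSpace α] [CompactSpace α] [NormedAddCommGroup E] [NormedSpace 𝕜 E]
    [NormedAddCommGroup F] [NormedSpace 𝕜 F] [CompleteSpace F] {H : E → F}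
    (hH : AnalyticAt 𝕜 H 0) :
    ∃ N : C(α, E) → C(α, F), AnalyticAt 𝕜 N 0 ∧ ∀ᶠ Y in 𝓝 0, ∀ s, N Y s = H (Y s) := by
  obtain ⟨p, r, hp⟩ := hH
  let P : FormalMultilinearSeries 𝕜 C(α, E) C(α, F) := fun n => (p n).compLeftContinuousMap α
  have hP : p.radius ≤ P.radius :=
    FormalMultilinearSeries.radius_le_of_le fun n => (p n).norm_compLeftContinuousMap_le
  have hr : r ≤ P.radius := hp.r_le.trans hP
  have hsum := P.hasFPowerSeriesOnBall (hp.r_pos.trans_le hr)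
  refine ⟨P.sum, hsum.analyticAt, ?_⟩
  filter_upwards [Metric.eball_mem_nhds (0 : C(α, E)) hp.r_pos] with Y hY s
  have h1 := (hsum.hasSum (Metric.eball_subset_eball hr hY)).mapL (ContinuousMap.evalCLM 𝕜 s)
  have hYs : Y s ∈ Metric.eball (0 : E) r := by
    rw [mem_eball_zero_iff] at hY ⊢
    refine lt_of_le_of_lt ?_ hY
    simpa [enorm_le_iff_norm_le] using Y.norm_coe_le_norm s
  have h2 := hp.hasSum hYs
  rw [zero_add] at h1 h2
  exact h1.unique h2

/-- The averaging operator `f ↦ (s ↦ ∫ q, f (s * q))` on continuous functions on `[0, 1]`. -/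
noncomputable def radialMean : C(I, ℂ) →L[ℂ] C(I, ℂ) :=
  LinearMap.mkContinuous
    { toFun := fun f => ⟨fun s => ∫ q : I, f (s * q), by
        have := continuous_parametric_integral_of_continuous (μ := MeasureTheory.volume)
          (f := fun s q : I => f (s * q)) (by fun_prop) isCompact_univ
        simpa using this⟩
      map_add' := fun f g => by
        ext s
        exact MeasureTheory.integral_add
          (Continuous.integrable_of_hasCompactSupport (by fun_prop) (.of_compactSpace _))
          (Continuous.integrable_of_hasCompactSupport (by fun_prop) (.of_compactSpace _))
      map_smul' := fun c f => by
        ext s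
        exact MeasureTheory.integral_const_mul c _ }
    1 fun f => by
      refine (ContinuousMap.norm_le _ (by positivity)).2 fun s => ?_
      simpa using MeasureTheory.norm_integral_le_of_norm_le_const (μ := MeasureTheory.volume)
        (f := fun q : I => f (s * q)) (.of_forall fun q => f.norm_coe_le_norm (s * q))

theorem radialMean_apply (f : C(I, ℂ)) (s : I) : radialMean f s = ∫ q : I, f (s * q) :=
  rfl

theorem integral_unitInterval_eq_sub {f f' : ℝ → ℂ}
    (hf : ∀ t ∈ Icc (0 : ℝ) 1, HasDerivAt f (f' t) t) (hf' : ContinuousOn f' (Icc 0 1)) :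
    ∫ q : I, f' q = f 1 - f 0 := by
  rw [MeasureTheory.integral_subtype measurableSet_Icc, MeasureTheory.integral_Icc_eq_integral_Ioc,
    ← intervalIntegral.integral_of_le zero_le_one]
  rw [← uIcc_of_le zero_le_one] at hf hf'
  exact intervalIntegral.integral_eq_sub_of_hasDerivAt hf hf'.intervalIntegrable

/-- Hadamard's lemma with a parameter, for analytic functions. -/
theorem AnalyticAt.exists_sub_eq_mul {f : ℂ × ℂ → ℂ} (hf : AnalyticAt ℂ f 0) :
    ∃ q : ℂ × ℂ × ℂ → ℂ, AnalyticAt ℂ q 0 ∧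
      ∀ᶠ w in 𝓝 (0 : ℂ × ℂ × ℂ), f (w.1, w.2.1) - f (w.1, w.2.2)
        = (w.2.1 - w.2.2) * q w := by
  obtain ⟨N, hN, hNf⟩ := AnalyticAt.exists_superposition I
    (H := fun p => fderiv ℂ f p (0, 1))
    (((ContinuousLinearMap.apply ℂ ℂ ((0 : ℂ), (1 : ℂ))).analyticAt _).comp hf.fderiv)
  let e : C(I, ℂ × ℂ) := ⟨fun s => (0, ((s : ℝ) : ℂ)), by fun_prop⟩
  let c := ContinuousLinearMap.const (R := ℂ) (M := ℂ × ℂ) I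
  let L : ℂ × ℂ × ℂ → C(I, ℂ × ℂ) := fun w => c (w.1, w.2.2) + (w.2.1 - w.2.2) • e
  have hL : ∀ w, AnalyticAt ℂ L w := fun w => by
    refine ((c.analyticAt _).comp (f := fun w : ℂ × ℂ × ℂ => (w.1, w.2.2)) ?_).add
      (AnalyticAt.fun_smul ?_ analyticAt_const) <;> fun_prop
  have hL0 : L 0 = 0 := by ext s <;> simp [L, c]
  have hLs (w : ℂ × ℂ × ℂ) (s : I) : L w s = (w.1, w.2.2 + (s : ℝ) * (w.2.1 - w.2.2)) := by
    ext <;> simp [L, c, e]; ring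
  have hLt : Tendsto L (𝓝 0) (𝓝 0) := by simpa [hL0] using (hL 0).continuousAt.tendsto
  refine ⟨fun w => radialMean (N (L w)) 1, ?_, ?_⟩
  · refine ((ContinuousMap.evalCLM ℂ (1 : I)).comp radialMean).analyticAt _ |>.comp
      (AnalyticAt.comp (g := N) (f := L) ?_ (hL 0))
    rwa [hL0]
  obtain ⟨δ, hδ, hball⟩ := Metric.eventually_nhds_iff_ball.1 hf.eventually_analyticAt
  filter_upwards [hLt.eventually hNf, hLt.eventually (Metric.ball_mem_nhds 0 hδ)] with w hw hwδ
  have hmem (s : I) : L w s ∈ ball (0 : ℂ × ℂ) δ := by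
    rw [dist_zero_right] at hwδ
    rw [mem_ball_zero_iff]
    exact ((L w).norm_coe_le_norm s).trans_lt hwδ
  simp only [radialMean_apply, one_mul, hw, hLs]
  have hd : ∀ t ∈ Icc (0 : ℝ) 1,
      HasDerivAt (fun t : ℝ => f (w.1, w.2.2 + t * (w.2.1 - w.2.2)))
        ((w.2.1 - w.2.2) * fderiv ℂ f (w.1, w.2.2 + t * (w.2.1 - w.2.2)) (0, 1)) t := by
    intro t ht
    have h1 := (hball _ (hmem ⟨t, ht⟩)).differentiableAt.hasFDerivAt
    rw [hLs] at h1
    have h2 : HasDerivAt (fun t : ℝ => (w.1, w.2.2 + (t : ℂ) * (w.2.1 - w.2.2)))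
        (0, w.2.1 - w.2.2) t := by
      refine (hasDerivAt_const _ _).prodMk ?_
      simpa using
        ((Complex.ofRealCLM.hasDerivAt (x := t)).mul_const (w.2.1 - w.2.2)).const_add w.2.2
    have h3 := (h1.restrictScalars ℝ).comp_hasDerivAt t h2
    refine h3.congr_deriv ?_
    have : ((0 : ℂ), w.2.1 - w.2.2) = (w.2.1 - w.2.2) • ((0 : ℂ), (1 : ℂ)) := by simp
    rw [this]
    exact map_smul (fderiv ℂ f _) (w.2.1 - w.2.2) (0, 1)
  have hc : ContinuousOn (fun t : ℝ => (w.2.1 - w.2.2) *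
      fderiv ℂ f (w.1, w.2.2 + t * (w.2.1 - w.2.2)) (0, 1)) (Icc 0 1) := by
    intro t ht
    have h1 := (hball _ (hmem ⟨t, ht⟩)).fderiv.continuousAt
    rw [hLs] at h1
    refine ContinuousAt.continuousWithinAt
      (continuousAt_const.mul (ContinuousAt.clm_apply ?_ continuousAt_const))
    exact ContinuousAt.comp (f := fun t : ℝ => (w.1, w.2.2 + (t : ℂ) * (w.2.1 - w.2.2))) h1
      (by fun_prop)
  have := integral_unitInterval_eq_sub hd hc
  rw [MeasureTheory.integral_const_mul] at this
  simpa using this.symm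

/-- The average over `[0, 1]` of a holomorphic function along the segment from `0` to `z`, times
`z`, is its primitive vanishing at `0`. -/
theorem DifferentiableOn.hasDerivAt_mul_integral_unitInterval {h : ℂ → ℂ} {δ : ℝ}
    (hh : DifferentiableOn ℂ h (ball 0 δ)) {z : ℂ} (hz : z ∈ ball 0 δ) :
    HasDerivAt (fun z => z * ∫ q : I, h ((q : ℝ) * z)) (h z) z := by
  obtain ⟨g, hg0, hg⟩ := hh.isExactOn_ball.with_val_at 0 0
  have key : ∀ y ∈ ball (0 : ℂ) δ, y * ∫ q : I, h ((q : ℝ) * y) = g y := by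
    intro y hy
    have hmem : ∀ t ∈ Icc (0 : ℝ) 1, (t : ℂ) * y ∈ ball (0 : ℂ) δ := by
      intro t ht
      rw [mem_ball_zero_iff] at hy ⊢
      rw [norm_mul, Complex.norm_of_nonneg ht.1]
      exact (mul_le_of_le_one_left (norm_nonneg _) ht.2).trans_lt hy
    have hlin (t : ℝ) : HasDerivAt (fun t : ℝ => (t : ℂ) * y) y t := by
      simpa using (Complex.ofRealCLM.hasDerivAt (x := t)).mul_const y
    have hd : ∀ t ∈ Icc (0 : ℝ) 1,
        HasDerivAt (fun t : ℝ => g (t * y)) (y * h (t * y)) t := fun t ht =>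
      (hg _ (hmem t ht)).scomp t (hlin t)
    have hc : ContinuousOn (fun t : ℝ => y * h (t * y)) (Icc 0 1) :=
      continuousOn_const.mul (hh.continuousOn.comp (by fun_prop) hmem)
    have := integral_unitInterval_eq_sub hd hc
    rw [MeasureTheory.integral_const_mul] at this
    simpa [hg0] using this
  refine (hg z hz).congr_of_eventuallyEq ?_
  filter_upwards [isOpen_ball.mem_nhds hz] with y hy using key y hy

/-- Analytic dependence on the parameter `ε` of the solution of the Cauchy problem
`∂u/∂z = H (z, ε, u)`, `u (0, ε) = 0`. -/
theorem AnalyticAt.exists_hasDerivAt_eq {H : ℂ × ℂ × ℂ → ℂ} (hH : AnalyticAt ℂ H 0) :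
    ∃ u : ℂ × ℂ → ℂ, AnalyticAt ℂ u 0 ∧ u 0 = 0 ∧
      ∀ᶠ x in 𝓝 (0 : ℂ × ℂ), HasDerivAt (fun z => u (z, x.2)) (H (x.1, x.2, u x)) x.1 := by
  obtain ⟨N, hN, hNH⟩ := hH.exists_superposition I
  let ι : C(I, ℂ) := ⟨fun s => ((s : ℝ) : ℂ), by fun_prop⟩
  let e : C(I, ℂ × ℂ × ℂ) := ⟨fun s => (((s : ℝ) : ℂ), 0, 0), by fun_prop⟩
  let c : C(I, ℂ × ℂ × ℂ) := ContinuousMap.const I (0, 1, 0)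
  let J : C(I, ℂ) →L[ℂ] C(I, ℂ × ℂ × ℂ) := ContinuousLinearMap.compLeftContinuous ℂ I
    ((ContinuousLinearMap.inr ℂ ℂ (ℂ × ℂ)).comp (ContinuousLinearMap.inr ℂ ℂ ℂ))
  let L : (ℂ × ℂ) × C(I, ℂ) → C(I, ℂ × ℂ × ℂ) := fun w => w.1.1 • e + w.1.2 • c + J w.2
  have hLs (w) (s : I) : L w s = ((s : ℝ) * w.1.1, w.1.2, w.2 s) := by
    ext <;> simp [L, c, e, J, mul_comm]
  have hL (w) : AnalyticAt ℂ L w := by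
    refine (AnalyticAt.add (AnalyticAt.fun_smul ?_ analyticAt_const)
      (AnalyticAt.fun_smul ?_ analyticAt_const)).add ((J.analyticAt _).comp ?_) <;> fun_prop
  have hL0 : L 0 = 0 := by ext s <;> simp [hLs]
  have hLt : Tendsto L (𝓝 0) (𝓝 0) := by simpa [hL0] using (hL 0).continuousAt.tendsto
  have hNL : AnalyticAt ℂ (fun w => ι * radialMean (N (L w))) 0 := by
    refine analyticAt_const.mul ((radialMean.analyticAt _).comp (AnalyticAt.comp ?_ (hL 0)))
    rwa [hL0]
  let G : (ℂ × ℂ) × C(I, ℂ) → C(I, ℂ) := fun w => w.2 - w.1.1 • (ι * radialMean (N (L w)))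
  have hG : AnalyticAt ℂ G 0 :=
    analyticAt_snd.sub ((by fun_prop : AnalyticAt ℂ (fun w => w.1.1) _).fun_smul hNL)
  have hGs (w) (s : I) : G w s = w.2 s - w.1.1 * (s * ∫ q : I, N (L w) (s * q)) := by
    simp [G, ι, radialMean_apply]
  have hG0 : G 0 = 0 := by ext s; simp [hGs]
  have cdf : ContDiffAt ℂ ω G 0 := hG.contDiffAt
  have hinv : (fderiv ℂ G 0 ∘L .inr ℂ (ℂ × ℂ) C(I, ℂ)).IsInvertible := by
    have h1 : HasFDerivAt (fun X : C(I, ℂ) => G (0, X))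
        (fderiv ℂ G 0 ∘L .inr ℂ (ℂ × ℂ) C(I, ℂ)) 0 :=
      HasFDerivAt.comp (g := G) (f := fun X : C(I, ℂ) => ((0 : ℂ × ℂ), X)) 0
        hG.differentiableAt.hasFDerivAt (hasFDerivAt_prodMk_right _ _)
    have h2 : (fun X : C(I, ℂ) => G (0, X)) = id := by
      ext; simp [G]
    rw [h2] at h1
    rw [h1.unique (hasFDerivAt_id _)]
    exact ⟨ContinuousLinearEquiv.refl ℂ _, rfl⟩
  have hω : (ω : WithTop ℕ∞) ≠ 0 := by simp
  let Φ : ℂ × ℂ → C(I, ℂ) := cdf.implicitFunction hω hinv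
  have hΦ : AnalyticAt ℂ Φ 0 := (cdf.contDiffAt_implicitFunction hω hinv).analyticAt
  have hΦ0 : Φ 0 = 0 := cdf.implicitFunction_apply_self hω hinv
  have hΦt : Tendsto Φ (𝓝 0) (𝓝 0) := by simpa [hΦ0] using hΦ.continuousAt.tendsto
  let u : ℂ × ℂ → ℂ := fun x => Φ x 1
  have hu : AnalyticAt ℂ u 0 :=
    ((ContinuousMap.evalCLM (M := ℂ) ℂ (1 : I)).analyticAt _).comp hΦ
  have hu0 : u 0 = 0 := by simp [u, hΦ0]
  obtain ⟨δ₁, hδ₁, h₁⟩ := Metric.eventually_nhds_iff_ball.1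
    ((cdf.eventually_apply_eq_iff_implicitFunction hω hinv).and (hLt.eventually hNH))
  have htriple : Tendsto (fun x : ℂ × ℂ => (x.1, x.2, u x)) (𝓝 0) (𝓝 0) := by
    have : ContinuousAt (fun x : ℂ × ℂ => (x.1, x.2, u x)) 0 := by
      have := hu.continuousAt
      fun_prop
    have h0 : ((0 : ℂ × ℂ).1, (0 : ℂ × ℂ).2, u 0) = 0 := by rw [hu0]; rfl
    rwa [ContinuousAt, h0] at this
  obtain ⟨δ, hδ, h⟩ := Metric.eventually_nhds_iff_ball.1
    ((((cdf.eventually_apply_implicitFunction hω hinv).and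
      (hΦt.eventually (Metric.ball_mem_nhds 0 hδ₁))).and
      (Metric.ball_mem_nhds (0 : ℂ × ℂ) hδ₁)).and
      ((htriple.eventually hH.eventually_analyticAt).and hu.eventually_analyticAt))
  refine ⟨u, hu, hu0, ?_⟩
  have hmem {z ε : ℂ} {r : ℝ} : (z, ε) ∈ ball (0 : ℂ × ℂ) r ↔ z ∈ ball 0 r ∧ ε ∈ ball 0 r := by
    rw [← Prod.mk_zero_zero, ← ball_prod_same, Set.mem_prod]
  have hscale {z : ℂ} {r : ℝ} (t : I) (hz : z ∈ ball 0 r) : ((t : ℝ) : ℂ) * z ∈ ball 0 r := by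
    rw [mem_ball_zero_iff] at hz ⊢
    rw [norm_mul, Complex.norm_of_nonneg t.2.1]
    exact (mul_le_of_le_one_left (norm_nonneg _) t.2.2).trans_lt hz
  -- the path through `(z, ε)` is made of the values of `u` on the segment from `0` to `z`
  have hray {z ε : ℂ} (hx : (z, ε) ∈ ball (0 : ℂ × ℂ) δ) :
      (∀ s : I, Φ (z, ε) s = z * (s * ∫ q : I, H ((s * q : ℝ) * z, ε, Φ (z, ε) (s * q)))) ∧
      ∀ t : I, u ((t : ℝ) * z, ε) = Φ (z, ε) t := by
    obtain ⟨⟨⟨hx1, hx2⟩, hx3⟩, -⟩ := h _ hx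
    change G ((z, ε), Φ (z, ε)) = G 0 at hx1
    have hball {y : ℂ × ℂ} {Y : C(I, ℂ)} (hy : y ∈ ball 0 δ₁) (hY : Y ∈ ball 0 δ₁) :
        (y, Y) ∈ ball (0 : (ℂ × ℂ) × C(I, ℂ)) δ₁ := by
      rw [← Prod.mk_zero_zero, ← ball_prod_same]
      exact ⟨hy, hY⟩
    have hint (s : I) :
        Φ (z, ε) s = z * (s * ∫ q : I, H ((s * q : ℝ) * z, ε, Φ (z, ε) (s * q))) := by
      have h2 := congrArg (fun f => f s) (hx1.trans hG0)
      simp only [hGs, (h₁ _ (hball hx3 hx2)).2, hLs, ContinuousMap.zero_apply] at h2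
      simpa using sub_eq_zero.1 h2
    refine ⟨hint, fun t => ?_⟩
    let Y : C(I, ℂ) := ⟨fun s => Φ (z, ε) (t * s), by fun_prop⟩
    have hY : Y ∈ ball 0 δ₁ := by
      rw [dist_zero_right] at hx2
      rw [mem_ball_zero_iff]
      refine lt_of_le_of_lt ?_ hx2
      exact (ContinuousMap.norm_le _ (norm_nonneg _)).2 fun s => (Φ (z, ε)).norm_coe_le_norm _
    have hy : ((t : ℝ) * z, ε) ∈ ball (0 : ℂ × ℂ) δ₁ :=
      hmem.2 ⟨hscale t (hmem.1 hx3).1, (hmem.1 hx3).2⟩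
    obtain ⟨h3, h4⟩ := h₁ _ (hball hy hY)
    have h5 : Φ ((t : ℝ) * z, ε) = Y := by
      refine h3.1 ?_
      rw [hG0]
      ext s
      simp only [hGs, h4, hLs, ContinuousMap.zero_apply, Y, ContinuousMap.coe_mk]
      rw [sub_eq_zero, hint (t * s)]
      simp only [Icc.coe_mul, Complex.ofReal_mul, mul_assoc, mul_left_comm, mul_comm]
    simp [u, h5, Y]
  filter_upwards [Metric.ball_mem_nhds (0 : ℂ × ℂ) hδ]
  rintro ⟨z, ε⟩ hx
  have hε := (hmem.1 hx).2
  have hdiff : DifferentiableOn ℂ (fun z => H (z, ε, u (z, ε))) (ball 0 δ) := by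
    intro y hy
    obtain ⟨-, hHy, huy⟩ := h _ (hmem.2 ⟨hy, hε⟩)
    refine DifferentiableAt.differentiableWithinAt ?_
    have h1 : DifferentiableAt ℂ (fun z => u (z, ε)) y :=
      DifferentiableAt.comp (g := u) (f := fun z => (z, ε)) y huy.differentiableAt (by fun_prop)
    exact DifferentiableAt.comp (g := H) (f := fun z => (z, ε, u (z, ε))) y
      hHy.differentiableAt (by fun_prop)
  refine (hdiff.hasDerivAt_mul_integral_unitInterval (hmem.1 hx).1).congr_of_eventuallyEq ?_
  filter_upwards [isOpen_ball.mem_nhds (hmem.1 hx).1] with y hy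
  obtain ⟨h1, h2⟩ := hray (hmem.2 ⟨hy, hε⟩)
  simpa [h2, u] using h1 1

end

theorem exists_add_pow_succ_eq (n : ℕ) :
    ∃ R : ℂ × ℂ → ℂ, (∀ p, AnalyticAt ℂ R p) ∧ ∀ z w,
      (z + w) ^ (n + 1) = z ^ (n + 1) + (n + 1) * z ^ n * w + w ^ 2 * R (z, w) := by
  induction n with
  | zero => exact ⟨0, fun p => analyticAt_const, fun z w => by simp⟩
  | succ n ih =>
    obtain ⟨R, hR, h⟩ := ih
    refine ⟨fun p => (n + 1) * p.1 ^ n + (p.1 + p.2) * R p, fun p => ?_, fun z w => ?_⟩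
    · have := hR p
      fun_prop
    · rw [pow_succ, h]
      push_cast
      ring

/-- Every factored family `ω(z,ε) = (z^{k+1}−ε)·v(z,ε)` of codimension `k`
is conjugate, by a parameter-preserving analytic conjugacy, to the family
`Ω(z,ε) = (z^{k+1}−ε)·σ(z)` where `σ(δ) = v(δ,δ^{k+1})` does not depend on `ε`. -/
theorem statement8 (k : ℕ) (hk : 1 ≤ k) (v : ℂ → ℂ → ℂ)
    (hv : AnalyticAt ℂ (fun p : ℂ × ℂ => v p.1 p.2) (0, 0)) (hv0 : v 0 0 ≠ 0) :
    ∃ (r ρ : ℝ) (ψ : ℂ → ℂ → ℂ), 0 < r ∧ 0 < ρ ∧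
      AnalyticOnNhd ℂ (fun p : ℂ × ℂ => ψ p.1 p.2) (ball 0 r ×ˢ ball 0 ρ) ∧
      ψ 0 0 = 0 ∧
      (∀ ε ∈ ball (0 : ℂ) ρ, Set.InjOn (fun z => ψ z ε) (ball 0 r)) ∧
      ∀ z ∈ ball (0 : ℂ) r, ∀ ε ∈ ball (0 : ℂ) ρ,
        deriv (fun z => ψ z ε) z * ((z ^ (k + 1) - ε) * v z ε)
          = (ψ z ε ^ (k + 1) - ε) * v (ψ z ε) (ψ z ε ^ (k + 1)) := by
  change AnalyticAt ℂ (fun p : ℂ × ℂ => v p.1 p.2) 0 at hv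
  set σ : ℂ → ℂ := fun z => v z (z ^ (k + 1))
  have hσa : AnalyticAt ℂ σ 0 :=
    hv.comp_of_eq (f := fun z : ℂ => (z, z ^ (k + 1))) (by fun_prop) (by simp)
  obtain ⟨q, hq, hqe⟩ := hv.exists_sub_eq_mul
  obtain ⟨S, hS, hSe⟩ := AnalyticAt.exists_sub_eq_mul (f := fun p => σ p.2)
    (hσa.comp_of_eq (f := fun p : ℂ × ℂ => p.2) (by fun_prop) rfl)
  obtain ⟨R, hR, hRe⟩ := exists_add_pow_succ_eq k
  -- the equation for `u` obtained by inserting `ψ = z + (z ^ (k + 1) - ε) * u`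
  let H : ℂ × ℂ × ℂ → ℂ := fun y =>
    (y.2.2 ^ 2 * R (y.1, (y.1 ^ (k + 1) - y.2.1) * y.2.2) * σ y.1
      + y.2.2 * S (0, y.1 + (y.1 ^ (k + 1) - y.2.1) * y.2.2, y.1)
        * (1 + (k + 1) * y.1 ^ k * y.2.2 + (y.1 ^ (k + 1) - y.2.1) * y.2.2 ^ 2
          * R (y.1, (y.1 ^ (k + 1) - y.2.1) * y.2.2))
      + q (y.1, y.2.1, y.1 ^ (k + 1)) * (1 + (k + 1) * y.1 ^ k * y.2.2)) / v y.1 y.2.1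
  have hH : AnalyticAt ℂ H 0 := by
    have h1 : AnalyticAt ℂ
        (fun y : ℂ × ℂ × ℂ => R (y.1, (y.1 ^ (k + 1) - y.2.1) * y.2.2)) 0 :=
      (hR _).comp (f := fun y : ℂ × ℂ × ℂ => (y.1, (y.1 ^ (k + 1) - y.2.1) * y.2.2))
        (by fun_prop)
    have h2 : AnalyticAt ℂ
        (fun y : ℂ × ℂ × ℂ => S (0, y.1 + (y.1 ^ (k + 1) - y.2.1) * y.2.2, y.1)) 0 :=
      hS.comp_of_eq
        (f := fun y : ℂ × ℂ × ℂ => ((0 : ℂ), y.1 + (y.1 ^ (k + 1) - y.2.1) * y.2.2, y.1))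
        (by fun_prop) (by simp)
    have h3 : AnalyticAt ℂ (fun y : ℂ × ℂ × ℂ => q (y.1, y.2.1, y.1 ^ (k + 1))) 0 :=
      hq.comp_of_eq (f := fun y : ℂ × ℂ × ℂ => (y.1, y.2.1, y.1 ^ (k + 1)))
        (by fun_prop) (by simp)
    have h4 : AnalyticAt ℂ (fun y : ℂ × ℂ × ℂ => v y.1 y.2.1) 0 :=
      hv.comp_of_eq (f := fun y : ℂ × ℂ × ℂ => (y.1, y.2.1)) (by fun_prop) (by simp)
    have h5 : AnalyticAt ℂ (fun y : ℂ × ℂ × ℂ => σ y.1) 0 :=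
      hσa.comp_of_eq (f := fun y : ℂ × ℂ × ℂ => y.1) (by fun_prop) rfl
    have h6 : AnalyticAt ℂ (fun y : ℂ × ℂ × ℂ => y.2.2) 0 := by fun_prop
    have h7 : AnalyticAt ℂ (fun y : ℂ × ℂ × ℂ => 1 + (k + 1) * y.1 ^ k * y.2.2) 0 := by fun_prop
    have h8 : AnalyticAt ℂ (fun y : ℂ × ℂ × ℂ => (y.1 ^ (k + 1) - y.2.1) * y.2.2 ^ 2) 0 := by
      fun_prop
    exact (((((h6.pow 2).mul h1).mul h5).add ((h6.mul h2).mul (h7.add (h8.mul h1)))).add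
      (h3.mul h7)).div h4 hv0
  obtain ⟨u, hu, hu0, hud⟩ := hH.exists_hasDerivAt_eq
  let ψ : ℂ × ℂ → ℂ := fun x => x.1 + (x.1 ^ (k + 1) - x.2) * u x
  have hψ : AnalyticAt ℂ ψ 0 := by fun_prop
  have hψ0 : ψ 0 = 0 := by simp [ψ]
  have hψ' : HasStrictFDerivAt ψ (ContinuousLinearMap.fst ℂ ℂ ℂ) 0 := by
    have h1 : AnalyticAt ℂ (fun x : ℂ × ℂ => x.1 ^ (k + 1) - x.2) 0 := by fun_prop
    have h2 := (hasStrictFDerivAt_fst (𝕜 := ℂ) (p := (0 : ℂ × ℂ))).add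
      (h1.hasStrictFDerivAt.mul hu.hasStrictFDerivAt)
    exact h2.congr_fderiv (by ext <;> simp [hu0])
  obtain ⟨s, hs, hsψ⟩ := hψ'.approximates_deriv_on_nhds (c := 1 / 2) (.inr (by norm_num))
  have hq_tendsto : Tendsto (fun x : ℂ × ℂ => (x.1, x.2, x.1 ^ (k + 1))) (𝓝 0) (𝓝 0) := by
    have : Continuous fun x : ℂ × ℂ => (x.1, x.2, x.1 ^ (k + 1)) := by fun_prop
    exact this.tendsto' _ _ (by simp)
  have hS_tendsto : Tendsto (fun x : ℂ × ℂ => ((0 : ℂ), ψ x, x.1)) (𝓝 0) (𝓝 0) := by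
    have h1 : ContinuousAt (fun x : ℂ × ℂ => ((0 : ℂ), ψ x, x.1)) 0 := by
      have := hψ.continuousAt
      fun_prop
    have h2 : ((0 : ℂ), ψ 0, (0 : ℂ × ℂ).1) = 0 := by rw [hψ0]; rfl
    rwa [ContinuousAt, h2] at h1
  obtain ⟨r, hr, h⟩ := Metric.eventually_nhds_iff_ball.1
    (((hψ.eventually_analyticAt.and hs).and (hud.and (hv.continuousAt.eventually_ne hv0))).and
      ((hq_tendsto.eventually hqe).and (hS_tendsto.eventually hSe)))
  have hmem {z ε : ℂ} (hz : z ∈ ball 0 r) (hε : ε ∈ ball 0 r) : (z, ε) ∈ ball (0 : ℂ × ℂ) r := by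
    rw [← Prod.mk_zero_zero, ← ball_prod_same]
    exact ⟨hz, hε⟩
  refine ⟨r, r, fun z ε => ψ (z, ε), hr, hr, fun x hx => (h x (hmem hx.1 hx.2)).1.1.1, hψ0,
    fun ε hε z hz w hw hzw => ?_, fun z hz ε hε => ?_⟩
  · have h1 := hsψ _ (h _ (hmem hz hε)).1.1.2 _ (h _ (hmem hw hε)).1.1.2
    have h2 : ‖z - w‖ ≤ 1 / 2 * ‖z - w‖ := by
      simpa [show ψ (z, ε) = ψ (w, ε) from hzw, Prod.norm_def, norm_sub_rev] using h1
    exact sub_eq_zero.1 (norm_le_zero_iff.1 (by linarith))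
  · obtain ⟨⟨-, hd, hvne⟩, hqx, hSx⟩ := h _ (hmem hz hε)
    have hdψ : HasDerivAt (fun z => ψ (z, ε)) (1 + ((k + 1) * z ^ k * u (z, ε)
        + (z ^ (k + 1) - ε) * H (z, ε, u (z, ε)))) z := by
      have h1 : HasDerivAt (fun z : ℂ => z ^ (k + 1) - ε) ((k + 1) * z ^ k) z := by
        simpa using (hasDerivAt_pow (k + 1) z).sub_const ε
      exact (hasDerivAt_id z).add (h1.mul hd)
    have hHv : H (z, ε, u (z, ε)) * v z ε = _ := div_mul_cancel₀ _ hvne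
    have hpow := hRe z ((z ^ (k + 1) - ε) * u (z, ε))
    rw [hdψ.deriv]
    change _ = (ψ (z, ε) ^ (k + 1) - ε) * σ (ψ (z, ε))
    have hψe : ψ (z, ε) = z + (z ^ (k + 1) - ε) * u (z, ε) := rfl
    simp only [hψe] at hSx hqx hHv ⊢
    rw [hpow]
    change v z ε - σ z = _ at hqx
    set P := z ^ (k + 1) - ε
    set U := u (z, ε)
    set W := R (z, P * U)
    set T := S (0, z + P * U, z)
    linear_combination P ^ 2 * hHv + P * (1 + (k + 1) * z ^ k * U) * hqx
      - P * (1 + (k + 1) * z ^ k * U + P * U ^ 2 * W) * hSx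
end

section
/- Let k ≥ 1 and let λ : (ℂ,0) → (ℂ,0) be analytic near 0 of the form λ(δ) = (k+1)·δ^k·σ(δ) with σ analytic near 0 and σ(0) = 1. Then there exists an analytic function g near 0 with g(0) = 1, unique as a germ at 0, such that the map h(η) = η·g(η^{k+1}) (an analytic local diffeomorphism tangent to the identity) has the following property: in the Taylor expansion at 0 of the composite λ∘h, the coefficient of η^{k+m(k+1)} vanishes for every integer m ≥ 1. Uniqueness means: if g₁ and g₂ are two analytic functions near 0 with g₁(0) = g₂(0) = 1 such that both h_i(η) = η·g_i(η^{k+1}) have this property, then g₁ = g₂ on a neighborhood of 0. -/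
open Metric Set Filter Complex

/-- For `λ(η) = (k+1)·η^k·σ(η)` and `h(η) = η·g(η^{k+1})`, this says that in the Taylor
expansion at `0` of `λ∘h` the coefficient of `η^{k+m(k+1)}` vanishes for all `m ≥ 1`. -/
def KillsResonantTerms (k : ℕ) (σ g : ℂ → ℂ) : Prop :=
  ∀ m : ℕ, 1 ≤ m →
    iteratedDeriv (k + m * (k + 1))
      (fun η : ℂ => ((k : ℂ) + 1) * (η * g (η ^ (k + 1))) ^ k * σ (η * g (η ^ (k + 1)))) 0 = 0

open scoped Topology

theorem hasSum_taylor_of_analyticAt {f : ℂ → ℂ} (hf : AnalyticAt ℂ f 0) :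
    ∀ᶠ z in 𝓝 (0 : ℂ), HasSum (fun n => z ^ n * (iteratedDeriv n f 0 / n.factorial)) (f z) := by
  have h := hasFPowerSeriesAt_iff.1 hf.hasFPowerSeriesAt
  simpa [FormalMultilinearSeries.coeff_ofScalars] using h

theorem hasFPowerSeriesAt_ofScalars_of_hasSum {f : ℂ → ℂ} {a : ℕ → ℂ}
    (h : ∀ᶠ z in 𝓝 (0 : ℂ), HasSum (fun n => z ^ n * a n) (f z)) :
    HasFPowerSeriesAt f (FormalMultilinearSeries.ofScalars ℂ a) 0 := by
  rw [hasFPowerSeriesAt_iff]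
  simpa [FormalMultilinearSeries.coeff_ofScalars] using h

theorem iteratedDeriv_eq_of_hasSum {f : ℂ → ℂ} {a : ℕ → ℂ}
    (h : ∀ᶠ z in 𝓝 (0 : ℂ), HasSum (fun n => z ^ n * a n) (f z)) (n : ℕ) :
    iteratedDeriv n f 0 = n.factorial * a n := by
  have hp := hasFPowerSeriesAt_ofScalars_of_hasSum h
  have he := congrArg (fun p => FormalMultilinearSeries.coeff p n)
    (hp.analyticAt.hasFPowerSeriesAt.eq_formalMultilinearSeries hp)
  simp only [FormalMultilinearSeries.coeff_ofScalars] at he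
  rw [← he, mul_div_cancel₀ _ (Nat.cast_ne_zero.2 n.factorial_ne_zero)]

theorem tendsto_const_mul_nhds_zero (c : ℂ) :
    Tendsto (fun z : ℂ => c * z) (𝓝 0) (𝓝 0) := by
  have h : Continuous fun z : ℂ => c * z := by fun_prop
  simpa using h.tendsto 0

theorem tendsto_pow_nhds_zero {N : ℕ} (hN : N ≠ 0) :
    Tendsto (fun z : ℂ => z ^ N) (𝓝 0) (𝓝 0) := by
  have h : Continuous fun z : ℂ => z ^ N := by fun_prop
  simpa [hN] using h.tendsto 0

/-- The principal `N`-th root is continuous at `0`. -/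
theorem tendsto_cpow_nat_inv_nhds_zero {N : ℕ} (hN : N ≠ 0) :
    Tendsto (fun z : ℂ => z ^ ((N : ℂ)⁻¹)) (𝓝 0) (𝓝 0) := by
  have h : ContinuousAt (fun z : ℂ => z ^ ((N : ℂ)⁻¹)) 0 := by
    refine Complex.continuousAt_cpow_const_of_re_pos (Or.inl le_rfl) ?_
    rw [← Complex.ofReal_natCast, ← Complex.ofReal_inv, Complex.ofReal_re]
    positivity
  have h' := h.tendsto
  rwa [Complex.zero_cpow (by simpa using hN)] at h'

theorem iteratedDeriv_comp_const_mul_zero {f : ℂ → ℂ} (hf : AnalyticAt ℂ f 0) (c : ℂ) (n : ℕ) :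
    iteratedDeriv n (fun z => f (c * z)) 0 = c ^ n * iteratedDeriv n f 0 := by
  have h : ∀ᶠ z in 𝓝 (0 : ℂ),
      HasSum (fun n => z ^ n * (c ^ n * (iteratedDeriv n f 0 / n.factorial))) (f (c * z)) := by
    filter_upwards [(tendsto_const_mul_nhds_zero c).eventually (hasSum_taylor_of_analyticAt hf)]
      with z hz
    convert hz using 2 with n
    ring
  rw [iteratedDeriv_eq_of_hasSum h, mul_left_comm,
    mul_div_cancel₀ _ (Nat.cast_ne_zero.2 n.factorial_ne_zero)]

theorem AnalyticAt.eventually_eq_monomial {f : ℂ → ℂ} (hf : AnalyticAt ℂ f 0) (k : ℕ)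
    (h : ∀ n, n ≠ k → iteratedDeriv n f 0 = 0) :
    ∃ c : ℂ, ∀ᶠ z in 𝓝 (0 : ℂ), f z = c * z ^ k := by
  refine ⟨iteratedDeriv k f 0 / k.factorial, ?_⟩
  filter_upwards [hasSum_taylor_of_analyticAt hf] with z hz
  rw [mul_comm]
  refine hz.unique (hasSum_single k fun n hn => ?_)
  simp [h n hn]

/-- An analytic germ invariant under the rotation by a primitive `N`-th root of unity is an
analytic function of `z ^ N`. -/
theorem AnalyticAt.exists_eq_comp_pow {f : ℂ → ℂ} (hf : AnalyticAt ℂ f 0) {N : ℕ} (hN : N ≠ 0)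
    {ω : ℂ} (hω : IsPrimitiveRoot ω N) (hinv : ∀ᶠ z in 𝓝 (0 : ℂ), f (ω * z) = f z) :
    ∃ g : ℂ → ℂ, AnalyticAt ℂ g 0 ∧ ∀ᶠ z in 𝓝 (0 : ℂ), f z = g (z ^ N) := by
  have hcoeff : ∀ n, ¬ N ∣ n → iteratedDeriv n f 0 = 0 := by
    intro n hn
    have h1 := iteratedDeriv_comp_const_mul_zero hf ω n
    rw [Filter.EventuallyEq.iteratedDeriv_eq n hinv] at h1
    have h2 : ω ^ n ≠ 1 := fun h => hn (hω.dvd_of_pow_eq_one n h)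
    have h3 : (ω ^ n - 1) * iteratedDeriv n f 0 = 0 := by linear_combination -h1
    exact (mul_eq_zero.1 h3).resolve_left (sub_ne_zero.2 h2)
  set b : ℕ → ℂ := fun m => iteratedDeriv (N * m) f 0 / (N * m).factorial with hb
  have hsum : ∀ᶠ z in 𝓝 (0 : ℂ), HasSum (fun m => (z ^ N) ^ m * b m) (f z) := by
    filter_upwards [hasSum_taylor_of_analyticAt hf] with z hz
    rw [← Function.Injective.hasSum_iff (mul_right_injective₀ hN)] at hz
    · simpa only [Function.comp_def, pow_mul] using hz
    · intro n hn
      rw [hcoeff n fun ⟨m, hm⟩ => hn ⟨m, hm.symm⟩]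
      simp
  have hg : ∀ᶠ t in 𝓝 (0 : ℂ), HasSum (fun m => t ^ m * b m) (f (t ^ ((N : ℂ)⁻¹))) := by
    filter_upwards [(tendsto_cpow_nat_inv_nhds_zero hN).eventually hsum] with t ht
    rwa [Complex.cpow_nat_inv_pow t hN] at ht
  refine ⟨fun t => f (t ^ ((N : ℂ)⁻¹)), (hasFPowerSeriesAt_ofScalars_of_hasSum hg).analyticAt, ?_⟩
  filter_upwards [hsum, (tendsto_pow_nhds_zero hN).eventually hg] with z h1 h2
  exact h1.unique h2

/-- The sum over the rotations by powers of `ω` that isolates the Taylor coefficients of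
index `n` with `n + 1` divisible by the order of `ω`. -/
noncomputable def twistedRotationSum (N : ℕ) (ω : ℂ) (f : ℂ → ℂ) (z : ℂ) : ℂ :=
  ∑ i ∈ Finset.range N, ω ^ i * f (ω ^ i * z)

theorem AnalyticAt.comp_const_mul_zero {f : ℂ → ℂ} (hf : AnalyticAt ℂ f 0) (c : ℂ) :
    AnalyticAt ℂ (fun z => f (c * z)) 0 := by
  have h : AnalyticAt ℂ f (c * 0) := by simpa using hf
  exact h.fun_comp (f := fun z => c * z) (by fun_prop)

theorem AnalyticAt.twistedRotationSum {f : ℂ → ℂ} (hf : AnalyticAt ℂ f 0) (N : ℕ) (ω : ℂ) :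
    AnalyticAt ℂ (twistedRotationSum N ω f) 0 := by
  unfold _root_.twistedRotationSum
  exact Finset.analyticAt_fun_sum _ fun i _ => analyticAt_const.mul (hf.comp_const_mul_zero _)

theorem iteratedDeriv_twistedRotationSum {f : ℂ → ℂ} (hf : AnalyticAt ℂ f 0) (N : ℕ) (ω : ℂ)
    (n : ℕ) : iteratedDeriv n (twistedRotationSum N ω f) 0 =
      (∑ i ∈ Finset.range N, (ω ^ (n + 1)) ^ i) * iteratedDeriv n f 0 := by
  unfold twistedRotationSum
  rw [iteratedDeriv_fun_sum, Finset.sum_mul]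
  · refine Finset.sum_congr rfl fun i _ => ?_
    rw [iteratedDeriv_const_mul _ (hf.comp_const_mul_zero _).contDiffAt,
      iteratedDeriv_comp_const_mul_zero hf]
    ring
  · exact fun i _ => (analyticAt_const.mul (hf.comp_const_mul_zero _)).contDiffAt

theorem forall_iteratedDeriv_eq_zero_iff {f : ℂ → ℂ} (hf : AnalyticAt ℂ f 0) {k : ℕ} {ω : ℂ}
    (hω : IsPrimitiveRoot ω (k + 1)) :
    (∀ m : ℕ, 1 ≤ m → iteratedDeriv (k + m * (k + 1)) f 0 = 0) ↔
      ∃ c : ℂ, ∀ᶠ z in 𝓝 (0 : ℂ), twistedRotationSum (k + 1) ω f z = c * z ^ k := by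
  constructor
  · intro h
    refine (hf.twistedRotationSum (k + 1) ω).eventually_eq_monomial k fun n hn => ?_
    rw [iteratedDeriv_twistedRotationSum hf]
    by_cases hd : (k + 1) ∣ n + 1
    · obtain ⟨m, hm⟩ := hd
      obtain _ | _ | m := m
      · omega
      · omega
      · have hn' : n = k + (m + 1) * (k + 1) := by
          apply Nat.succ_injective
          simp only [Nat.succ_eq_add_one, hm]
          ring
        rw [hn', h (m + 1) (by omega), mul_zero]
    · have h1 : ω ^ (n + 1) ≠ 1 := fun h => hd (hω.dvd_of_pow_eq_one _ h)
      rw [geom_sum_eq h1, ← pow_mul, mul_comm (n + 1), pow_mul, hω.pow_eq_one]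
      simp
  · rintro ⟨c, hc⟩ m hm
    have h1 := Filter.EventuallyEq.iteratedDeriv_eq (k + m * (k + 1)) hc
    rw [iteratedDeriv_twistedRotationSum hf, iteratedDeriv_const_mul _ (by fun_prop)] at h1
    have h2 : ω ^ (k + m * (k + 1) + 1) = 1 := by
      rw [show k + m * (k + 1) + 1 = (k + 1) * (m + 1) by ring, pow_mul, hω.pow_eq_one, one_pow]
    have h3 : m * (k + 1) ≠ 0 := by positivity
    rw [h2, iteratedDeriv_fun_pow_zero, if_neg (by omega)] at h1
    simp only [one_pow, Finset.sum_const, Finset.card_range, nsmul_eq_mul, mul_one,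
      Nat.cast_zero, mul_zero] at h1
    exact (mul_eq_zero.1 h1).resolve_left (Nat.cast_ne_zero.2 k.succ_ne_zero)

/-- The average of `σ` over the rotations by the powers of `ω`. -/
noncomputable def rotationAverage (N : ℕ) (ω : ℂ) (σ : ℂ → ℂ) (x : ℂ) : ℂ :=
  (∑ i ∈ Finset.range N, σ (ω ^ i * x)) / N

theorem AnalyticAt.rotationAverage {σ : ℂ → ℂ} (hσ : AnalyticAt ℂ σ 0) (N : ℕ) (ω : ℂ) :
    AnalyticAt ℂ (rotationAverage N ω σ) 0 := by
  unfold _root_.rotationAverage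
  exact (Finset.analyticAt_fun_sum _ fun i _ => hσ.comp_const_mul_zero _).div_const

theorem rotationAverage_zero {N : ℕ} (hN : N ≠ 0) (ω : ℂ) (σ : ℂ → ℂ) :
    rotationAverage N ω σ 0 = σ 0 := by
  simp [rotationAverage, hN]

theorem rotationAverage_rotate {N : ℕ} {ω : ℂ} (hω : ω ^ N = 1) (σ : ℂ → ℂ) (x : ℂ) :
    rotationAverage N ω σ (ω * x) = rotationAverage N ω σ x := by
  unfold rotationAverage
  congr 1
  have h := (Finset.sum_range_succ (fun i => σ (ω ^ i * x)) N).symm.trans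
    (Finset.sum_range_succ' (fun i => σ (ω ^ i * x)) N)
  rw [hω, pow_zero] at h
  rw [add_right_cancel h]
  exact Finset.sum_congr rfl fun i _ => by rw [pow_succ, mul_assoc]

/-- The map `x ↦ x * A(x) ^ (1 / k)`, with `A` the rotation average of `σ`, whose local inverse is
the normalizing diffeomorphism. -/
noncomputable def normalizingInverse (k : ℕ) (ω : ℂ) (σ : ℂ → ℂ) (x : ℂ) : ℂ :=
  x * rotationAverage (k + 1) ω σ x ^ ((k : ℂ)⁻¹)

theorem normalizingInverse_pow {k : ℕ} (hk : k ≠ 0) (ω : ℂ) (σ : ℂ → ℂ) (x : ℂ) :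
    normalizingInverse k ω σ x ^ k = x ^ k * rotationAverage (k + 1) ω σ x := by
  rw [normalizingInverse, mul_pow, Complex.cpow_nat_inv_pow _ hk]

theorem normalizingInverse_rotate {k : ℕ} {ω : ℂ} (hω : ω ^ (k + 1) = 1) (σ : ℂ → ℂ) (x : ℂ) :
    normalizingInverse k ω σ (ω * x) = ω * normalizingInverse k ω σ x := by
  rw [normalizingInverse, rotationAverage_rotate hω, normalizingInverse, mul_assoc]

theorem analyticAt_rotationAverage_cpow {k : ℕ} (ω : ℂ) {σ : ℂ → ℂ} (hσ : AnalyticAt ℂ σ 0)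
    (hσ0 : σ 0 = 1) :
    AnalyticAt ℂ (fun x => rotationAverage (k + 1) ω σ x ^ ((k : ℂ)⁻¹)) 0 := by
  refine (hσ.rotationAverage _ _).cpow analyticAt_const ?_
  rw [rotationAverage_zero k.succ_ne_zero, hσ0]
  exact Complex.one_mem_slitPlane

theorem analyticAt_normalizingInverse (k : ℕ) (ω : ℂ) {σ : ℂ → ℂ} (hσ : AnalyticAt ℂ σ 0)
    (hσ0 : σ 0 = 1) : AnalyticAt ℂ (normalizingInverse k ω σ) 0 :=
  analyticAt_id.mul (analyticAt_rotationAverage_cpow ω hσ hσ0)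

theorem hasStrictDerivAt_normalizingInverse (k : ℕ) (ω : ℂ) {σ : ℂ → ℂ}
    (hσ : AnalyticAt ℂ σ 0) (hσ0 : σ 0 = 1) :
    HasStrictDerivAt (normalizingInverse k ω σ) 1 0 := by
  have h := (hasStrictDerivAt_id (0 : ℂ)).mul
    (analyticAt_rotationAverage_cpow (k := k) ω hσ hσ0).hasStrictDerivAt
  simpa [rotationAverage_zero, hσ0] using! h

theorem analyticAt_mul_comp_pow {N : ℕ} (hN : N ≠ 0) {g : ℂ → ℂ} (hg : AnalyticAt ℂ g 0) :
    AnalyticAt ℂ (fun η => η * g (η ^ N)) 0 := by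
  have h : AnalyticAt ℂ g (0 ^ N) := by simpa [hN] using hg
  exact analyticAt_id.mul (h.fun_comp (f := fun z => z ^ N) (by fun_prop))

theorem twistedRotationSum_comp {k : ℕ} {ω : ℂ} (hω : ω ^ (k + 1) = 1) (σ g : ℂ → ℂ) (η : ℂ) :
    twistedRotationSum (k + 1) ω (fun η : ℂ =>
      ((k : ℂ) + 1) * (η * g (η ^ (k + 1))) ^ k * σ (η * g (η ^ (k + 1)))) η =
      ((k : ℂ) + 1) ^ 2 * ((η * g (η ^ (k + 1))) ^ k *
        rotationAverage (k + 1) ω σ (η * g (η ^ (k + 1)))) := by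
  have hk : (k : ℂ) + 1 ≠ 0 := by exact_mod_cast k.succ_ne_zero
  have hscale (S : ℂ) : ((k : ℂ) + 1) ^ 2 * ((η * g (η ^ (k + 1))) ^ k * (S / ((k : ℂ) + 1))) =
      ((k : ℂ) + 1) * (η * g (η ^ (k + 1))) ^ k * S := by
    field_simp
  rw [twistedRotationSum, rotationAverage, Nat.cast_succ, hscale, Finset.mul_sum]
  refine Finset.sum_congr rfl fun i _ => ?_
  have h1 : (ω ^ i) ^ (k + 1) = 1 := by rw [← pow_mul, mul_comm, pow_mul, hω, one_pow]
  have h2 : ω ^ i * (ω ^ i) ^ k = 1 := by rw [← pow_succ', h1]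
  rw [mul_pow (ω ^ i) η (k + 1), h1, one_mul]
  rw [mul_assoc (ω ^ i) η, mul_pow (ω ^ i)]
  linear_combination (((k : ℂ) + 1) * (η * g (η ^ (k + 1))) ^ k *
    σ (ω ^ i * (η * g (η ^ (k + 1))))) * h2

theorem eventually_eq_one_of_pow_eq_one {α : Type*} {l : Filter α} {u : α → ℂ} {k : ℕ}
    (hk : k ≠ 0) (hu : Tendsto u l (𝓝 1)) (h : ∀ᶠ x in l, u x ^ k = 1) : ∀ᶠ x in l, u x = 1 := by
  have harg : Tendsto (fun x => (u x).arg) l (𝓝 0) := by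
    simpa [Function.comp_def] using (Complex.continuousAt_arg Complex.one_mem_slitPlane).tendsto.comp hu
  have hpos : 0 < Real.pi / k := div_pos Real.pi_pos (by positivity)
  filter_upwards [h, harg.eventually_const_lt (neg_lt_zero.2 hpos),
    harg.eventually_lt_const hpos] with x hx h1 h2
  have h3 := Complex.pow_cpow_nat_inv hk h1 h2.le
  rwa [hx, Complex.one_cpow, eq_comm] at h3

theorem killsResonantTerms_iff {k : ℕ} (hk : k ≠ 0) {ω : ℂ} (hω : IsPrimitiveRoot ω (k + 1))
    {σ g : ℂ → ℂ} (hσ : AnalyticAt ℂ σ 0) (hσ0 : σ 0 = 1) (hg : AnalyticAt ℂ g 0)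
    (hg0 : g 0 = 1) :
    KillsResonantTerms k σ g ↔
      ∀ᶠ η in 𝓝 (0 : ℂ), normalizingInverse k ω σ (η * g (η ^ (k + 1))) = η := by
  have hh := analyticAt_mul_comp_pow k.succ_ne_zero hg
  have hk1 : (k : ℂ) + 1 ≠ 0 := by exact_mod_cast k.succ_ne_zero
  have hσh : AnalyticAt ℂ (fun η => σ (η * g (η ^ (k + 1)))) 0 := by
    refine AnalyticAt.fun_comp ?_ hh
    simpa using hσ
  have hf : AnalyticAt ℂ (fun η : ℂ =>
      ((k : ℂ) + 1) * (η * g (η ^ (k + 1))) ^ k * σ (η * g (η ^ (k + 1)))) 0 :=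
    (analyticAt_const.mul (hh.pow k)).mul hσh
  rw [KillsResonantTerms, forall_iteratedDeriv_eq_zero_iff hf hω]
  simp only [twistedRotationSum_comp hω.pow_eq_one, ← normalizingInverse_pow hk]
  constructor
  · rintro ⟨c, hc⟩
    have hroot := analyticAt_rotationAverage_cpow (k := k) ω hσ hσ0
    set u : ℂ → ℂ := fun η => g (η ^ (k + 1)) *
      rotationAverage (k + 1) ω σ (η * g (η ^ (k + 1))) ^ ((k : ℂ)⁻¹) with hu
    have hfac : ∀ η, normalizingInverse k ω σ (η * g (η ^ (k + 1))) = η * u η := fun η => by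
      simp only [normalizingInverse, hu, mul_assoc]
    have hu1 : Tendsto u (𝓝 0) (𝓝 1) := by
      have h1 : Tendsto (fun η : ℂ => g (η ^ (k + 1))) (𝓝 0) (𝓝 1) := by
        have := hg.continuousAt.tendsto
        rw [hg0] at this
        exact this.comp (tendsto_pow_nhds_zero k.succ_ne_zero)
      have h2 : Tendsto (fun η : ℂ => η * g (η ^ (k + 1))) (𝓝 0) (𝓝 0) := by
        simpa using hh.continuousAt.tendsto
      have h3 := hroot.continuousAt.tendsto
      simp only [rotationAverage_zero k.succ_ne_zero, hσ0, Complex.one_cpow] at h3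
      simpa using h1.mul (h3.comp h2)
    have hev : ∀ᶠ η in 𝓝[≠] (0 : ℂ), u η ^ k = c / ((k : ℂ) + 1) ^ 2 := by
      filter_upwards [hc.filter_mono nhdsWithin_le_nhds, self_mem_nhdsWithin] with η h1 h2
      rw [hfac, mul_pow] at h1
      rw [eq_div_iff (pow_ne_zero 2 hk1)]
      apply mul_right_cancel₀ (pow_ne_zero k h2)
      linear_combination h1
    have hu1' := hu1.mono_left (nhdsWithin_le_nhds (s := {(0 : ℂ)}ᶜ))
    have hlim : c / ((k : ℂ) + 1) ^ 2 = 1 := by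
      refine tendsto_nhds_unique (tendsto_const_nhds.congr' ?_) (by simpa using hu1'.pow k)
      filter_upwards [hev] with η h using h.symm
    rw [hlim] at hev
    have h := eventually_nhdsWithin_iff.1 (eventually_eq_one_of_pow_eq_one hk hu1' hev)
    filter_upwards [h] with η h
    rw [hfac]
    rcases eq_or_ne η 0 with rfl | h0
    · simp
    · rw [h h0, mul_one]
  · intro h
    refine ⟨((k : ℂ) + 1) ^ 2, ?_⟩
    filter_upwards [h] with η h
    rw [h]

/-- For every `λ(δ) = (k+1)·δ^k·σ(δ)` with `σ` analytic near `0` and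
`σ(0) = 1`, there exists a unique (as a germ at `0`) analytic `g` with `g(0) = 1` such that
the tangent-to-identity diffeomorphism `h(η) = η·g(η^{k+1})` kills all coefficients of
`η^{k+m(k+1)}`, `m ≥ 1`, in the Taylor expansion of `λ∘h` at `0`. -/
theorem statement9 (k : ℕ) (hk : 1 ≤ k) (σ : ℂ → ℂ)
    (hσ : AnalyticAt ℂ σ 0) (hσ0 : σ 0 = 1) :
    ∃ g : ℂ → ℂ, (AnalyticAt ℂ g 0 ∧ g 0 = 1 ∧ KillsResonantTerms k σ g) ∧
      ∀ g' : ℂ → ℂ, (AnalyticAt ℂ g' 0 ∧ g' 0 = 1 ∧ KillsResonantTerms k σ g') →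
        ∀ᶠ η in nhds (0 : ℂ), g' η = g η := by
  have hk0 : k ≠ 0 := by omega
  obtain ⟨ω, hω⟩ : ∃ ω : ℂ, IsPrimitiveRoot ω (k + 1) :=
    ⟨_, Complex.isPrimitiveRoot_exp (k + 1) k.succ_ne_zero⟩
  have hω0 : ω ≠ 0 := hω.ne_zero k.succ_ne_zero
  set φ := normalizingInverse k ω σ with hφ
  have hφa : AnalyticAt ℂ φ 0 := analyticAt_normalizingInverse k ω hσ hσ0
  have hφd : HasStrictDerivAt φ 1 0 := hasStrictDerivAt_normalizingInverse k ω hσ hσ0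
  have hφ0 : φ 0 = 0 := by simp [hφ, normalizingInverse]
  obtain ⟨h, hha, hhd, hleft, hright⟩ : ∃ h : ℂ → ℂ, AnalyticAt ℂ h 0 ∧ HasStrictDerivAt h 1 0 ∧
      (∀ᶠ x in 𝓝 (0 : ℂ), h (φ x) = x) ∧ ∀ᶠ x in 𝓝 (0 : ℂ), φ (h x) = x := by
    have hd0 : deriv φ 0 ≠ 0 := by simp [hφd.hasDerivAt.deriv]
    have e := hφa.hasStrictDerivAt.hasStrictFDerivAt_equiv hd0
    refine ⟨hφa.hasStrictDerivAt.localInverse _ _ _ hd0, ?_, ?_,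
      e.eventually_left_inverse, ?_⟩
    · simpa only [hφ0] using hφa.analyticAt_localInverse hd0
    · simpa only [hφ0, hφd.hasDerivAt.deriv, inv_one] using
        hφa.hasStrictDerivAt.to_localInverse hd0
    · simpa only [hφ0] using e.eventually_right_inverse
  have hh0 : h 0 = 0 := by simpa [hφ0] using hleft.self_of_nhds
  have hht : Tendsto h (𝓝 0) (𝓝 0) := by simpa [hh0] using hha.continuousAt.tendsto
  have hrot : ∀ᶠ η in 𝓝 (0 : ℂ), h (ω * η) = ω * h η := by
    filter_upwards [hright, ((tendsto_const_mul_nhds_zero ω).comp hht).eventually hleft]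
      with η h1 h2
    simp only [Function.comp_apply] at h2
    rwa [hφ, normalizingInverse_rotate hω.pow_eq_one, ← hφ, h1] at h2
  have hy : AnalyticAt ℂ (dslope h 0) 0 := by
    obtain ⟨p, hp⟩ := hha
    exact hp.has_fpower_series_dslope_fslope.analyticAt
  have hyh : ∀ η, η * dslope h 0 η = h η := fun η => by
    simpa [hh0] using sub_smul_dslope h 0 η
  obtain ⟨g, hg, hgy⟩ := hy.exists_eq_comp_pow k.succ_ne_zero hω (by
    filter_upwards [hrot] with η h1
    rcases eq_or_ne η 0 with rfl | h0
    · simp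
    · apply mul_left_cancel₀ (mul_ne_zero hω0 h0)
      rw [hyh, h1, mul_assoc, hyh])
  have hg0 : g 0 = 1 := by
    simpa [dslope_same, hhd.hasDerivAt.deriv] using hgy.self_of_nhds.symm
  refine ⟨g, ⟨hg, hg0, (killsResonantTerms_iff hk0 hω hσ hσ0 hg hg0).2 ?_⟩, ?_⟩
  · filter_upwards [hgy, hright] with η h1 h2
    rwa [← h1, hyh]
  · rintro g' ⟨hg', hg'0, hkill⟩
    have h1 := (killsResonantTerms_iff hk0 hω hσ hσ0 hg' hg'0).1 hkill
    have h2 : Tendsto (fun η : ℂ => η * g' (η ^ (k + 1))) (𝓝 0) (𝓝 0) := by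
      simpa using (analyticAt_mul_comp_pow k.succ_ne_zero hg').continuousAt.tendsto
    have h3 : ∀ᶠ η in 𝓝 (0 : ℂ), g' (η ^ (k + 1)) = g (η ^ (k + 1)) := by
      filter_upwards [h1, h2.eventually hleft, hgy] with η e1 e2 e3
      rcases eq_or_ne η 0 with rfl | h0
      · simp [hg0, hg'0]
      · rw [← hφ] at e1
        rw [e1, ← hyh, e3] at e2
        exact (mul_left_cancel₀ h0 e2).symm
    filter_upwards [(tendsto_cpow_nat_inv_nhds_zero k.succ_ne_zero).eventually h3] with t ht
    rwa [Complex.cpow_nat_inv_pow t k.succ_ne_zero] at ht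
end

section
/- Let k ≥ 1 and let ω(z,ε) = (z^{k+1} − ε)·v(z,ε) and ω̃(z,ε) = (z^{k+1} − ε)·ṽ(z,ε) be two factored families of codimension k that are normalized so that v(0,0) = 1 and ṽ(0,0) = 1. Suppose α, β ∈ ℂ*, γ ∈ ℂ are such that the linear change of coordinate and parameter (z,ε) ↦ (βz + γε, αε) transforms ω into ω̃, i.e. β·ω(z,ε) = ω̃(βz + γε, αε) for all (z,ε) in a neighborhood of (0,0). Then β^k = 1, α = β, and γ = 0. In other words, the only linear changes of coordinate and parameter preserving the normalized factored form are (z,ε) ↦ (νz, νε) with ν a k-th root of unity. -/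
open Metric Set Filter Complex

/-- A function of two variables that is continuous at the origin tends to its value there along
any pair of functions tending to `0`. -/
theorem tendsto_comp_of_continuousAt_origin {ι : Type*} {l : Filter ι} {u : ℂ → ℂ → ℂ}
    (hu : ContinuousAt (fun p : ℂ × ℂ => u p.1 p.2) (0, 0)) {f g : ι → ℂ}
    (hf : Tendsto f l (nhds 0)) (hg : Tendsto g l (nhds 0)) :
    Tendsto (fun i => u (f i) (g i)) l (nhds (u 0 0)) :=
  hu.tendsto.comp (hf.prodMk_nhds hg)

/-- The `n`-th power map is injective near a nonzero point: if `w` tends to `b ≠ 0` and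
`w ^ n = b ^ n` eventually, with `n ≠ 0`, then `w = b` eventually. -/
theorem eventually_eq_of_pow_eq_pow {ι : Type*} {l : Filter ι} {w : ι → ℂ} {b : ℂ} {n : ℕ}
    (hn : n ≠ 0) (hb : b ≠ 0) (hw : Tendsto w l (nhds b)) (h : ∀ᶠ i in l, w i ^ n = b ^ n) :
    ∀ᶠ i in l, w i = b := by
  have hcont : Continuous fun x : ℂ => ∑ j ∈ Finset.range n, x ^ j * b ^ (n - 1 - j) := by
    fun_prop
  have hsum : (∑ j ∈ Finset.range n, b ^ j * b ^ (n - 1 - j)) ≠ 0 := by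
    rw [geom_sum₂_self]
    exact mul_ne_zero (Nat.cast_ne_zero.mpr hn) (pow_ne_zero _ hb)
  filter_upwards [h, ((hcont.tendsto b).comp hw).eventually_ne hsum] with i hi hne
  have hfac := geom_sum₂_mul (w i) b n
  rw [hi, sub_self] at hfac
  exact sub_eq_zero.mp ((mul_eq_zero.mp hfac).resolve_left hne)

/-- If a linear change of coordinate and parameter
`(z,ε) ↦ (βz + γε, αε)` transforms the normalized factored family `(z^{k+1}−ε)·v(z,ε)`
(`v(0,0) = 1`) into the normalized factored family `(z^{k+1}−ε)·ṽ(z,ε)` (`ṽ(0,0) = 1`),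
then `β^k = 1`, `α = β` and `γ = 0`. -/
theorem statement11 (k : ℕ) (hk : 1 ≤ k) (v tv : ℂ → ℂ → ℂ)
    (hv : AnalyticAt ℂ (fun p : ℂ × ℂ => v p.1 p.2) (0, 0)) (hv0 : v 0 0 = 1)
    (htv : AnalyticAt ℂ (fun p : ℂ × ℂ => tv p.1 p.2) (0, 0)) (htv0 : tv 0 0 = 1)
    (α β γ : ℂ) (hα : α ≠ 0) (hβ : β ≠ 0)
    (hconj : ∀ᶠ p : ℂ × ℂ in nhds (0, 0),
      β * ((p.1 ^ (k + 1) - p.2) * v p.1 p.2)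
        = ((β * p.1 + γ * p.2) ^ (k + 1) - α * p.2) * tv (β * p.1 + γ * p.2) (α * p.2)) :
    β ^ k = 1 ∧ α = β ∧ γ = 0 := by
  have hk0 : k ≠ 0 := by omega
  have hv := hv.continuousAt
  have htv := htv.continuousAt
  have lim {f : ℂ → ℂ} (hf : Continuous f) {a : ℂ} (h0 : f 0 = a) :
      Tendsto f (nhdsWithin 0 {0}ᶜ) (nhds a) :=
    h0 ▸ (hf.tendsto 0).mono_left nhdsWithin_le_nhds
  have hne : ∀ᶠ z : ℂ in nhdsWithin 0 {0}ᶜ, z ≠ 0 := self_mem_nhdsWithin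
  have hz : Tendsto (fun z : ℂ => z) (nhdsWithin 0 {0}ᶜ) (nhds 0) := lim continuous_id rfl
  have h0 : Tendsto (fun _ : ℂ => (0 : ℂ)) (nhdsWithin 0 {0}ᶜ) (nhds 0) := tendsto_const_nhds
  have hmul (c : ℂ) : Tendsto (fun z : ℂ => c * z) (nhdsWithin 0 {0}ᶜ) (nhds 0) :=
    lim (by fun_prop) (by simp)
  have hβk : β ^ k = 1 := by
    have hL := (tendsto_comp_of_continuousAt_origin hv hz h0).const_mul β
    have hR := (tendsto_comp_of_continuousAt_origin htv (hmul β) h0).const_mul (β ^ (k + 1))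
    have hEq := tendsto_nhds_unique_of_eventuallyEq hL hR (by
      filter_upwards [(hz.prodMk_nhds h0).eventually hconj, hne] with z hzc hz0
      simp only [mul_zero, add_zero, sub_zero, mul_pow] at hzc
      exact mul_left_cancel₀ (pow_ne_zero (k + 1) hz0) (by linear_combination hzc))
    rw [hv0, htv0, mul_one, mul_one, pow_succ] at hEq
    exact mul_right_cancel₀ hβ (by linear_combination -hEq)
  have hαβ : α = β := by
    have hL := (tendsto_comp_of_continuousAt_origin hv h0 hz).const_mul (-β)
    have hR := (lim (f := fun ε => γ ^ (k + 1) * ε ^ k - α) (by fun_prop) (a := -α)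
      (by simp [hk0])).mul (tendsto_comp_of_continuousAt_origin htv (hmul γ) (hmul α))
    have hEq := tendsto_nhds_unique_of_eventuallyEq hL hR (by
      filter_upwards [(h0.prodMk_nhds hz).eventually hconj, hne] with ε hε hε0
      simp only [mul_zero, zero_add, mul_pow, zero_pow (Nat.succ_ne_zero k), zero_sub] at hε
      exact mul_left_cancel₀ hε0 (by linear_combination hε))
    rw [hv0, htv0, mul_one, mul_one] at hEq
    exact (neg_injective hEq).symm
  refine ⟨hβk, hαβ, ?_⟩
  subst hαβ
  have hpow : Tendsto (fun z : ℂ => z ^ (k + 1)) (nhdsWithin 0 {0}ᶜ) (nhds 0) :=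
    lim (by fun_prop) (by simp)
  have htv_ne := (tendsto_comp_of_continuousAt_origin htv
    (lim (f := fun z => α * z + γ * z ^ (k + 1)) (by fun_prop) (by simp))
    (lim (f := fun z => α * z ^ (k + 1)) (by fun_prop) (by simp))).eventually_ne
    (htv0.trans_ne one_ne_zero)
  have hw := eventually_eq_of_pow_eq_pow (w := fun z => α + γ * z ^ k) k.succ_ne_zero hα
    (lim (by fun_prop) (by simp [hk0])) (by
      filter_upwards [(hz.prodMk_nhds hpow).eventually hconj, hne, htv_ne] with z hzc hz0 htz
      simp only [sub_self, zero_mul, mul_zero] at hzc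
      have hfac := (mul_eq_zero.mp hzc.symm).resolve_right htz
      rw [show α * z + γ * z ^ (k + 1) = z * (α + γ * z ^ k) by ring, mul_pow] at hfac
      refine mul_left_cancel₀ (pow_ne_zero (k + 1) hz0) ?_
      rw [Nat.succ_eq_add_one, pow_succ α, hβk]
      linear_combination hfac)
  obtain ⟨z, hzw, hz0⟩ := (hw.and hne).exists
  exact (mul_eq_zero.mp (add_eq_left.mp hzw)).resolve_right (pow_ne_zero k hz0)
end
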